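/- arXiv:math/0501063 — 2 statements merged into one kernel-verified Lean document; each statement's English description precedes it below -/
import Mathlib

section
/- Let (R, m) be a commutative Noetherian local ring, a an ideal, and M a finitely generated R-module of dimension n with H_a^n(M) ≠ 0. Then there exists a finitely generated module K over the m-adic completion R̂ which is a quotient of the completion M̂, such that Ass_{R̂}(K) = Att_{R̂}(H_a^n(M)) and H_a^n(M) ≅ H_{mR̂}^n(K) as R̂-modules. -/
noncomputable section

universe u

open CategoryTheory

/-- The `i`-th local cohomology of a module with respect to an ideal. -/
abbrev LC {R : Type u} [CommRing R] (J : Ideal R) (i : ℕ) (M : Type u)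
    [AddCommGroup M] [Module R M] : ModuleCat.{u} R :=
  (localCohomology J i).obj (ModuleCat.of R M)

/-- Attached primes of a module: primes of the form `Ann(T/U)`. -/
def Att (R : Type u) [CommRing R] (T : Type u) [AddCommGroup T] [Module R T] :
    Set (Ideal R) :=
  { p | p.IsPrime ∧ ∃ U : Submodule R T, p = Module.annihilator R (T ⧸ U) }

/-- Krull dimension of a module, as the Krull dimension of its support. -/
def mdim (R : Type u) [CommRing R] (M : Type u) [AddCommGroup M] [Module R M] :
    WithBot ℕ∞ :=
  Order.krullDim (Module.support R M)

/-- Cohomological dimension of `M` with respect to `J`: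
the supremum of the `i` with `H_J^i(M) ≠ 0` (`⊥` if there are none). -/
def cohDim (R : Type u) [CommRing R] (J : Ideal R) (M : Type u)
    [AddCommGroup M] [Module R M] : WithBot ℕ∞ :=
  sSup { x | ∃ i : ℕ, x = (i : ℕ∞) ∧ Nontrivial (LC J i M) }

noncomputable section


open CategoryTheory

namespace LCX

variable {R : Type u} [CommRing R]

/-- transition map of quotients by powers -/
def fac (a : Ideal R) {s t : ℕ} (h : s ≤ t) :
    ModuleCat.of R (R ⧸ a ^ t) ⟶ ModuleCat.of R (R ⧸ a ^ s) :=
  ModuleCat.ofHom (Submodule.mapQ _ _ LinearMap.id (Ideal.pow_le_pow_right h))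

lemma fac_comp (a : Ideal R) {s t r : ℕ} (h : s ≤ t) (h' : t ≤ r) :
    fac a h' ≫ fac a h = fac a (h.trans h') := by
  refine ModuleCat.hom_ext (LinearMap.ext fun x => ?_)
  obtain ⟨x, rfl⟩ := Submodule.mkQ_surjective _ x
  rfl

lemma fac_self (a : Ideal R) (s : ℕ) : fac a (le_refl s) = 𝟙 _ := by
  refine ModuleCat.hom_ext (LinearMap.ext fun x => ?_)
  obtain ⟨x, rfl⟩ := Submodule.mkQ_surjective _ x
  rfl

/-- Ext groups entering local cohomology -/
abbrev EX (a : Ideal R) (i : ℕ) (N : Type u) [AddCommGroup N] [Module R N] (t : ℕ) : Type u :=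
  Abelian.Ext.{u} (ModuleCat.of R (R ⧸ a ^ t)) (ModuleCat.of R N) i

section
variable (a : Ideal R) (i : ℕ) (N : Type u) [AddCommGroup N] [Module R N]

/-- transition maps -/
def tr (s t : ℕ) (h : s ≤ t) : EX a i N s →ₗ[R] EX a i N t :=
  (Abelian.Ext.mk₀ (fac a h)).precompOfLinear R (ModuleCat.of R N) (zero_add i)

lemma tr_apply {s t : ℕ} (h : s ≤ t) (x : EX a i N s) :
    tr a i N s t h x = (Abelian.Ext.mk₀ (fac a h)).comp x (zero_add i) := rfl

instance : DirectedSystem (EX a i N) (tr a i N · · ·) where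
  map_self s x := by
    rw [tr_apply, fac_self, Abelian.Ext.mk₀_id_comp]
  map_map r t s h h' x := by
    rw [tr_apply, tr_apply, tr_apply, Abelian.Ext.mk₀_comp_mk₀_assoc, fac_comp]

/-- local cohomology as a direct limit of new Ext. -/
def T : Type u := Module.DirectLimit (EX a i N) (tr a i N)

instance : AddCommGroup (T a i N) := inferInstanceAs (AddCommGroup (Module.DirectLimit _ _))
instance : Module R (T a i N) := inferInstanceAs (Module R (Module.DirectLimit _ _))

/-- the canonical map -/
def ofT (t : ℕ) : EX a i N t →ₗ[R] T a i N := Module.DirectLimit.of R ℕ _ (tr a i N) t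

variable {a i N}

lemma ofT_tr {s t : ℕ} (h : s ≤ t) (x : EX a i N s) :
    ofT a i N t (tr a i N s t h x) = ofT a i N s x := Module.DirectLimit.of_f

lemma exists_ofT (z : T a i N) : ∃ t x, ofT a i N t x = z := Module.DirectLimit.exists_of z

lemma ofT_eq_zero {t : ℕ} {x : EX a i N t} (h : ofT a i N t x = 0) :
    ∃ s, ∃ h : t ≤ s, tr a i N t s h x = 0 := Module.DirectLimit.of.zero_exact h

lemma exists_ofT_ge (z : T a i N) (r : ℕ) : ∃ t, r ≤ t ∧ ∃ x, ofT a i N t x = z := by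
  obtain ⟨t, x, rfl⟩ := exists_ofT z
  exact ⟨max r t, le_max_left _ _, tr a i N t _ (le_max_right _ _) x, ofT_tr _ _⟩

/-- lifting -/
def liftT {P : Type*} [AddCommGroup P] [Module R P] (g : ∀ t, EX a i N t →ₗ[R] P)
    (hg : ∀ s t h x, g t (tr a i N s t h x) = g s x) : T a i N →ₗ[R] P :=
  Module.DirectLimit.lift R ℕ _ _ g hg

@[simp] lemma liftT_ofT {P : Type*} [AddCommGroup P] [Module R P] (g : ∀ t, EX a i N t →ₗ[R] P)
    (hg : ∀ s t h x, g t (tr a i N s t h x) = g s x) (t : ℕ) (x : EX a i N t) :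
    liftT g hg (ofT a i N t x) = g t x := Module.DirectLimit.lift_of ..

end

section
variable (a : Ideal R) (i : ℕ) {N N' N'' : Type u} [AddCommGroup N] [Module R N]
  [AddCommGroup N'] [Module R N'] [AddCommGroup N''] [Module R N'']

/-- functoriality -/
def mapT (f : N →ₗ[R] N') : T a i N →ₗ[R] T a i N' :=
  liftT (fun t => ofT a i N' t ∘ₗ
    (Abelian.Ext.mk₀ (ModuleCat.ofHom f)).postcompOfLinear R _ (add_zero i)) (by
    intro s t h x
    rw [LinearMap.comp_apply, LinearMap.comp_apply, ← ofT_tr h, tr_apply, tr_apply]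
    congr 1
    exact Abelian.Ext.comp_assoc_of_third_deg_zero _ _ _ _)

variable {a i}

lemma mapT_ofT (f : N →ₗ[R] N') (t : ℕ) (x : EX a i N t) :
    mapT a i f (ofT a i N t x) =
      ofT a i N' t (x.comp (Abelian.Ext.mk₀ (ModuleCat.ofHom f)) (add_zero i)) :=
  liftT_ofT ..

lemma mapT_comp (f : N →ₗ[R] N') (g : N' →ₗ[R] N'') (z : T a i N) :
    mapT a i g (mapT a i f z) = mapT a i (g ∘ₗ f) z := by
  obtain ⟨t, x, rfl⟩ := exists_ofT z
  rw [mapT_ofT, mapT_ofT, mapT_ofT, Abelian.Ext.comp_assoc_of_third_deg_zero,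
    Abelian.Ext.mk₀_comp_mk₀]
  rfl

lemma mapT_id (z : T a i N) : mapT a i LinearMap.id z = z := by
  obtain ⟨t, x, rfl⟩ := exists_ofT z
  rw [mapT_ofT]
  congr 1
  exact Abelian.Ext.comp_mk₀_id x

lemma mapT_add (f g : N →ₗ[R] N') (z : T a i N) :
    mapT a i (f + g) z = mapT a i f z + mapT a i g z := by
  obtain ⟨t, x, rfl⟩ := exists_ofT z
  rw [mapT_ofT, mapT_ofT, mapT_ofT, ← map_add, ← Abelian.Ext.comp_add, ← Abelian.Ext.mk₀_add]
  rfl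

lemma mapT_smul (r : R) (f : N →ₗ[R] N') (z : T a i N) :
    mapT a i (r • f) z = r • mapT a i f z := by
  obtain ⟨t, x, rfl⟩ := exists_ofT z
  rw [mapT_ofT, mapT_ofT, ← map_smul, ← Abelian.Ext.comp_smul, ← Abelian.Ext.mk₀_smul]
  rfl

lemma mapT_lsmul (r : R) (z : T a i N) :
    mapT a i (LinearMap.lsmul R N r) z = r • z := by
  have : LinearMap.lsmul R N r = r • LinearMap.id := by ext; simp
  rw [this, mapT_smul, mapT_id]

lemma mapT_zero (z : T a i N) : mapT a i (0 : N →ₗ[R] N') z = 0 := by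
  have := mapT_smul (0 : R) (0 : N →ₗ[R] N') z
  simpa using this

/-- equivalences -/
def congrT (e : N ≃ₗ[R] N') : T a i N ≃ₗ[R] T a i N' :=
  LinearEquiv.ofLinearMap (mapT a i e) (mapT a i e.symm)
    (by ext z; simp [mapT_comp, mapT_id])
    (by ext z; simp [mapT_comp, mapT_id])

/-- the short exact short complex of an unbundled short exact sequence -/
abbrev sc (f : N →ₗ[R] N') (g : N' →ₗ[R] N'') (hfg : Function.Exact f g) :
    ShortComplex (ModuleCat.{u} R) :=
  ShortComplex.mk (ModuleCat.ofHom f) (ModuleCat.ofHom g) (by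
    ext x; exact hfg.apply_apply_eq_zero x)

lemma sc_exact (f : N →ₗ[R] N') (g : N' →ₗ[R] N'') (hf : Function.Injective f)
    (hfg : Function.Exact f g) (hg : Function.Surjective g) : (sc f g hfg).ShortExact where
  exact := by
    rw [ShortComplex.ShortExact.moduleCat_exact_iff_function_exact]
    exact hfg
  mono_f := by rw [ModuleCat.mono_iff_injective]; exact hf
  epi_g := by rw [ModuleCat.epi_iff_surjective]; exact hg

/-- Ext class of a short exact sequence. -/
def ecl {f : N →ₗ[R] N'} {g : N' →ₗ[R] N''} (hf : Function.Injective f)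
    (hfg : Function.Exact f g) (hg : Function.Surjective g) :
    Abelian.Ext.{u} (ModuleCat.of R N'') (ModuleCat.of R N) 1 :=
  (sc_exact f g hf hfg hg).extClass

variable (a i) in
/-- connecting map -/
def dT {f : N →ₗ[R] N'} {g : N' →ₗ[R] N''} (hf : Function.Injective f)
    (hfg : Function.Exact f g) (hg : Function.Surjective g) :
    T a i N'' →ₗ[R] T a (i + 1) N :=
  liftT (fun t => ofT a (i + 1) N t ∘ₗ
    (ecl hf hfg hg).postcompOfLinear R _ rfl) (by
    intro s t h x
    rw [LinearMap.comp_apply, LinearMap.comp_apply, ← ofT_tr h, tr_apply, tr_apply]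
    congr 1
    exact Abelian.Ext.comp_assoc _ _ _ (zero_add i) rfl (by omega))

variable {f : N →ₗ[R] N'} {g : N' →ₗ[R] N''} (hf : Function.Injective f)
    (hfg : Function.Exact f g) (hg : Function.Surjective g)

lemma dT_ofT (t : ℕ) (x : EX a i N'' t) :
    dT a i hf hfg hg (ofT a i N'' t x) =
      ofT a (i + 1) N t (x.comp (ecl hf hfg hg) rfl) :=
  liftT_ofT ..

include hf hfg hg in
lemma exact₂ : Function.Exact (mapT a i f) (mapT a i g) := by
  intro z
  constructor
  · intro hz
    obtain ⟨t, x, rfl⟩ := exists_ofT z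
    rw [mapT_ofT] at hz
    obtain ⟨s, hs, h0⟩ := ofT_eq_zero hz
    rw [tr_apply, ← Abelian.Ext.comp_assoc_of_third_deg_zero] at h0
    obtain ⟨y, hy⟩ := Abelian.Ext.covariant_sequence_exact₂ _ (sc_exact f g hf hfg hg) _ h0
    refine ⟨ofT a i N s y, ?_⟩
    refine (mapT_ofT _ s y).trans ?_
    rw [← ofT_tr hs]
    exact congrArg _ hy
  · rintro ⟨y, rfl⟩
    rw [mapT_comp, hfg.linearMap_comp_eq_zero, mapT_zero]

lemma exact₃ : Function.Exact (mapT a i g) (dT a i hf hfg hg) := by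
  intro z
  obtain ⟨t, x, rfl⟩ := exists_ofT z
  constructor
  · intro hz
    rw [dT_ofT] at hz
    obtain ⟨s, hs, h0⟩ := ofT_eq_zero hz
    rw [tr_apply, ← Abelian.Ext.comp_assoc _ _ _ (zero_add i) rfl (by omega)] at h0
    obtain ⟨y, hy⟩ := Abelian.Ext.covariant_sequence_exact₃ _ (sc_exact f g hf hfg hg) _ _ h0
    refine ⟨ofT a i N' s y, ?_⟩
    refine (mapT_ofT _ s y).trans ?_
    rw [← ofT_tr hs]
    exact congrArg _ hy
  · rintro ⟨y, hy⟩
    rw [← hy]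
    obtain ⟨t, x, rfl⟩ := exists_ofT y
    rw [mapT_ofT, dT_ofT, Abelian.Ext.comp_assoc_of_second_deg_zero]
    have : (Abelian.Ext.mk₀ (ModuleCat.ofHom g)).comp (ecl hf hfg hg) (zero_add 1) = 0 :=
      ShortComplex.ShortExact.comp_extClass (sc_exact f g hf hfg hg)
    rw [this, Abelian.Ext.comp_zero, map_zero]

lemma exact₁ : Function.Exact (dT a i hf hfg hg) (mapT a (i + 1) f) := by
  intro z
  obtain ⟨t, x, rfl⟩ := exists_ofT z
  constructor
  · intro hz
    rw [mapT_ofT] at hz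
    obtain ⟨s, hs, h0⟩ := ofT_eq_zero hz
    rw [tr_apply, ← Abelian.Ext.comp_assoc_of_third_deg_zero] at h0
    obtain ⟨y, hy⟩ := Abelian.Ext.covariant_sequence_exact₁ _ (sc_exact f g hf hfg hg) _ h0 rfl
    refine ⟨ofT a i N'' s y, ?_⟩
    refine (dT_ofT hf hfg hg s y).trans ?_
    rw [← ofT_tr hs]
    exact congrArg _ hy
  · rintro ⟨y, hy⟩
    rw [← hy]
    obtain ⟨t, x, rfl⟩ := exists_ofT y
    rw [dT_ofT, mapT_ofT, Abelian.Ext.comp_assoc_of_third_deg_zero]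
    have : (ecl hf hfg hg).comp (Abelian.Ext.mk₀ (ModuleCat.ofHom f)) (add_zero 1) = 0 :=
      ShortComplex.ShortExact.extClass_comp (sc_exact f g hf hfg hg)
    rw [this, Abelian.Ext.comp_zero, map_zero]

include hf in
lemma inj₀ : Function.Injective (mapT a 0 f) := by
  rw [injective_iff_map_eq_zero]
  intro z hz
  obtain ⟨t, x, rfl⟩ := exists_ofT z
  rw [mapT_ofT] at hz
  obtain ⟨s, hs, h0⟩ := ofT_eq_zero hz
  rw [tr_apply, ← Abelian.Ext.comp_assoc_of_third_deg_zero] at h0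
  have : Mono (ModuleCat.ofHom f) := by rw [ModuleCat.mono_iff_injective]; exact hf
  rw [← ofT_tr hs, tr_apply]
  rw [Abelian.Ext.postcomp_mk₀_injective_of_mono _ (ModuleCat.ofHom f)
    (a₁ := (Abelian.Ext.mk₀ (fac a hs)).comp x (zero_add 0)) (a₂ := 0) (by simpa using h0), map_zero]

/-- torsion -/
lemma torsionT (z : T a i N) : ∃ t, ∀ r ∈ a ^ t, r • z = 0 := by
  obtain ⟨t, x, rfl⟩ := exists_ofT z
  refine ⟨t, fun r hr => ?_⟩
  rw [← map_smul]
  have h1 : r • x = (Abelian.Ext.mk₀ (r • 𝟙 (ModuleCat.of R (R ⧸ a ^ t)))).comp x (zero_add i) := by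
    rw [Abelian.Ext.mk₀_smul, Abelian.Ext.smul_comp, Abelian.Ext.mk₀_id_comp]
  have h2 : r • 𝟙 (ModuleCat.of R (R ⧸ a ^ t)) = 0 := by
    refine ModuleCat.hom_ext (LinearMap.ext fun y => ?_)
    obtain ⟨y, rfl⟩ := Submodule.mkQ_surjective _ y
    change r • (Submodule.mkQ (a ^ t) y) = 0
    rw [← map_smul, Submodule.mkQ_apply, Submodule.Quotient.mk_eq_zero]
    exact Ideal.mul_mem_right _ _ hr
  rw [h1, h2, Abelian.Ext.mk₀_zero, Abelian.Ext.zero_comp, map_zero]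

lemma torsionT_pow {x : R} (hx : x ∈ a) (z : T a i N) : ∃ k : ℕ, x ^ k • z = 0 := by
  obtain ⟨t, ht⟩ := torsionT z
  exact ⟨t, ht _ (Ideal.pow_mem_pow hx t)⟩

end

end LCX

end

noncomputable section


open CategoryTheory

namespace LCX

variable {R : Type u} [CommRing R]

section
variable (a : Ideal R) {N N' : Type u} [AddCommGroup N] [Module R N]
  [AddCommGroup N'] [Module R N']

variable (N) in
/-- evaluation at 1 -/
def evT : T a 0 N →ₗ[R] N :=
  liftT (fun t =>
    { toFun := fun x => (Abelian.Ext.linearEquiv₀ (R := R) x).hom (Submodule.Quotient.mk 1)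
      map_add' := fun x y => by simp
      map_smul' := fun r x => by simp }) (by
    intro s t h x
    obtain ⟨f, rfl⟩ := (Abelian.Ext.linearEquiv₀ (R := R)).symm.surjective x
    simp only [tr_apply, Abelian.Ext.linearEquiv₀_symm_apply]
    erw [Abelian.Ext.mk₀_comp_mk₀]
    rw [LinearMap.coe_mk, LinearMap.coe_mk, AddHom.coe_mk, AddHom.coe_mk]
    erw [← Abelian.Ext.linearEquiv₀_symm_apply (R := R), ← Abelian.Ext.linearEquiv₀_symm_apply (R := R)]
    rw [LinearEquiv.apply_symm_apply, LinearEquiv.apply_symm_apply]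
    rfl)

variable {a}

lemma evT_mk₀ (t : ℕ) (f : ModuleCat.of R (R ⧸ a ^ t) ⟶ ModuleCat.of R N) :
    evT a N (ofT a 0 N t (Abelian.Ext.mk₀ f)) = f.hom (Submodule.Quotient.mk 1) := by
  refine (liftT_ofT ..).trans ?_
  rw [LinearMap.coe_mk, AddHom.coe_mk]
  erw [← Abelian.Ext.linearEquiv₀_symm_apply (R := R)]
  rw [LinearEquiv.apply_symm_apply]

lemma exists_ofT₀ (z : T a 0 N) :
    ∃ t, ∃ f : ModuleCat.of R (R ⧸ a ^ t) ⟶ ModuleCat.of R N,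
      ofT a 0 N t (Abelian.Ext.mk₀ f) = z := by
  obtain ⟨t, x, rfl⟩ := exists_ofT z
  exact ⟨t, Abelian.Ext.linearEquiv₀ (R := R) x, by simp⟩

lemma evT_mapT (f : N →ₗ[R] N') (z : T a 0 N) : evT a N' (mapT a 0 f z) = f (evT a N z) := by
  obtain ⟨t, x, rfl⟩ := exists_ofT₀ z
  rw [mapT_ofT, Abelian.Ext.mk₀_comp_mk₀, evT_mk₀, evT_mk₀]
  rfl

lemma evT_injective : Function.Injective (evT a N) := by
  rw [injective_iff_map_eq_zero]
  intro z hz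
  obtain ⟨t, f, rfl⟩ := exists_ofT₀ z
  rw [evT_mk₀] at hz
  have : f = 0 := by
    refine ModuleCat.hom_ext (LinearMap.ext fun y => ?_)
    obtain ⟨y, rfl⟩ := Submodule.mkQ_surjective _ y
    have : (Submodule.mkQ (a ^ t) y) = y • (Submodule.Quotient.mk 1 : R ⧸ a ^ t) := by
      rw [← Submodule.Quotient.mk_smul]; simp
    rw [this]
    refine (map_smul f.hom y _).trans ?_
    rw [hz, smul_zero]; rfl
  rw [this, Abelian.Ext.mk₀_zero, map_zero]

variable (a N) in
/-- the a-torsion submodule -/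
def ators : Submodule R N where
  carrier := {n | ∃ t, ∀ r ∈ a ^ t, r • n = 0}
  zero_mem' := ⟨0, by simp⟩
  add_mem' := by
    rintro x y ⟨s, hs⟩ ⟨t, ht⟩
    refine ⟨s + t, fun r hr => ?_⟩
    rw [smul_add, hs r (Ideal.pow_le_pow_right (by omega) hr),
      ht r (Ideal.pow_le_pow_right (by omega) hr), add_zero]
  smul_mem' := by
    rintro c x ⟨s, hs⟩
    exact ⟨s, fun r hr => by rw [smul_comm, hs r hr, smul_zero]⟩

lemma mem_ators {n : N} : n ∈ ators a N ↔ ∃ t, ∀ r ∈ a ^ t, r • n = 0 := Iff.rfl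

lemma range_evT : LinearMap.range (evT a N) = ators a N := by
  apply le_antisymm
  · rintro _ ⟨z, rfl⟩
    obtain ⟨t, ht⟩ := torsionT z
    exact ⟨t, fun r hr => by rw [← map_smul, ht r hr, map_zero]⟩
  · rintro n ⟨t, ht⟩
    refine ⟨ofT a 0 N t (Abelian.Ext.mk₀ (ModuleCat.ofHom
      (Submodule.liftQ (a ^ t) (LinearMap.toSpanSingleton R N n) fun r hr => ht r hr))), ?_⟩
    rw [evT_mk₀]
    change (1 : R) • n = n
    exact one_smul _ _

/-- the module is a-torsion -/
def IsATors (a : Ideal R) (N : Type u) [AddCommGroup N] [Module R N] : Prop :=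
  ∀ n : N, ∃ t, ∀ r ∈ a ^ t, r • n = 0

lemma evT_bijective (h : IsATors a N) : Function.Bijective (evT a N) := by
  refine ⟨evT_injective, ?_⟩
  rw [← LinearMap.range_eq_top, range_evT, eq_top_iff]
  exact fun n _ => h n

lemma IsATors.of_surjective (h : IsATors a N) (f : N →ₗ[R] N') (hf : Function.Surjective f) :
    IsATors a N' := by
  intro n
  obtain ⟨n, rfl⟩ := hf n
  obtain ⟨t, ht⟩ := h n
  exact ⟨t, fun r hr => by rw [← map_smul, ht r hr, map_zero]⟩

lemma IsATors.of_injective (h : IsATors a N') (f : N →ₗ[R] N') (hf : Function.Injective f) :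
    IsATors a N := by
  intro n
  obtain ⟨t, ht⟩ := h (f n)
  exact ⟨t, fun r hr => hf (by rw [map_smul, ht r hr, map_zero])⟩

lemma isATors_T (i : ℕ) : IsATors a (T a i N) := torsionT

lemma exists_pow_fg [IsNoetherianRing R] (a : Ideal R) {J : Submodule R N} (hJ : J.FG)
    (h : J ≤ ators a N) : ∃ t, ∀ r ∈ a ^ t, ∀ n ∈ J, r • n = 0 := by
  obtain ⟨s, rfl⟩ := hJ
  have : ∀ n ∈ s, ∃ t, ∀ r ∈ a ^ t, r • n = 0 := fun n hn => h (Submodule.subset_span hn)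
  choose! t ht using this
  refine ⟨s.sup t, fun r hr n hn => ?_⟩
  have : Submodule.span R (s : Set N) ≤ LinearMap.ker (LinearMap.lsmul R N r) := by
    rw [Submodule.span_le]
    intro n hn
    exact ht n hn r (Ideal.pow_le_pow_right (Finset.le_sup hn) hr)
  exact this hn

lemma baer_ators [IsNoetherianRing R] (a : Ideal R) (hI : Module.Injective R N) :
    Module.Injective R (ators a N) := by
  apply Module.Baer.injective
  intro J g
  have hrange : (LinearMap.range ((ators a N).subtype ∘ₗ g)).FG := by
    have : (LinearMap.range ((ators a N).subtype ∘ₗ g)) = (⊤ : Submodule R J).map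
      ((ators a N).subtype ∘ₗ g) := LinearMap.range_eq_map _
    rw [this]
    exact Submodule.FG.map _ (Module.Finite.fg_top)
  obtain ⟨t, ht⟩ := exists_pow_fg a hrange (by
    rintro _ ⟨x, rfl⟩
    exact (g x).2)
  obtain ⟨k, hk⟩ := Ideal.exists_pow_inf_eq_pow_smul a (J : Submodule R R)
  have hk := hk (k + t) (by omega)
  let φ : J →ₗ[R] (R ⧸ a ^ (k + t)) := (Submodule.mkQ (a ^ (k + t))) ∘ₗ J.subtype
  have hker : LinearMap.ker φ ≤ LinearMap.ker ((ators a N).subtype ∘ₗ g) := by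
    intro x hx
    have hx' : (x : R) ∈ a ^ (k + t) := by
      have : Submodule.Quotient.mk (p := a ^ (k + t)) (x : R) = 0 := hx
      rwa [Submodule.Quotient.mk_eq_zero] at this
    have h1 : (x : R) ∈ (a ^ (k + t) • (⊤ : Submodule R R)) ⊓ J := by
      refine ⟨?_, x.2⟩
      simpa using hx'
    rw [hk] at h1
    have h2 : (x : R) ∈ a ^ t • J := by
      have e : k + t - k = t := by omega
      rw [e] at h1
      exact Submodule.smul_mono le_rfl inf_le_right h1
    have h3 : a ^ t • J ≤ (LinearMap.ker ((ators a N).subtype ∘ₗ g)).map J.subtype := by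
      rw [Submodule.smul_le]
      intro r hr n hn
      refine ⟨r • ⟨n, hn⟩, ?_, rfl⟩
      change ((ators a N).subtype ∘ₗ g) _ = 0
      rw [map_smul]
      exact ht r hr _ ⟨_, rfl⟩
    obtain ⟨y, hy, hyx⟩ := h3 h2
    have : y = x := Subtype.ext hyx
    rwa [← this]
  obtain ⟨h, hh⟩ := hI.out (Submodule.liftQ (LinearMap.ker φ) φ le_rfl)
    (by
      rw [← LinearMap.ker_eq_bot]
      exact Submodule.ker_liftQ_eq_bot _ _ _ le_rfl)
    (Submodule.liftQ (LinearMap.ker φ) ((ators a N).subtype ∘ₗ g) hker)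
  refine ⟨LinearMap.toSpanSingleton R _ ⟨h (Submodule.Quotient.mk 1), k + t, fun r hr => ?_⟩,
    fun x hx => ?_⟩
  · rw [← map_smul, ← Submodule.Quotient.mk_smul]
    have : (Submodule.Quotient.mk (r • (1 : R)) : R ⧸ a ^ (k + t)) = 0 := by
      rw [Submodule.Quotient.mk_eq_zero]; simpa using hr
    rw [this, map_zero]
  · apply Subtype.ext
    have := hh (Submodule.Quotient.mk ⟨x, hx⟩)
    simp only [Submodule.liftQ_apply] at this
    refine Eq.trans ?_ this
    simp only [LinearMap.toSpanSingleton_apply, SetLike.val_smul]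
    rw [← map_smul, ← Submodule.Quotient.mk_smul, smul_eq_mul, mul_one]
    rfl

lemma T_injective_zero (i : ℕ) (hI : Module.Injective R N) (z : T a (i + 1) N) : z = 0 := by
  obtain ⟨t, x, rfl⟩ := exists_ofT z
  have : Injective (ModuleCat.of R N) := (Module.injective_iff_injective_object R N).1 hI
  rw [Abelian.Ext.eq_zero_of_injective x, map_zero]

lemma exists_injective (R : Type u) [CommRing R] (N : Type u) [AddCommGroup N] [Module R N] :
    ∃ (I : Type u) (_ : AddCommGroup I) (_ : Module R I) (f : N →ₗ[R] I),
      Module.Injective R I ∧ Function.Injective f := by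
  let J : ModuleCat.{u} R := Injective.under (ModuleCat.of R N)
  refine ⟨J, inferInstance, inferInstance,
    (Injective.ι (ModuleCat.of R N)).hom, ?_, ?_⟩
  · apply (Module.injective_iff_injective_object R _).2
    exact inferInstanceAs (Injective (Injective.under (ModuleCat.of R N)))
  · rw [← ModuleCat.mono_iff_injective]; infer_instance

lemma T_tors_zero [IsNoetherianRing R] (a : Ideal R) (i : ℕ) :
    ∀ (N : Type u) [AddCommGroup N] [Module R N], IsATors a N → ∀ z : T a (i + 1) N, z = 0 := by
  induction i with
  | zero =>
    intro N _ _ hN z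
    obtain ⟨I, _, _, f, hI, hf⟩ := exists_injective R N
    have hJ := baer_ators a hI
    let f' : N →ₗ[R] ators a I := f.codRestrict _ (fun n => by
      obtain ⟨t, ht⟩ := hN n
      exact ⟨t, fun r hr => by rw [← map_smul, ht r hr, map_zero]⟩)
    have hf' : Function.Injective f' := fun x y h => hf (congrArg Subtype.val h)
    have hJt : IsATors a (ators a I) := fun n => by
      obtain ⟨t, ht⟩ := n.2
      exact ⟨t, fun r hr => Subtype.ext (ht r hr)⟩
    have hex : Function.Exact f' (LinearMap.range f').mkQ := LinearMap.exact_map_mkQ_range f'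
    have hsurj := Submodule.mkQ_surjective (LinearMap.range f')
    obtain ⟨w, rfl⟩ := (exact₁ hf' hex hsurj z).1 (T_injective_zero 0 hJ _)
    have hQt := hJt.of_surjective _ hsurj
    obtain ⟨y, hy⟩ := hsurj (evT a _ w)
    obtain ⟨v, rfl⟩ := (evT_bijective hJt).2 y
    rw [← evT_mapT] at hy
    exact (exact₃ hf' hex hsurj w).2 ⟨v, (evT_injective hy)⟩
  | succ i ih =>
    intro N _ _ hN z
    obtain ⟨I, _, _, f, hI, hf⟩ := exists_injective R N
    have hJ := baer_ators a hI
    let f' : N →ₗ[R] ators a I := f.codRestrict _ (fun n => by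
      obtain ⟨t, ht⟩ := hN n
      exact ⟨t, fun r hr => by rw [← map_smul, ht r hr, map_zero]⟩)
    have hf' : Function.Injective f' := fun x y h => hf (congrArg Subtype.val h)
    have hJt : IsATors a (ators a I) := fun n => by
      obtain ⟨t, ht⟩ := n.2
      exact ⟨t, fun r hr => Subtype.ext (ht r hr)⟩
    have hex : Function.Exact f' (LinearMap.range f').mkQ := LinearMap.exact_map_mkQ_range f'
    have hsurj := Submodule.mkQ_surjective (LinearMap.range f')
    obtain ⟨w, rfl⟩ := (exact₁ hf' hex hsurj z).1 (T_injective_zero _ hJ _)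
    rw [ih _ (hJt.of_surjective _ hsurj) w, map_zero]

end

end LCX

end

noncomputable section


open CategoryTheory

namespace LCX

variable {R : Type u} [CommRing R]

section opc
variable (L : ChainComplex (ModuleCat.{u} R)ᵒᵖ ℕ) (n : ℕ)

/-- cocycles -/
abbrev ZC : ModuleCat.{u} R := (L.opcycles n).unop

/-- inclusion of cocycles -/
def jZ : ZC L n ⟶ (L.X n).unop := (L.pOpcycles n).unop

/-- class of a cocycle -/
def cZ : ZC L n ⟶ (L.homology n).unop := (L.homologyι n).unop

lemma jZ_inj : Function.Injective (jZ L n).hom := by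
  have : Mono (jZ L n) := by unfold jZ; infer_instance
  exact (ModuleCat.mono_iff_injective _).1 this

lemma cZ_surj : Function.Surjective (cZ L n).hom := by
  have : Epi (cZ L n) := by unfold cZ; infer_instance
  exact (ModuleCat.epi_iff_surjective _).1 this

lemma d_jZ (z : ZC L n) : (L.d (n + 1) n).unop.hom ((jZ L n).hom z) = 0 := by
  have : (jZ L n) ≫ (L.d (n + 1) n).unop = 0 := by
    unfold jZ
    rw [← unop_comp, L.d_pOpcycles]; rfl
  exact congrArg (fun f => f.hom z) this

lemma exists_jZ (x : (L.X n).unop) (hx : (L.d (n + 1) n).unop.hom x = 0) :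
    ∃ z, (jZ L n).hom z = x := by
  let g : L.X n ⟶ Opposite.op (ModuleCat.of R R) :=
    (ModuleCat.ofHom (LinearMap.toSpanSingleton R (L.X n).unop x)).op
  have hg : L.d (n + 1) n ≫ g = 0 := by
    apply Quiver.Hom.unop_inj
    rw [unop_comp]
    refine ModuleCat.hom_ext (LinearMap.ext fun r => ?_)
    change (L.d (n + 1) n).unop.hom (r • x) = 0
    rw [map_smul, hx, smul_zero]
  let k := L.descOpcycles g (n + 1) (by simp) hg
  refine ⟨k.unop.hom (1 : R), ?_⟩
  have : k.unop ≫ jZ L n = g.unop := by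
    unfold jZ
    rw [← unop_comp, L.p_descOpcycles]
  have := congrArg (fun f => f.hom (1 : R)) this
  refine this.trans ?_
  change (1 : R) • x = x
  exact one_smul _ _

lemma cZ_eq_zero_succ (z : ZC L (n + 1)) :
    (cZ L (n + 1)).hom z = 0 ↔ ∃ y : (L.X n).unop, (L.d (n + 1) n).unop.hom y =
      (jZ L (n + 1)).hom z := by
  have hex := (ShortComplex.exact_of_f_is_kernel
    (ShortComplex.mk (L.homologyι (n + 1)) (L.fromOpcycles (n + 1) n) (by simp))
      (L.homologyIsKernel (n + 1) n (by simp))).unop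
  rw [ShortComplex.moduleCat_exact_iff] at hex
  have hd : (L.fromOpcycles (n + 1) n).unop ≫ jZ L (n + 1) = (L.d (n + 1) n).unop := by
    unfold jZ
    rw [← unop_comp, L.p_fromOpcycles]
  constructor
  · intro h
    obtain ⟨y, hy⟩ := hex z h
    refine ⟨y, ?_⟩
    rw [← hd, ← hy]; rfl
  · rintro ⟨y, hy⟩
    rw [← hd] at hy
    have := jZ_inj _ _ hy
    rw [← this]
    have h0 : (L.fromOpcycles (n + 1) n).unop ≫ cZ L (n + 1) = 0 := by
      unfold cZ
      rw [← unop_comp, L.homologyι_comp_fromOpcycles]; rfl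
    exact congrArg (fun f => f.hom y) h0

lemma cZ_inj_zero : Function.Injective (cZ L 0).hom := by
  have h : IsIso (L.homologyι 0) := by
    have := L.isIso_homologyι 0 _ rfl (by simp)
    exact this
  have : Mono (cZ L 0) := by unfold cZ; infer_instance
  exact (ModuleCat.mono_iff_injective _).1 this

end opc

section
variable (X Y : ModuleCat.{u} R) (n : ℕ)

/-- the derived functor -/
abbrev FY : ModuleCat.{u} R ⥤ (ModuleCat.{u} R)ᵒᵖ :=
  ((linearYoneda R (ModuleCat.{u} R)).obj Y).rightOp

/-- the complex -/
abbrev LY : ChainComplex (ModuleCat.{u} R)ᵒᵖ ℕ :=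
  ((FY Y).mapHomologicalComplex _).obj (projectiveResolution X).complex

/-- old ext -/
abbrev OE : ModuleCat.{u} R := ((Ext R (ModuleCat.{u} R) n).obj (Opposite.op X)).obj Y

/-- iso to homology -/
def oeIso : ((LY X Y).homology n).unop ⟶ OE X Y n :=
  ((projectiveResolution X).isoLeftDerivedObj (FY Y) n).hom.unop

instance : IsIso (oeIso X Y n) :=
  inferInstanceAs (IsIso ((projectiveResolution X).isoLeftDerivedObj (FY Y) n).unop.hom)

/-- cocycles to old ext -/
def cOE : ZC (LY X Y) n →ₗ[R] OE X Y n := (cZ (LY X Y) n ≫ oeIso X Y n).hom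

lemma cOE_surj : Function.Surjective (cOE X Y n) := by
  have h1 := cZ_surj (LY X Y) n
  have h2 : Function.Surjective (oeIso X Y n).hom :=
    (ModuleCat.epi_iff_surjective _).1 inferInstance
  exact h2.comp h1

lemma cOE_eq_zero (z) : cOE X Y n z = 0 ↔ (cZ (LY X Y) n).hom z = 0 := by
  have h2 : Function.Injective (oeIso X Y n).hom :=
    (ModuleCat.mono_iff_injective _).1 inferInstance
  exact map_eq_zero_iff (oeIso X Y n).hom h2

/-- underlying morphism of a cocycle -/
def jM : ZC (LY X Y) n →ₗ[R] ((projectiveResolution X).complex.X n ⟶ Y) := (jZ (LY X Y) n).hom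

lemma jM_d (z) : (projectiveResolution X).complex.d (n + 1) n ≫ jM X Y n z = 0 :=
  d_jZ (LY X Y) n z

/-- new ext of a cocycle -/
def eNE : ZC (LY X Y) n →ₗ[R] Abelian.Ext.{u} X Y n where
  toFun z := (projectiveResolution X).extMk (jM X Y n z) (n + 1) rfl (jM_d X Y n z)
  map_add' z w := by
    rw [ProjectiveResolution.add_extMk]
    congr 1
    exact map_add _ _ _
  map_smul' r z := by
    rw [RingHom.id_apply, Abelian.Ext.smul_eq_comp_mk₀, ProjectiveResolution.extMk_comp_mk₀]
    congr 1
    rw [map_smul, Linear.comp_smul, Category.comp_id]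

lemma eNE_surj : Function.Surjective (eNE X Y n) := by
  intro α
  obtain ⟨f, hf, rfl⟩ := (projectiveResolution X).extMk_surjective α (n + 1) rfl
  obtain ⟨z, hz⟩ := exists_jZ (LY X Y) n f hf
  refine ⟨z, ?_⟩
  change (projectiveResolution X).extMk (jM X Y n z) (n + 1) rfl (jM_d X Y n z) = _
  congr 1

lemma extMk_zero_iff (P : ProjectiveResolution X) (f : P.complex.X 0 ⟶ Y)
    (hf : P.complex.d 1 0 ≫ f = 0) : P.extMk f 1 rfl hf = 0 ↔ f = 0 := by
  constructor
  · intro h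
    rw [← P.extEquivCohomologyClass.apply_eq_iff_eq,
      ProjectiveResolution.extEquivCohomologyClass_extMk,
      ProjectiveResolution.extEquivCohomologyClass_zero,
      CochainComplex.HomComplex.CohomologyClass.mk_eq_zero_iff,
      CochainComplex.HomComplex.Cocycle.toSingleMk_mem_coboundaries_iff _ _ _ _ _ 1 (by lia)] at h
    obtain ⟨g, hg⟩ := h
    have hz : Limits.IsZero (P.cochainComplex.X 1) :=
      CochainComplex.isZero_of_isStrictlyLE _ 0 1 (by lia)
    rw [hz.eq_of_src g 0, Limits.comp_zero] at hg
    rw [← cancel_epi (P.cochainComplexXIso (-(0 : ℕ)) 0 rfl).hom, ← hg, Limits.comp_zero]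
  · rintro rfl
    simp

lemma ker_eq : LinearMap.ker (cOE X Y n) = LinearMap.ker (eNE X Y n) := by
  ext z
  rw [LinearMap.mem_ker, LinearMap.mem_ker, cOE_eq_zero]
  cases n with
  | zero =>
    rw [map_eq_zero_iff _ (cZ_inj_zero (LY X Y))]
    change _ ↔ (projectiveResolution X).extMk (jM X Y 0 z) 1 rfl (jM_d X Y 0 z) = 0
    rw [extMk_zero_iff]
    exact (map_eq_zero_iff (jZ (LY X Y) 0).hom (jZ_inj (LY X Y) 0)).symm
  | succ n =>
    rw [cZ_eq_zero_succ]
    exact ((projectiveResolution X).extMk_eq_zero_iff (jM X Y (n + 1) z) _ rfl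
      (jM_d X Y (n + 1) z) n rfl).symm

/-- comparison -/
def cmp : OE X Y n ≃ₗ[R] Abelian.Ext.{u} X Y n :=
  ((cOE X Y n).quotKerEquivOfSurjective (cOE_surj X Y n)).symm ≪≫ₗ
    Submodule.quotEquivOfEq _ _ (ker_eq X Y n) ≪≫ₗ
    (eNE X Y n).quotKerEquivOfSurjective (eNE_surj X Y n)

lemma cmp_cOE (z) : cmp X Y n (cOE X Y n z) = eNE X Y n z := by
  have : (cOE X Y n) z = ((cOE X Y n).quotKerEquivOfSurjective (cOE_surj X Y n))
    (Submodule.Quotient.mk z) := rfl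
  rw [cmp, LinearEquiv.trans_apply, LinearEquiv.trans_apply, this, LinearEquiv.symm_apply_apply]
  rfl

variable {X} {X' : ModuleCat.{u} R} (g : X' ⟶ X)

lemma cmp_nat (w : OE X Y n) :
    cmp X' Y n ((((Ext R (ModuleCat.{u} R) n).map g.op).app Y).hom w) =
      (Abelian.Ext.mk₀ g).comp (cmp X Y n w) (zero_add n) := by
  obtain ⟨z, rfl⟩ := cOE_surj X Y n w
  let ψ : ProjectiveResolution.Hom (projectiveResolution X') (projectiveResolution X) g :=
    { hom := ProjectiveResolution.lift g _ _
      hom_f_zero_comp_π_f_zero := ProjectiveResolution.lift_commutes_zero _ _ _ }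
  let Ψ : LY X' Y ⟶ LY X Y := ((FY Y).mapHomologicalComplex _).map ψ.hom
  let z' : ZC (LY X' Y) n := (HomologicalComplex.opcyclesMap Ψ n).unop.hom z
  have hz' : jM X' Y n z' = ψ.hom.f n ≫ jM X Y n z := by
    have : (HomologicalComplex.opcyclesMap Ψ n).unop ≫ jZ (LY X' Y) n =
        jZ (LY X Y) n ≫ (Ψ.f n).unop := by
      unfold jZ
      rw [← unop_comp, ← unop_comp, HomologicalComplex.p_opcyclesMap]
    exact congrArg (fun f => f.hom z) this
  have hc : cOE X' Y n z' = (((Ext R (ModuleCat.{u} R) n).map g.op).app Y).hom (cOE X Y n z) := by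
    have h1 : (HomologicalComplex.opcyclesMap Ψ n).unop ≫ cZ (LY X' Y) n =
        cZ (LY X Y) n ≫ (HomologicalComplex.homologyMap Ψ n).unop := by
      unfold cZ
      rw [← unop_comp, ← unop_comp, HomologicalComplex.homologyι_naturality]
    have h2 : (HomologicalComplex.homologyMap Ψ n).unop ≫ oeIso X' Y n =
        oeIso X Y n ≫ (((Ext R (ModuleCat.{u} R) n).map g.op).app Y) := by
      have := ProjectiveResolution.isoLeftDerivedObj_hom_naturality g
        (projectiveResolution X') (projectiveResolution X) ψ.hom
        (ProjectiveResolution.lift_commutes_zero _ _ _) (FY Y) n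
      have := congrArg Quiver.Hom.unop this
      exact this.symm
    have h3 : (HomologicalComplex.opcyclesMap Ψ n).unop ≫ (cZ (LY X' Y) n ≫ oeIso X' Y n) =
        (cZ (LY X Y) n ≫ oeIso X Y n) ≫ (((Ext R (ModuleCat.{u} R) n).map g.op).app Y) := by
      rw [← Category.assoc, h1, Category.assoc, h2, Category.assoc]
    exact congrArg (fun f => f.hom z) h3
  rw [← hc, cmp_cOE, cmp_cOE]
  refine Eq.trans ?_ (ProjectiveResolution.mk₀_comp_extMk (jM X Y n z) (n + 1) rfl
    (jM_d X Y n z) ψ).symm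
  change (projectiveResolution X').extMk (jM X' Y n z') (n + 1) rfl (jM_d X' Y n z') = _
  congr 1

end

section
variable (J : Ideal R) (i : ℕ) (N : Type u) [AddCommGroup N] [Module R N]

/-- the old system evaluated -/
abbrev oldD : (ℕᵒᵖ)ᵒᵖ ⥤ ModuleCat.{u} R :=
  localCohomology.diagram (localCohomology.idealPowersDiagram J) i ⋙
    (evaluation _ _).obj (ModuleCat.of R N)

/-- components -/
def cmpT (t : ℕ) : (oldD J i N).obj (Opposite.op (Opposite.op t)) ≃ₗ[R] EX J i N t :=
  cmp (ModuleCat.of R (R ⧸ J ^ t)) (ModuleCat.of R N) i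

lemma cmpT_nat {s t : ℕ} (f : Opposite.op (Opposite.op s) ⟶ Opposite.op (Opposite.op t))
    (w : (oldD J i N).obj (Opposite.op (Opposite.op s))) :
    cmpT J i N t (((oldD J i N).map f).hom w) =
      tr J i N s t (leOfHom f.unop.unop) (cmpT J i N s w) :=
  cmp_nat (ModuleCat.of R N) i (fac J (leOfHom f.unop.unop)) w

/-- the cocone -/
def cocT : Limits.Cocone (oldD J i N) where
  pt := ModuleCat.of R (T J i N)
  ι :=
    { app := fun t => ModuleCat.ofHom (ofT J i N t.unop.unop ∘ₗ (cmpT J i N t.unop.unop).toLinearMap)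
      naturality := by
        intro s t f
        refine ModuleCat.hom_ext (LinearMap.ext fun w => ?_)
        change ofT J i N t.unop.unop (cmpT J i N t.unop.unop (((oldD J i N).map f).hom w)) =
          ofT J i N s.unop.unop (cmpT J i N s.unop.unop w)
        rw [cmpT_nat, ofT_tr] }

/-- descent map -/
def descT (s : Limits.Cocone (oldD J i N)) : T J i N →ₗ[R] s.pt :=
  liftT
    (fun t => (s.ι.app (Opposite.op (Opposite.op t))).hom ∘ₗ (cmpT J i N t).symm.toLinearMap) (by
      intro p q h x
      obtain ⟨w, rfl⟩ := (cmpT J i N p).surjective x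
      let f : (Opposite.op (Opposite.op p) : (ℕᵒᵖ)ᵒᵖ) ⟶ Opposite.op (Opposite.op q) :=
        (homOfLE h).op.op
      have := cmpT_nat J i N f w
      rw [← this]
      simp only [LinearMap.comp_apply, LinearEquiv.coe_coe, LinearEquiv.symm_apply_apply]
      have := s.w f
      exact congrArg (fun f => f.hom w) this)

lemma descT_apply (s : Limits.Cocone (oldD J i N)) (t : ℕ)
    (w : (oldD J i N).obj (Opposite.op (Opposite.op t))) :
    descT J i N s (ofT J i N t (cmpT J i N t w)) =
      (s.ι.app (Opposite.op (Opposite.op t))).hom w := by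
  rw [descT, liftT_ofT]
  simp only [LinearMap.comp_apply, LinearEquiv.coe_coe, LinearEquiv.symm_apply_apply]

/-- it is a colimit -/
def cocTIsColimit : Limits.IsColimit (cocT J i N) where
  desc s := ModuleCat.ofHom (descT J i N s)
  fac s j := by
    refine ModuleCat.hom_ext (LinearMap.ext fun w => ?_)
    exact descT_apply J i N s j.unop.unop w
  uniq s m hm := by
    refine ModuleCat.hom_ext (LinearMap.ext fun z => ?_)
    obtain ⟨t, x, rfl⟩ := exists_ofT z
    obtain ⟨w, rfl⟩ := (cmpT J i N t).surjective x
    refine (congrArg (fun f => f.hom w) (hm (Opposite.op (Opposite.op t)))).trans ?_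
    exact (descT_apply J i N s t w).symm

/-- comparison of the two definitions -/
def lcEquiv : ((localCohomology J i).obj (ModuleCat.of R N)) ≃ₗ[R] T J i N :=
  (((Limits.isColimitOfPreserves ((evaluation _ _).obj (ModuleCat.of R N))
    (Limits.colimit.isColimit
      (localCohomology.diagram (localCohomology.idealPowersDiagram J) i))).coconePointUniqueUpToIso
    (cocTIsColimit J i N))).toLinearEquiv

end

end LCX

end

noncomputable section


open CategoryTheory

namespace LCX

variable {R : Type u} [CommRing R]

/-- support dimension less than a natural number -/
def DL (R : Type u) [CommRing R] (n : ℕ) (N : Type u) [AddCommGroup N] [Module R N] : Prop :=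
  Module.supportDim R N < (n : WithBot ℕ∞)

section
variable {N N' N'' : Type u} [AddCommGroup N] [Module R N]
  [AddCommGroup N'] [Module R N'] [AddCommGroup N''] [Module R N'']

lemma DL_zero : DL R 0 N ↔ Subsingleton N := by
  rw [DL, ← Module.supportDim_eq_bot_iff_subsingleton R N]
  generalize Module.supportDim R N = d
  cases d with
  | bot => simp
  | coe d => simp [← WithBot.coe_zero]

lemma DL.mono {m n : ℕ} (h : DL R m N) (hmn : m ≤ n) : DL R n N :=
  lt_of_lt_of_le h (by exact_mod_cast hmn)

lemma DL.of_injective {n : ℕ} (h : DL R n N') (f : N →ₗ[R] N') (hf : Function.Injective f) :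
    DL R n N := (Module.supportDim_le_of_injective f hf).trans_lt h

lemma DL.of_surjective {n : ℕ} (h : DL R n N) (f : N →ₗ[R] N') (hf : Function.Surjective f) :
    DL R n N' := (Module.supportDim_le_of_surjective f hf).trans_lt h

lemma DL_succ {n : ℕ} : DL R (n + 1) N ↔ Module.supportDim R N ≤ (n : WithBot ℕ∞) := by
  rw [DL]
  generalize Module.supportDim R N = d
  cases d with
  | bot => simp
  | coe d =>
    cases d with
    | top =>
      constructor
      · intro h; exact absurd h (by
          rw [not_lt]; exact WithBot.coe_le_coe.mpr le_top)
      · intro h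
        have h' : ((⊤ : ℕ∞) : WithBot ℕ∞) ≤ ((n : ℕ∞) : WithBot ℕ∞) := h
        have := WithBot.coe_le_coe.mp h'
        simp at this
    | coe d =>
      change (((d : ℕ∞) : WithBot ℕ∞) < (((n + 1 : ℕ) : ℕ∞) : WithBot ℕ∞)) ↔
        (((d : ℕ∞) : WithBot ℕ∞) ≤ ((n : ℕ∞) : WithBot ℕ∞))
      rw [WithBot.coe_lt_coe, WithBot.coe_le_coe, Nat.cast_lt, Nat.cast_le]
      omega

lemma DL_of_ne {n : ℕ} (h : DL R (n + 1) N) (h' : Module.supportDim R N ≠ n) : DL R n N :=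
  lt_of_le_of_ne (DL_succ.mp h) h'

lemma ann_quot (q : Ideal R) : Module.annihilator R (R ⧸ q) = q := Ideal.annihilator_quotient

open Pointwise in
lemma DL.quot {n : ℕ} {q : Ideal R} [q.IsPrime] {x : R} (hx : x ∉ q) (h : DL R (n + 1) (R ⧸ q)) :
    DL R n (QuotSMulTop x (R ⧸ q)) := by
  have h1 := Module.supportDim_quotSMulTop_succ_le_of_notMem_minimalPrimes (M := R ⧸ q) (x := x) (by
    intro p hp
    rw [Ideal.annihilator_quotient, Ideal.minimalPrimes_eq_subsingleton_self,
      Set.mem_singleton_iff] at hp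
    rwa [hp])
  have h2 : Module.supportDim R (QuotSMulTop x (R ⧸ q)) + 1 < ((n + 1 : ℕ) : WithBot ℕ∞) :=
    h1.trans_lt h
  rw [DL]
  generalize Module.supportDim R (QuotSMulTop x (R ⧸ q)) = d at h2
  by_contra h3
  rw [not_lt] at h3
  rw [Nat.cast_add, Nat.cast_one] at h2
  exact absurd h2 (not_lt.mpr (add_le_add_left h3 1))

lemma mem_support_quot {q : Ideal R} {p : PrimeSpectrum R} :
    p ∈ Module.support R (R ⧸ q) ↔ q ≤ p.asIdeal := by
  rw [Module.mem_support_iff_of_finite, Ideal.annihilator_quotient]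

open Pointwise in
lemma support_quotx {q : Ideal R} {x : R} (hx : x ∉ q) {p : PrimeSpectrum R}
    (hp : p ∈ Module.support R (QuotSMulTop x (R ⧸ q))) : q < p.asIdeal := by
  rw [Module.support_quotSMulTop] at hp
  have h1 := mem_support_quot.mp hp.1
  have h2 : x ∈ p.asIdeal := by simpa using hp.2
  exact lt_of_le_of_ne h1 (fun h => hx (h ▸ h2))

open Pointwise in
lemma lsmul_inj {q : Ideal R} [q.IsPrime] {x : R} (hx : x ∉ q) :
    Function.Injective (LinearMap.lsmul R (R ⧸ q) x) := by
  rw [injective_iff_map_eq_zero]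
  intro z hz
  obtain ⟨r, rfl⟩ := Ideal.Quotient.mk_surjective z
  have : Ideal.Quotient.mk q (x * r) = 0 := hz
  rw [Ideal.Quotient.eq_zero_iff_mem] at this ⊢
  exact (Ideal.IsPrime.mem_or_mem ‹_› this).resolve_left hx

open Pointwise in
/-- quotient map -/
def qx (x : R) (N : Type u) [AddCommGroup N] [Module R N] : N →ₗ[R] QuotSMulTop x N :=
  Submodule.mkQ _

open Pointwise in
lemma qx_surj (x : R) : Function.Surjective (qx x N) := Submodule.mkQ_surjective _

open Pointwise in
lemma qx_exact (x : R) : Function.Exact (LinearMap.lsmul R N x) (qx x N) := by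
  intro y
  rw [qx, Submodule.mkQ_apply, Submodule.Quotient.mk_eq_zero, Submodule.mem_smul_pointwise_iff_exists]
  constructor
  · rintro ⟨b, -, rfl⟩; exact ⟨b, rfl⟩
  · rintro ⟨b, rfl⟩; exact ⟨b, trivial, rfl⟩

/-- dévissage -/
theorem devissage [IsNoetherianRing R]
    (P : (N : Type u) → [AddCommGroup N] → [Module R N] → [Module.Finite R N] → Prop)
    (sub : (N : Type u) → [AddCommGroup N] → [Module R N] → [Module.Finite R N] →
      [Subsingleton N] → P N)
    (exact : (N₁ : Type u) → [AddCommGroup N₁] → [Module R N₁] → [Module.Finite R N₁] →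
      (N₂ : Type u) → [AddCommGroup N₂] → [Module R N₂] → [Module.Finite R N₂] →
      (N₃ : Type u) → [AddCommGroup N₃] → [Module R N₃] → [Module.Finite R N₃] →
      (f : N₁ →ₗ[R] N₂) → (g : N₂ →ₗ[R] N₃) →
      Function.Injective f → Function.Exact f g → Function.Surjective g →
      P N₁ → P N₃ → P N₂)
    (prime : (q : Ideal R) → [q.IsPrime] →
      (∀ (N : Type u) [AddCommGroup N] [Module R N] [Module.Finite R N],
        (∀ p ∈ Module.support R N, q < p.asIdeal) → P N) → P (R ⧸ q))
    (N : Type u) [AddCommGroup N] [Module R N] [hN : Module.Finite R N] : P N := by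
  have equiv (N₁ : Type u) [AddCommGroup N₁] [Module R N₁] [Module.Finite R N₁]
      (N₂ : Type u) [AddCommGroup N₂] [Module R N₂] [Module.Finite R N₂]
      (f : N₁ ≃ₗ[R] N₂) (h : P N₁) : P N₂ :=
    exact N₁ N₂ PUnit.{u + 1} f 0 f.injective
      ((f.exact_zero_iff_surjective _).2 f.surjective) (Function.surjective_to_subsingleton _)
      h (sub _)
  have key : ∀ q : Ideal R, q.IsPrime → P (R ⧸ q) := by
    intro q
    induction q using WellFoundedGT.induction with
    | ind q ih =>
      intro hq
      refine prime q ?_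
      intro N _ _ hN
      refine IsNoetherianRing.induction_on_isQuotientEquivQuotientPrime R hN
        (motive := fun N _ _ _ => (∀ p ∈ Module.support R N, q < p.asIdeal) → P N) ?_ ?_ ?_
      · intro N _ _ _ _ _
        exact sub N
      · intro N _ _ _ p e h
        refine equiv _ _ e.symm (ih p.1 (h p ?_) p.2)
        rw [e.support_eq, mem_support_quot]
      · intro N₁ _ _ _ N₂ _ _ _ N₃ _ _ _ f g hf hg hfg h1 h3 h
        exact exact N₁ N₂ N₃ f g hf hfg hg
          (h1 fun p hp => h p (Module.support_subset_of_injective f hf hp))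
          (h3 fun p hp => h p (Module.support_subset_of_surjective g hg hp))
  refine IsNoetherianRing.induction_on_isQuotientEquivQuotientPrime R hN
    (motive := fun N _ _ _ => P N) ?_ ?_ ?_
  · intro N _ _ _ _
    exact sub N
  · intro N _ _ _ p e
    exact equiv _ _ e.symm (key p.1 p.2)
  · intro N₁ _ _ _ N₂ _ _ _ N₃ _ _ _ f g hf hg hfg h1 h3
    exact exact N₁ N₂ N₃ f g hf hfg hg h1 h3

lemma T_sub [Subsingleton N] (a : Ideal R) (i : ℕ) (z : T a i N) : z = 0 := by
  rw [← mapT_id z, show (LinearMap.id : N →ₗ[R] N) = 0 from Subsingleton.elim _ _, mapT_zero]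

lemma isATors_quot {a q : Ideal R} (h : a ≤ q) : IsATors a (R ⧸ q) := by
  intro z
  refine ⟨1, fun r hr => ?_⟩
  obtain ⟨s, rfl⟩ := Ideal.Quotient.mk_surjective z
  rw [pow_one] at hr
  change Ideal.Quotient.mk q (r * s) = 0
  exact Ideal.Quotient.eq_zero_iff_mem.mpr (Ideal.mul_mem_right _ _ (h hr))

/-- Grothendieck vanishing -/
theorem T_vanish [IsNoetherianRing R] (a : Ideal R) (N : Type u) [AddCommGroup N] [Module R N]
    [Module.Finite R N] : ∀ i : ℕ, DL R i N → ∀ z : T a i N, z = 0 := by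
  refine devissage (R := R) (P := fun N _ _ _ => ∀ i : ℕ, DL R i N → ∀ z : T a i N, z = 0)
    ?_ ?_ ?_ N
  · intro N _ _ _ _ i _ z
    exact T_sub a i z
  · intro N₁ _ _ _ N₂ _ _ _ N₃ _ _ _ f g hf hfg hg h1 h3 i hi z
    obtain ⟨w, rfl⟩ := (exact₂ (a := a) (i := i) hf hfg hg z).mp (h3 i (hi.of_surjective g hg) _)
    rw [h1 i (hi.of_injective f hf) w, map_zero]
  · intro q _ ih i hi z
    cases i with
    | zero =>
      have := DL_zero.mp hi
      exact T_sub a 0 z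
    | succ i =>
      by_cases haq : a ≤ q
      · exact T_tors_zero a i _ (isATors_quot haq) z
      · obtain ⟨x, hxa, hxq⟩ := Set.not_subset.mp haq
        have hinj : ∀ w : T a (i + 1) (R ⧸ q), x • w = 0 → w = 0 := by
          intro w hw
          rw [← mapT_lsmul] at hw
          obtain ⟨v, rfl⟩ := (exact₁ (a := a) (i := i) (lsmul_inj hxq) (qx_exact x) (qx_surj x) w).mp hw
          rw [ih _ (fun p hp => support_quotx hxq hp) i (hi.quot hxq) v, map_zero]
        obtain ⟨k, hk⟩ := torsionT_pow hxa z
        induction k with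
        | zero => simpa using hk
        | succ k ihk =>
          refine ihk (hinj _ ?_)
          rw [smul_smul, ← pow_succ', hk]

lemma tors_ext [IsNoetherianRing R] {b : Ideal R} (f : N →ₗ[R] N') (z : N)
    (hz : f z ∈ ators b N') (hk : ∀ w, f w = 0 → w ∈ ators b N) : z ∈ ators b N := by
  obtain ⟨t, ht⟩ := hz
  -- J = m^t • z
  have hfg : (Submodule.map (LinearMap.toSpanSingleton R N z) (b ^ t)).FG :=
    Submodule.FG.map _ (IsNoetherian.noetherian _)
  have : ∃ s, ∀ r ∈ b ^ s, ∀ y ∈ Submodule.map (LinearMap.toSpanSingleton R N z) (b ^ t), r • y = 0 := by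
    refine exists_pow_fg b hfg ?_
    rintro y ⟨r, hr, rfl⟩
    refine hk _ ?_
    rw [LinearMap.toSpanSingleton_apply, map_smul]
    exact ht r hr
  obtain ⟨s, hs⟩ := this
  refine ⟨s + t, fun r hr => ?_⟩
  rw [pow_add] at hr
  refine Submodule.mul_induction_on hr ?_ ?_
  · intro r hr r' hr'
    rw [mul_smul]
    exact hs r hr _ ⟨r', hr', rfl⟩
  · intro x y hx hy
    rw [add_smul, hx, hy, add_zero]

lemma eq_max_of_DL_one [IsLocalRing R] {q : Ideal R} [q.IsPrime]
    (h : DL R 1 (R ⧸ q)) : q = IsLocalRing.maximalIdeal R := by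
  by_contra hne
  have hlt : q < IsLocalRing.maximalIdeal R :=
    lt_of_le_of_ne (IsLocalRing.le_maximalIdeal (Ideal.IsPrime.ne_top ‹_›)) hne
  obtain ⟨x, hx, hxq⟩ := Set.exists_of_ssubset hlt
  have := DL_zero.mp (DL.quot (n := 0) hxq h)
  have h2 : ∃ w : R ⧸ q, x • w = Ideal.Quotient.mk q 1 :=
    (qx_exact x _).mp (Subsingleton.elim _ _)
  obtain ⟨w, hw⟩ := h2
  obtain ⟨w, rfl⟩ := Ideal.Quotient.mk_surjective w
  have h3 : Ideal.Quotient.mk q (x * w) = Ideal.Quotient.mk q 1 := hw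
  rw [Ideal.Quotient.eq] at h3
  have h4 : (1 : R) ∈ IsLocalRing.maximalIdeal R := by
    have := Ideal.sub_mem _ (Ideal.mul_mem_right w _ hx) (hlt.le h3)
    simpa using this
  exact (Ideal.ne_top_iff_one _).mp (IsLocalRing.maximalIdeal.isMaximal R).ne_top h4

/-- top local cohomology is m-torsion -/
theorem T_mtors [IsNoetherianRing R] [IsLocalRing R] (a : Ideal R) (N : Type u)
    [AddCommGroup N] [Module R N] [Module.Finite R N] :
    ∀ i : ℕ, DL R (i + 1) N → IsATors (IsLocalRing.maximalIdeal R) (T a i N) := by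
  refine devissage (R := R) (P := fun N _ _ _ => ∀ i : ℕ, DL R (i + 1) N →
    IsATors (IsLocalRing.maximalIdeal R) (T a i N)) ?_ ?_ ?_ N
  · intro N _ _ _ _ i _ z
    rw [T_sub a i z]; exact ⟨0, by simp⟩
  · intro N₁ _ _ _ N₂ _ _ _ N₃ _ _ _ f g hf hfg hg h1 h3 i hi z
    refine tors_ext (mapT a i g) z (h3 i (hi.of_surjective g hg) _) fun w hw => ?_
    obtain ⟨w, rfl⟩ := (exact₂ (a := a) (i := i) hf hfg hg w).mp hw
    obtain ⟨t, ht⟩ := h1 i (hi.of_injective f hf) w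
    exact ⟨t, fun r hr => by rw [← map_smul, ht r hr, map_zero]⟩
  · intro q _ ih i hi z
    cases i with
    | zero =>
      have := eq_max_of_DL_one hi
      exact IsATors.of_injective (isATors_quot this.ge) (evT a (R ⧸ q)) evT_injective z
    | succ i =>
      by_cases haq : a ≤ q
      · rw [T_tors_zero a i _ (isATors_quot haq) z]; exact ⟨0, by simp⟩
      · obtain ⟨x, hxa, hxq⟩ := Set.not_subset.mp haq
        have hker : ∀ w : T a (i + 1) (R ⧸ q), x • w = 0 → w ∈ ators (IsLocalRing.maximalIdeal R) _ := by
          intro w hw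
          rw [← mapT_lsmul] at hw
          obtain ⟨v, rfl⟩ := (exact₁ (a := a) (i := i) (lsmul_inj hxq) (qx_exact x) (qx_surj x) w).mp hw
          obtain ⟨t, ht⟩ := ih _ (fun p hp => support_quotx hxq hp) i (hi.quot hxq) v
          exact ⟨t, fun r hr => by rw [← map_smul, ht r hr, map_zero]⟩
        obtain ⟨k, hk⟩ := torsionT_pow hxa z
        change z ∈ ators (IsLocalRing.maximalIdeal R) _
        induction k generalizing z with
        | zero => simp at hk; rw [hk]; exact zero_mem _
        | succ k ihk =>
          refine tors_ext (LinearMap.lsmul R _ x) z ?_ hker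
          refine ihk (x • z) ?_
          rw [smul_smul, ← pow_succ, hk]

end

end LCX

end

noncomputable section


open CategoryTheory

namespace LCX

variable {R : Type u} [CommRing R]

section nat
variable {a : Ideal R} {i : ℕ}
  {N N' N'' : Type u} [AddCommGroup N] [Module R N]
  [AddCommGroup N'] [Module R N'] [AddCommGroup N''] [Module R N'']
  {L L' L'' : Type u} [AddCommGroup L] [Module R L]
  [AddCommGroup L'] [Module R L'] [AddCommGroup L''] [Module R L'']
  {f : N →ₗ[R] N'} {g : N' →ₗ[R] N''} (hf : Function.Injective f)
  (hfg : Function.Exact f g) (hg : Function.Surjective g)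
  {f' : L →ₗ[R] L'} {g' : L' →ₗ[R] L''} (hf' : Function.Injective f')
  (hfg' : Function.Exact f' g') (hg' : Function.Surjective g')

lemma ecl_nat (α : N →ₗ[R] L) (β : N' →ₗ[R] L') (γ : N'' →ₗ[R] L'')
    (h1 : f' ∘ₗ α = β ∘ₗ f) (h2 : g' ∘ₗ β = γ ∘ₗ g) :
    (ecl hf hfg hg).comp (Abelian.Ext.mk₀ (ModuleCat.ofHom α)) (add_zero 1) =
      (Abelian.Ext.mk₀ (ModuleCat.ofHom γ)).comp (ecl hf' hfg' hg') (zero_add 1) := by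
  let φ : sc f g hfg ⟶ sc f' g' hfg' :=
    { τ₁ := ModuleCat.ofHom α
      τ₂ := ModuleCat.ofHom β
      τ₃ := ModuleCat.ofHom γ
      comm₁₂ := by
        refine ModuleCat.hom_ext ?_
        exact h1
      comm₂₃ := by
        refine ModuleCat.hom_ext ?_
        exact h2 }
  exact ShortComplex.ShortExact.extClass_naturality (sc_exact f g hf hfg hg)
    (sc_exact f' g' hf' hfg' hg') φ

lemma dT_nat (α : N →ₗ[R] L) (β : N' →ₗ[R] L') (γ : N'' →ₗ[R] L'')
    (h1 : f' ∘ₗ α = β ∘ₗ f) (h2 : g' ∘ₗ β = γ ∘ₗ g) (z : T a i N'') :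
    mapT a (i + 1) α (dT a i hf hfg hg z) = dT a i hf' hfg' hg' (mapT a i γ z) := by
  obtain ⟨t, x, rfl⟩ := exists_ofT z
  rw [dT_ofT, mapT_ofT, mapT_ofT, dT_ofT]
  congr 1
  rw [Abelian.Ext.comp_assoc_of_third_deg_zero, ecl_nat hf hfg hg hf' hfg' hg' α β γ h1 h2]
  exact (Abelian.Ext.comp_assoc _ _ _ (add_zero i) (zero_add 1) (by omega)).symm

end nat

section chg
variable {a b : Ideal R} (hab : a ≤ b) (i : ℕ) (N : Type u) [AddCommGroup N] [Module R N]

/-- change of ideal on quotients -/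
def cfac (t : ℕ) : ModuleCat.of R (R ⧸ a ^ t) ⟶ ModuleCat.of R (R ⧸ b ^ t) :=
  ModuleCat.ofHom (Submodule.factor (Ideal.pow_right_mono hab t))

lemma cfac_fac {s t : ℕ} (h : s ≤ t) : fac a h ≫ cfac hab s = cfac hab t ≫ fac b h := by
  refine ModuleCat.hom_ext (LinearMap.ext fun x => ?_)
  obtain ⟨x, rfl⟩ := Submodule.Quotient.mk_surjective _ x
  rfl

/-- change of ideal -/
def chg : T b i N →ₗ[R] T a i N :=
  liftT (fun t => ofT a i N t ∘ₗ
    (Abelian.Ext.mk₀ (cfac hab t)).precompOfLinear R (ModuleCat.of R N) (zero_add i)) (by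
    intro s t h x
    rw [LinearMap.comp_apply, LinearMap.comp_apply, ← ofT_tr h, tr_apply, tr_apply]
    congr 1
    change (Abelian.Ext.mk₀ (cfac hab t)).comp ((Abelian.Ext.mk₀ (fac b h)).comp x (zero_add i)) (zero_add i)
      = (Abelian.Ext.mk₀ (fac a h)).comp ((Abelian.Ext.mk₀ (cfac hab s)).comp x (zero_add i)) (zero_add i)
    rw [Abelian.Ext.mk₀_comp_mk₀_assoc, Abelian.Ext.mk₀_comp_mk₀_assoc, cfac_fac])

variable {i N}

lemma chg_ofT (t : ℕ) (x : EX b i N t) :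
    chg hab i N (ofT b i N t x) =
      ofT a i N t ((Abelian.Ext.mk₀ (cfac hab t)).comp x (zero_add i)) :=
  liftT_ofT ..

variable {N' N'' : Type u} [AddCommGroup N'] [Module R N'] [AddCommGroup N''] [Module R N'']

lemma chg_mapT (f : N →ₗ[R] N') (z : T b i N) :
    chg hab i N' (mapT b i f z) = mapT a i f (chg hab i N z) := by
  obtain ⟨t, x, rfl⟩ := exists_ofT z
  rw [mapT_ofT, chg_ofT, chg_ofT, mapT_ofT]
  congr 1
  exact (Abelian.Ext.comp_assoc_of_third_deg_zero _ _ _ _).symm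

lemma chg_dT {f : N →ₗ[R] N'} {g : N' →ₗ[R] N''} (hf : Function.Injective f)
    (hfg : Function.Exact f g) (hg : Function.Surjective g) (z : T b i N'') :
    chg hab (i + 1) N (dT b i hf hfg hg z) = dT a i hf hfg hg (chg hab i N'' z) := by
  obtain ⟨t, x, rfl⟩ := exists_ofT z
  rw [dT_ofT, chg_ofT, chg_ofT, dT_ofT]
  congr 1
  exact (Abelian.Ext.comp_assoc _ _ _ (zero_add i) rfl (by omega)).symm

lemma evT_chg (z : T b 0 N) : evT a N (chg hab 0 N z) = evT b N z := by
  obtain ⟨t, f, rfl⟩ := exists_ofT₀ z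
  rw [chg_ofT, Abelian.Ext.mk₀_comp_mk₀, evT_mk₀, evT_mk₀]
  rfl

end chg

/-- δ-functors -/
structure DF (R : Type u) [CommRing R] where
  H : ℕ → (N : Type u) → [AddCommGroup N] → [Module R N] → Type u
  acg : ∀ (i : ℕ) (N : Type u) [AddCommGroup N] [Module R N], AddCommGroup (H i N)
  mod : ∀ (i : ℕ) (N : Type u) [AddCommGroup N] [Module R N], Module R (H i N)
  map : ∀ (i : ℕ) {N N' : Type u} [AddCommGroup N] [Module R N] [AddCommGroup N'] [Module R N'],
    (N →ₗ[R] N') → (H i N →ₗ[R] H i N')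
  d : ∀ (i : ℕ) {N N' N'' : Type u} [AddCommGroup N] [Module R N] [AddCommGroup N'] [Module R N']
    [AddCommGroup N''] [Module R N''] {f : N →ₗ[R] N'} {g : N' →ₗ[R] N''},
    Function.Injective f → Function.Exact f g → Function.Surjective g → (H i N'' →ₗ[R] H (i + 1) N)
  lsmul : ∀ (i : ℕ) {N : Type u} [AddCommGroup N] [Module R N] (r : R) (z : H i N),
    map i (LinearMap.lsmul R N r) z = r • z
  e₂ : ∀ (i : ℕ) {N N' N'' : Type u} [AddCommGroup N] [Module R N] [AddCommGroup N'] [Module R N']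
    [AddCommGroup N''] [Module R N''] {f : N →ₗ[R] N'} {g : N' →ₗ[R] N''}
    (_ : Function.Injective f) (_ : Function.Exact f g) (_ : Function.Surjective g),
    Function.Exact (map i f) (map i g)
  e₃ : ∀ (i : ℕ) {N N' N'' : Type u} [AddCommGroup N] [Module R N] [AddCommGroup N'] [Module R N']
    [AddCommGroup N''] [Module R N''] {f : N →ₗ[R] N'} {g : N' →ₗ[R] N''}
    (hf : Function.Injective f) (hfg : Function.Exact f g) (hg : Function.Surjective g),
    Function.Exact (map i g) (d i hf hfg hg)
  e₁ : ∀ (i : ℕ) {N N' N'' : Type u} [AddCommGroup N] [Module R N] [AddCommGroup N'] [Module R N']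
    [AddCommGroup N''] [Module R N''] {f : N →ₗ[R] N'} {g : N' →ₗ[R] N''}
    (hf : Function.Injective f) (hfg : Function.Exact f g) (hg : Function.Surjective g),
    Function.Exact (d i hf hfg hg) (map (i + 1) f)
  i₀ : ∀ {N N' : Type u} [AddCommGroup N] [Module R N] [AddCommGroup N'] [Module R N']
    {f : N →ₗ[R] N'} (_ : Function.Injective f), Function.Injective (map 0 f)

attribute [instance] DF.acg DF.mod

/-- local cohomology δ-functor -/
def TDF (a : Ideal R) : DF R where
  H i N _ _ := T a i N
  acg i N _ _ := inferInstance
  mod i N _ _ := inferInstance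
  map i _ _ _ _ _ _ f := mapT a i f
  d i _ _ _ _ _ _ _ _ _ _ _ hf hfg hg := dT a i hf hfg hg
  lsmul i _ _ _ r z := mapT_lsmul r z
  e₂ i _ _ _ _ _ _ _ _ _ _ _ hf hfg hg := exact₂ hf hfg hg
  e₃ i _ _ _ _ _ _ _ _ _ _ _ hf hfg hg := exact₃ hf hfg hg
  e₁ i _ _ _ _ _ _ _ _ _ _ _ hf hfg hg := exact₁ hf hfg hg
  i₀ hf := inj₀ hf

section cmp
variable (F G : DF R)
  (θ : ∀ (i : ℕ) (N : Type u) [AddCommGroup N] [Module R N], F.H i N →ₗ[R] G.H i N)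
  (hmap : ∀ (i : ℕ) {N N' : Type u} [AddCommGroup N] [Module R N] [AddCommGroup N'] [Module R N']
    (f : N →ₗ[R] N') (z : F.H i N), θ i N' (F.map i f z) = G.map i f (θ i N z))
  (hd : ∀ (i : ℕ) {N N' N'' : Type u} [AddCommGroup N] [Module R N] [AddCommGroup N'] [Module R N']
    [AddCommGroup N''] [Module R N''] {f : N →ₗ[R] N'} {g : N' →ₗ[R] N''}
    (hf : Function.Injective f) (hfg : Function.Exact f g) (hg : Function.Surjective g)
    (z : F.H i N''), θ (i + 1) N (F.d i hf hfg hg z) = G.d i hf hfg hg (θ i N'' z))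

include hmap hd in
lemma cmp_ses {N N' N'' : Type u} [AddCommGroup N] [Module R N] [AddCommGroup N'] [Module R N']
    [AddCommGroup N''] [Module R N''] {f : N →ₗ[R] N'} {g : N' →ₗ[R] N''}
    (hf : Function.Injective f) (hfg : Function.Exact f g) (hg : Function.Surjective g)
    (h1 : ∀ i, Function.Bijective (θ i N)) (h3 : ∀ i, Function.Bijective (θ i N'')) (i : ℕ) :
    Function.Bijective (θ i N') := by
  constructor
  · rw [injective_iff_map_eq_zero]
    intro z hz
    have hgz : F.map i g z = 0 := by
      apply (h3 i).1
      rw [hmap, hz, map_zero, map_zero]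
    obtain ⟨w, rfl⟩ := (F.e₂ i hf hfg hg z).mp hgz
    rw [hmap] at hz
    cases i with
    | zero =>
      have h0 : θ 0 N w = 0 := G.i₀ hf (by rw [hz, map_zero])
      have : w = 0 := (h1 0).1 (by rw [h0, map_zero])
      rw [this, map_zero]
    | succ i =>
      obtain ⟨v, hv⟩ := (G.e₁ i hf hfg hg _).mp hz
      obtain ⟨v, rfl⟩ := (h3 i).2 v
      rw [← hd] at hv
      rw [← (h1 _).1 hv]
      exact (F.e₁ i hf hfg hg).apply_apply_eq_zero v
  · intro y
    obtain ⟨w, hw⟩ := (h3 i).2 (G.map i g y)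
    have h0 : F.d i hf hfg hg w = 0 := by
      apply (h1 (i + 1)).1
      rw [hd, hw, map_zero]
      exact (G.e₃ i hf hfg hg).apply_apply_eq_zero y
    obtain ⟨z, rfl⟩ := (F.e₃ i hf hfg hg w).mp h0
    have h4 : G.map i g (y - θ i N' z) = 0 := by
      rw [map_sub, ← hmap, hw, sub_self]
    obtain ⟨v, hv⟩ := (G.e₂ i hf hfg hg _).mp h4
    obtain ⟨v, rfl⟩ := (h1 i).2 v
    refine ⟨z + F.map i f v, ?_⟩
    rw [map_add, hmap, hv]
    abel

include hmap hd in
lemma cmp_step {x : R} {N : Type u} [AddCommGroup N] [Module R N]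
    (hx : Function.Injective (LinearMap.lsmul R N x))
    (h3 : ∀ i, Function.Bijective (θ i (QuotSMulTop x N)))
    (hF : ∀ i (z : F.H i N), ∃ k : ℕ, x ^ k • z = 0)
    (hG : ∀ i (z : G.H i N), ∃ k : ℕ, x ^ k • z = 0) (i : ℕ) :
    Function.Bijective (θ i N) := by
  have hsurj : ∀ i, (∀ y : G.H i N, x • y = 0 → y ∈ Set.range (θ i N)) →
      Function.Surjective (θ i N) := by
    intro i hi y
    obtain ⟨k, hk⟩ := hG i y
    induction k generalizing y with
    | zero => exact ⟨0, by rw [map_zero]; simpa using hk.symm⟩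
    | succ k ih =>
      obtain ⟨z, hz⟩ := ih (x • y) (by rw [smul_smul, ← pow_succ, hk])
      have h0 : F.map i (qx x N) z = 0 := by
        apply (h3 i).1
        rw [hmap, hz, map_zero, ← G.lsmul i x y]
        exact (G.e₂ i hx (qx_exact x) (qx_surj x)).apply_apply_eq_zero y
      obtain ⟨w, hw⟩ := (F.e₂ i hx (qx_exact x) (qx_surj x) z).mp h0
      rw [F.lsmul] at hw
      obtain ⟨v, hv⟩ := hi (y - θ i N w) (by rw [smul_sub, ← map_smul, hw, hz, sub_self])
      exact ⟨v + w, by rw [map_add, hv]; abel⟩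
  have hinj : ∀ i, (∀ z : F.H i N, x • z = 0 → θ i N z = 0 → z = 0) →
      Function.Injective (θ i N) := by
    intro i hi
    rw [injective_iff_map_eq_zero]
    intro z hz
    obtain ⟨k, hk⟩ := hF i z
    induction k generalizing z with
    | zero => simpa using hk
    | succ k ih =>
      refine hi z (ih (x • z) (by rw [map_smul, hz, smul_zero]) ?_) hz
      rw [smul_smul, ← pow_succ, hk]
  induction i with
  | zero =>
    constructor
    · refine hinj 0 fun z hz _ => ?_
      exact F.i₀ hx (by rw [F.lsmul, hz, map_zero])
    · refine hsurj 0 fun z hz => ⟨0, ?_⟩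
      rw [map_zero]
      exact (G.i₀ hx (by rw [G.lsmul, hz, map_zero])).symm
  | succ i ih =>
    constructor
    · refine hinj _ fun z hz h0 => ?_
      rw [← F.lsmul] at hz
      obtain ⟨w, rfl⟩ := (F.e₁ i hx (qx_exact x) (qx_surj x) z).mp hz
      rw [hd] at h0
      obtain ⟨v, hv⟩ := (G.e₃ i hx (qx_exact x) (qx_surj x) _).mp h0
      obtain ⟨v, rfl⟩ := ih.2 v
      rw [← hmap] at hv
      rw [← (h3 i).1 hv]
      exact (F.e₃ i hx (qx_exact x) (qx_surj x)).apply_apply_eq_zero v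
    · refine hsurj _ fun y hy => ?_
      rw [← G.lsmul] at hy
      obtain ⟨w, rfl⟩ := (G.e₁ i hx (qx_exact x) (qx_surj x) y).mp hy
      obtain ⟨w, rfl⟩ := (h3 i).2 w
      exact ⟨_, hd i hx (qx_exact x) (qx_surj x) w⟩

include hmap hd in
theorem cmp_main [IsNoetherianRing R] (a : Ideal R)
    (hF : ∀ x ∈ a, ∀ i (N : Type u) [AddCommGroup N] [Module R N] (z : F.H i N),
      ∃ k : ℕ, x ^ k • z = 0)
    (hG : ∀ x ∈ a, ∀ i (N : Type u) [AddCommGroup N] [Module R N] (z : G.H i N),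
      ∃ k : ℕ, x ^ k • z = 0)
    (Z : Set (PrimeSpectrum R))
    (hbase : ∀ (q : Ideal R) (hq : q.IsPrime), ⟨q, hq⟩ ∈ Z → a ≤ q →
      ∀ i, Function.Bijective (θ i (R ⧸ q)))
    (hzero : ∀ (N : Type u) [AddCommGroup N] [Module R N] [Subsingleton N],
      ∀ i, Function.Bijective (θ i N))
    (N : Type u) [AddCommGroup N] [Module R N] [Module.Finite R N]
    (hN : Module.support R N ⊆ Z) : ∀ i, Function.Bijective (θ i N) := by
  revert hN
  refine devissage (R := R) (P := fun N _ _ _ => Module.support R N ⊆ Z →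
    ∀ i, Function.Bijective (θ i N)) ?_ ?_ ?_ N
  · intro N _ _ _ _ _
    exact hzero N
  · intro N₁ _ _ _ N₂ _ _ _ N₃ _ _ _ f g hf hfg hg h1 h3 hN
    exact cmp_ses F G θ hmap hd hf hfg hg (h1 ((Module.support_subset_of_injective f hf).trans hN))
      (h3 ((Module.support_subset_of_surjective g hg).trans hN))
  · intro q hq ih hZ
    by_cases haq : a ≤ q
    · exact hbase q hq (hZ (mem_support_quot.mpr le_rfl)) haq
    · obtain ⟨x, hxa, hxq⟩ := Set.not_subset.mp haq
      refine cmp_step F G θ hmap hd (lsmul_inj hxq) (ih _ (fun p hp => support_quotx hxq hp) ?_)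
        (fun i => hF x hxa i _) (fun i => hG x hxa i _)
      exact (Module.support_subset_of_surjective _ (qx_surj x)).trans hZ

end cmp

lemma bij_sub {A B : Type*} [AddCommGroup A] [AddCommGroup B] [Module R A] [Module R B]
    (f : A →ₗ[R] B) (hA : ∀ a : A, a = 0) (hB : ∀ b : B, b = 0) : Function.Bijective f :=
  ⟨fun x y _ => by rw [hA x, hA y], fun b => ⟨0, by rw [hB b, map_zero]⟩⟩

/-- change of ideals -/
theorem chg_bij [IsNoetherianRing R] {a b : Ideal R} (hab : a ≤ b) (N : Type u)
    [AddCommGroup N] [Module R N] [Module.Finite R N]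
    (h : ∀ q ∈ Module.support R N, a ≤ q.asIdeal → b ≤ q.asIdeal) (i : ℕ) :
    Function.Bijective (chg hab i N) := by
  refine cmp_main (TDF b) (TDF a) (fun i N _ _ => chg hab i N)
    (fun i _ _ _ _ _ _ f z => chg_mapT hab f z)
    (fun i _ _ _ _ _ _ _ _ _ _ _ hf hfg hg z => chg_dT hab hf hfg hg z) a
    (fun x hx i N _ _ z => torsionT_pow (a := b) (hab hx) z)
    (fun x hx i N _ _ z => torsionT_pow (a := a) hx z)
    {q | a ≤ q.asIdeal → b ≤ q.asIdeal} ?_ ?_ N h i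
  · intro q hq hZ haq i
    have hbq := hZ haq
    cases i with
    | zero =>
      have h1 := evT_bijective (isATors_quot haq)
      have h2 := evT_bijective (isATors_quot hbq)
      have h3 : evT a (R ⧸ q) ∘ chg hab 0 (R ⧸ q) = evT b (R ⧸ q) := funext fun z => evT_chg hab z
      rw [← h3] at h2
      exact (Function.Bijective.of_comp_iff' h1 _).mp h2
    | succ i =>
      exact bij_sub _ (T_tors_zero b i _ (isATors_quot hbq)) (T_tors_zero a i _ (isATors_quot haq))
  · intro N _ _ _ i
    exact bij_sub _ (T_sub b i) (T_sub a i)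

end LCX

end

noncomputable section


open CategoryTheory

namespace LCX

variable {R : Type u} [CommRing R]

open TensorProduct

section baseA
variable {S : Type u} [CommRing S] [Algebra R S]

lemma injective_restrict [Module.Flat R S] {I : Type u} [AddCommGroup I] [Module R I] [Module S I]
    [IsScalarTower R S I] (hI : Module.Injective S I) : Module.Injective R I := by
  constructor
  intro X Y _ _ _ _ f hf g
  have hinj : Function.Injective (f.baseChange S) :=
    Module.Flat.lTensor_preserves_injective_linearMap (M := S) f hf
  obtain ⟨h, hh⟩ := hI.out (f.baseChange S) hinj (g.liftBaseChange S)
  refine ⟨(h.restrictScalars R) ∘ₗ (TensorProduct.mk R S Y 1), fun x => ?_⟩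
  have := hh (1 ⊗ₜ x)
  rw [LinearMap.baseChange_tmul, LinearMap.liftBaseChange_tmul, one_smul] at this
  exact this

lemma ators_map (a : Ideal R) (N : Type u) [AddCommGroup N] [Module R N] [Module S N]
    [IsScalarTower R S N] (z : N) :
    z ∈ ators (a.map (algebraMap R S)) N ↔ z ∈ ators a N := by
  rw [mem_ators, mem_ators]
  refine exists_congr fun t => ?_
  constructor
  · intro h r hr
    rw [← algebraMap_smul S]
    refine h _ ?_
    rw [← Ideal.map_pow]
    exact Ideal.mem_map_of_mem _ hr
  · intro h
    rw [← Ideal.map_pow]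
    have : (a ^ t).map (algebraMap R S) ≤ LinearMap.ker (LinearMap.toSpanSingleton S N z) := by
      rw [Ideal.map_le_iff_le_comap]
      intro r hr
      rw [Ideal.mem_comap, LinearMap.mem_ker, LinearMap.toSpanSingleton_apply, algebraMap_smul]
      exact h r hr
    intro r hr
    exact this hr

/-- degree zero comparison -/
lemma base0 (a : Ideal R) (N : Type u) [AddCommGroup N] [Module R N] [Module S N]
    [IsScalarTower R S N] : ∃ e : T (a.map (algebraMap R S)) 0 N ≃+ T a 0 N,
      ∀ z, evT a N (e z) = evT _ N z := by
  have h : ∀ z : T (a.map (algebraMap R S)) 0 N, ∃ w : T a 0 N, evT a N w = evT _ N z := by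
    intro z
    have : evT _ N z ∈ LinearMap.range (evT a N) := by
      rw [range_evT, ← ators_map (S := S), ← range_evT]
      exact ⟨z, rfl⟩
    exact this
  choose e he using h
  have hadd : ∀ x y, e (x + y) = e x + e y := by
    intro x y
    apply evT_injective
    simp only [he, map_add]
  refine ⟨AddEquiv.ofBijective (AddMonoidHom.mk' e hadd) ⟨?_, ?_⟩, he⟩
  · intro x y hxy
    apply evT_injective
    rw [← he, ← he]
    exact congrArg _ hxy
  · intro w
    have : evT a N w ∈ LinearMap.range (evT (a.map (algebraMap R S)) N) := by
      rw [range_evT, ators_map (S := S), ← range_evT]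
      exact ⟨w, rfl⟩
    obtain ⟨z, hz⟩ := this
    refine ⟨z, evT_injective ?_⟩
    rw [← hz]
    exact he z

theorem baseA [Module.Flat R S] [IsNoetherianRing R] [IsNoetherianRing S] (a : Ideal R) (i : ℕ) :
    ∀ (N : Type u) [AddCommGroup N] [Module R N] [Module S N] [IsScalarTower R S N],
    Nonempty (T (a.map (algebraMap R S)) i N ≃+ T a i N) := by
  induction i with
  | zero =>
    intro N _ _ _ _
    obtain ⟨e, -⟩ := base0 (S := S) a N
    exact ⟨e⟩
  | succ i ih =>
    intro N _ _ _ _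
    obtain ⟨I, _, _, f, hI, hf⟩ := exists_injective S N
    letI : Module R I := Module.compHom I (algebraMap R S)
    haveI : IsScalarTower R S I := ⟨fun r s x => by
      rw [Algebra.smul_def, mul_smul]; rfl⟩
    have hI' : Module.Injective R I := injective_restrict hI
    let g : I →ₗ[S] (I ⧸ LinearMap.range f) := Submodule.mkQ _
    have hfg : Function.Exact f g := LinearMap.exact_map_mkQ_range f
    have hg : Function.Surjective g := Submodule.mkQ_surjective _
    let f' := f.restrictScalars R
    let g' := g.restrictScalars R
    have hf' : Function.Injective f' := hf
    have hfg' : Function.Exact f' g' := hfg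
    have hg' : Function.Surjective g' := hg
    have hsS : Function.Surjective (dT (a.map (algebraMap R S)) i hf hfg hg) := fun z =>
      (exact₁ hf hfg hg z).mp (T_injective_zero i hI _)
    have hsR : Function.Surjective (dT a i hf' hfg' hg') := fun z =>
      (exact₁ hf' hfg' hg' z).mp (T_injective_zero i hI' _)
    have key : ∃ e : T (a.map (algebraMap R S)) i (I ⧸ LinearMap.range f) ≃+
        T a i (I ⧸ LinearMap.range f), ∀ z, dT (a.map (algebraMap R S)) i hf hfg hg z = 0 ↔
          dT a i hf' hfg' hg' (e z) = 0 := by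
      cases i with
      | zero =>
        obtain ⟨e, he⟩ := base0 (S := S) a (I ⧸ LinearMap.range f)
        obtain ⟨e', he'⟩ := base0 (S := S) a I
        refine ⟨e, fun z => ?_⟩
        rw [exact₃ hf hfg hg z, exact₃ hf' hfg' hg' (e z)]
        constructor
        · rintro ⟨w, rfl⟩
          refine ⟨e' w, evT_injective ?_⟩
          rw [he, evT_mapT, evT_mapT, he']
          rfl
        · rintro ⟨w, hw⟩
          refine ⟨e'.symm w, evT_injective ?_⟩
          rw [← he z, ← hw, evT_mapT, evT_mapT, ← he', AddEquiv.apply_symm_apply]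
          rfl
      | succ i =>
        obtain ⟨e⟩ := ih (I ⧸ LinearMap.range f)
        refine ⟨e, fun z => ?_⟩
        constructor
        · intro h
          obtain ⟨w, rfl⟩ := (exact₃ hf hfg hg z).mp h
          rw [T_injective_zero i hI w, map_zero, map_zero, map_zero]
        · intro h
          obtain ⟨w, hw⟩ := (exact₃ hf' hfg' hg' (e z)).mp h
          rw [T_injective_zero i hI' w, map_zero] at hw
          rw [e.map_eq_zero_iff.mp hw.symm, map_zero]
    obtain ⟨e, he⟩ := key
    let φ : T (a.map (algebraMap R S)) i (I ⧸ LinearMap.range f) →+ T a (i + 1) N :=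
      (dT a i hf' hfg' hg').toAddMonoidHom.comp e.toAddMonoidHom
    have hφ : Function.Surjective φ := hsR.comp e.surjective
    let ψ := (dT (a.map (algebraMap R S)) i hf hfg hg).toAddMonoidHom
    have hψ : Function.Surjective ψ := hsS
    have hker : ψ.ker = φ.ker := by
      ext z
      exact he z
    exact ⟨(QuotientAddGroup.quotientKerEquivOfSurjective ψ hψ).symm.trans
      ((QuotientAddGroup.quotientAddEquivOfEq hker).trans
        (QuotientAddGroup.quotientKerEquivOfSurjective φ hφ))⟩

end baseA

section baseB
variable (S : Type u) [CommRing S] [Algebra R S]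

/-- `S ⊗ T` δ-functor -/
def SDF [Module.Flat R S] (a : Ideal R) : DF R where
  H i N _ _ := S ⊗[R] T a i N
  acg _ _ _ _ := inferInstance
  mod _ _ _ _ := inferInstance
  map i _ _ _ _ _ _ f := (mapT a i f).lTensor S
  d i _ _ _ _ _ _ _ _ _ _ _ hf hfg hg := (dT a i hf hfg hg).lTensor S
  lsmul i N _ _ r z := by
    have : mapT a i (LinearMap.lsmul R N r) = LinearMap.lsmul R _ r :=
      LinearMap.ext fun z => mapT_lsmul r z
    rw [this]
    induction z with
    | zero => simp
    | tmul s z => simp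
    | add x y hx hy => rw [map_add, hx, hy, smul_add]
  e₂ i _ _ _ _ _ _ _ _ _ _ _ hf hfg hg := Module.Flat.lTensor_exact S (exact₂ hf hfg hg)
  e₃ i _ _ _ _ _ _ _ _ _ _ _ hf hfg hg := Module.Flat.lTensor_exact S (exact₃ hf hfg hg)
  e₁ i _ _ _ _ _ _ _ _ _ _ _ hf hfg hg := Module.Flat.lTensor_exact S (exact₁ hf hfg hg)
  i₀ hf := Module.Flat.lTensor_preserves_injective_linearMap _ (inj₀ hf)

/-- `T (S ⊗ )` δ-functor -/
def TSDF [Module.Flat R S] (a : Ideal R) : DF R where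
  H i N _ _ := T a i (S ⊗[R] N)
  acg _ _ _ _ := inferInstance
  mod _ _ _ _ := inferInstance
  map i _ _ _ _ _ _ f := mapT a i (f.lTensor S)
  d i _ _ _ _ _ _ _ _ _ _ _ hf hfg hg :=
    dT a i (Module.Flat.lTensor_preserves_injective_linearMap (M := S) _ hf)
      (Module.Flat.lTensor_exact S hfg) (LinearMap.lTensor_surjective S hg)
  lsmul i N _ _ r z := by
    have : (LinearMap.lsmul R N r).lTensor S = LinearMap.lsmul R _ r := by
      ext s n
      simp
    rw [this, mapT_lsmul]
  e₂ i _ _ _ _ _ _ _ _ _ _ _ hf hfg hg := exact₂ (Module.Flat.lTensor_preserves_injective_linearMap (M := S) _ hf)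
    (Module.Flat.lTensor_exact S hfg) (LinearMap.lTensor_surjective S hg)
  e₃ i _ _ _ _ _ _ _ _ _ _ _ hf hfg hg := exact₃ (Module.Flat.lTensor_preserves_injective_linearMap (M := S) _ hf)
    (Module.Flat.lTensor_exact S hfg) (LinearMap.lTensor_surjective S hg)
  e₁ i _ _ _ _ _ _ _ _ _ _ _ hf hfg hg := exact₁ (Module.Flat.lTensor_preserves_injective_linearMap (M := S) _ hf)
    (Module.Flat.lTensor_exact S hfg) (LinearMap.lTensor_surjective S hg)
  i₀ hf := inj₀ (Module.Flat.lTensor_preserves_injective_linearMap (M := S) _ hf)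

variable (a : Ideal R) (i : ℕ) (N : Type u) [AddCommGroup N] [Module R N]

/-- comparison map -/
def thS : S ⊗[R] T a i N →ₗ[R] T a i (S ⊗[R] N) :=
  TensorProduct.lift
    { toFun := fun s => mapT a i (TensorProduct.mk R S N s)
      map_add' := fun s s' => by
        ext z
        rw [map_add, mapT_add, LinearMap.add_apply]
      map_smul' := fun r s => by
        ext z
        rw [map_smul, mapT_smul]
        rfl }

variable {a i N}
@[simp] lemma thS_tmul (s : S) (z : T a i N) :
    thS S a i N (s ⊗ₜ z) = mapT a i (TensorProduct.mk R S N s) z := rfl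

lemma thS_mapT {N' : Type u} [AddCommGroup N'] [Module R N'] (f : N →ₗ[R] N')
    (z : S ⊗[R] T a i N) :
    thS S a i N' ((mapT a i f).lTensor S z) = mapT a i (f.lTensor S) (thS S a i N z) := by
  induction z with
  | zero => simp
  | tmul s z =>
    rw [LinearMap.lTensor_tmul, thS_tmul, thS_tmul, mapT_comp, mapT_comp]
    congr 1
  | add x y hx hy => simp only [map_add, hx, hy]

lemma thS_dT [Module.Flat R S] {N' N'' : Type u} [AddCommGroup N'] [Module R N']
    [AddCommGroup N''] [Module R N''] {f : N →ₗ[R] N'} {g : N' →ₗ[R] N''}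
    (hf : Function.Injective f) (hfg : Function.Exact f g) (hg : Function.Surjective g)
    (z : S ⊗[R] T a i N'') :
    thS S a (i + 1) N ((dT a i hf hfg hg).lTensor S z) =
    dT a i (Module.Flat.lTensor_preserves_injective_linearMap (M := S) _ hf)
      (Module.Flat.lTensor_exact S hfg) (LinearMap.lTensor_surjective S hg) (thS S a i N'' z) := by
  induction z with
  | zero => simp
  | tmul s z =>
    rw [LinearMap.lTensor_tmul, thS_tmul, thS_tmul]
    refine dT_nat _ _ _ _ _ _ _ (TensorProduct.mk R S N' s) _ ?_ ?_ z
    · ext; rfl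
    · ext; rfl
  | add x y hx hy => simp only [map_add, hx, hy]

lemma evT_thS (z : S ⊗[R] T a 0 N) :
    evT a _ (thS S a 0 N z) = (evT a N).lTensor S z := by
  induction z with
  | zero => simp
  | tmul s z =>
    rw [thS_tmul, evT_mapT, LinearMap.lTensor_tmul]
    rfl
  | add x y hx hy => simp only [map_add, hx, hy]

lemma isATors_tensor (h : IsATors a N) : IsATors a (S ⊗[R] N) := by
  intro z
  change z ∈ ators a _
  induction z with
  | zero => exact zero_mem _
  | tmul s z =>
    obtain ⟨t, ht⟩ := h z
    exact ⟨t, fun r hr => by rw [← TensorProduct.tmul_smul, ht r hr, TensorProduct.tmul_zero]⟩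
  | add x y hx hy => exact add_mem hx hy

theorem thS_bij [IsNoetherianRing R] [Module.Flat R S] [Module.Finite R N] (i : ℕ) :
    Function.Bijective (thS S a i N) := by
  refine cmp_main (SDF S a) (TSDF S a) (fun i N _ _ => thS S a i N)
    (fun i _ _ _ _ _ _ f z => thS_mapT S f z)
    (fun i _ _ _ _ _ _ _ _ _ _ _ hf hfg hg z => thS_dT S hf hfg hg z) a
    ?_ (fun x hx i N _ _ z => torsionT_pow (a := a) hx z) Set.univ ?_ ?_ N (Set.subset_univ _) i
  · intro x hx i N _ _ z
    obtain ⟨t, ht⟩ := isATors_tensor S (isATors_T (a := a) (N := N) i) z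
    exact ⟨t, ht _ (Ideal.pow_mem_pow hx t)⟩
  · intro q hq _ haq i
    have h1 := isATors_quot haq
    have h2 := isATors_tensor S h1
    cases i with
    | zero =>
      have h3 : evT a _ ∘ thS S a 0 (R ⧸ q) = (evT a (R ⧸ q)).lTensor S :=
        funext fun z => evT_thS S z
      have h4 : Function.Bijective ((evT a (R ⧸ q)).lTensor S) :=
        ⟨Module.Flat.lTensor_preserves_injective_linearMap (M := S) _ (evT_bijective h1).1,
          LinearMap.lTensor_surjective S (evT_bijective h1).2⟩
      rw [← h3] at h4
      exact (Function.Bijective.of_comp_iff' (evT_bijective h2) _).mp h4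
    | succ i =>
      refine bij_sub _ (fun z => ?_) (T_tors_zero a i _ h2)
      have : Subsingleton (T a (i + 1) (R ⧸ q)) :=
        ⟨fun x y => by rw [T_tors_zero a i _ h1 x, T_tors_zero a i _ h1 y]⟩
      exact Subsingleton.elim (α := S ⊗[R] T a (i + 1) (R ⧸ q)) _ _
  · intro N _ _ _ i
    refine bij_sub _ (fun z => ?_) (T_sub a i)
    have : Subsingleton (T a i N) := ⟨fun x y => by rw [T_sub a i x, T_sub a i y]⟩
    exact Subsingleton.elim (α := S ⊗[R] T a i N) _ _

end baseB

section compl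
open IsLocalRing
variable [IsNoetherianRing R] [IsLocalRing R]

variable (R) in
/-- completion -/
abbrev Rh : Type u := AdicCompletion (maximalIdeal R) R

lemma Rh_approx (t : ℕ) (s : Rh R) : ∃ r : R, s - algebraMap R (Rh R) r ∈
    (maximalIdeal R) ^ t • (⊤ : Submodule R (Rh R)) := by
  obtain ⟨r, hr⟩ := Submodule.Quotient.mk_surjective _ (AdicCompletion.eval (maximalIdeal R) R t s)
  refine ⟨r, ?_⟩
  rw [AdicCompletion.algebraMap_apply,
    AdicCompletion.pow_smul_top_eq_ker_eval (maximalIdeal R).fg_of_isNoetherianRing,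
    LinearMap.mem_ker, map_sub, ← hr]
  simp [AdicCompletion.eval]

instance : Module.Flat R (Rh R) := AdicCompletion.flat_of_isNoetherian _

instance : Module.FaithfullyFlat R (Rh R) := Module.FaithfullyFlat.of_flat_of_isLocalHom

lemma tors_tensor {X : Type u} [AddCommGroup X] [Module R X] (h : IsATors (maximalIdeal R) X) :
    Function.Bijective (TensorProduct.mk R (Rh R) X 1) := by
  constructor
  · exact Module.FaithfullyFlat.tensorProduct_mk_injective _
  · intro z
    change z ∈ LinearMap.range (TensorProduct.mk R (Rh R) X 1)
    induction z with
    | zero => exact zero_mem _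
    | tmul s x =>
      obtain ⟨t, ht⟩ := h x
      obtain ⟨r, hr⟩ := Rh_approx t s
      refine ⟨r • x, ?_⟩
      have h0 : ∀ y ∈ (maximalIdeal R) ^ t • (⊤ : Submodule R (Rh R)), y ⊗ₜ[R] x = 0 := by
        intro y hy
        refine Submodule.smul_induction_on hy ?_ ?_
        · intro r hr n _
          rw [TensorProduct.smul_tmul, ht r hr, TensorProduct.tmul_zero]
        · intro y z hy hz
          rw [TensorProduct.add_tmul, hy, hz, add_zero]
      have := h0 _ hr
      rw [TensorProduct.sub_tmul, sub_eq_zero] at this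
      rw [this, TensorProduct.mk_apply, ← TensorProduct.smul_tmul, Algebra.algebraMap_eq_smul_one]
    | add x y hx hy => exact add_mem hx hy

theorem base_change [IsNoetherianRing (Rh R)] (a : Ideal R) (M : Type u) [AddCommGroup M]
    [Module R M] [Module.Finite R M] (n : ℕ) (hn : DL R (n + 1) M) :
    Nonempty (T a n M ≃+ T (a.map (algebraMap R (Rh R))) n
      (AdicCompletion (maximalIdeal R) M)) := by
  have h1 := tors_tensor (T_mtors a M n hn)
  have h2 := thS_bij (Rh R) (a := a) (N := M) n
  obtain ⟨e⟩ := baseA (R := R) (S := Rh R) a n (Rh R ⊗[R] M)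
  let e3 : T (a.map (algebraMap R (Rh R))) n (Rh R ⊗[R] M) ≃ₗ[Rh R] _ :=
    congrT (AdicCompletion.ofTensorProductEquivOfFiniteNoetherian (maximalIdeal R) M)
  exact ⟨((LinearEquiv.ofBijective _ h1).toAddEquiv.trans
    (LinearEquiv.ofBijective _ h2).toAddEquiv).trans (e.symm.trans e3.toAddEquiv)⟩

end compl

end LCX

end

noncomputable section
open CategoryTheory
namespace LCX
variable {R : Type u} [CommRing R]

/-- `E` is essential over `K`. -/
def Ess {I : Type u} [AddCommGroup I] [Module R I] (K E : Submodule R I) : Prop :=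
  ∀ x ∈ E, x ≠ 0 → ∃ r : R, r • x ∈ K ∧ r • x ≠ 0

lemma exists_hull {I : Type u} [AddCommGroup I] [Module R I] (hI : Module.Injective R I)
    (K : Submodule R I) : ∃ E : Submodule R I, K ≤ E ∧ Ess K E ∧ Module.Injective R E := by
  obtain ⟨E, hKE, hE⟩ := zorn_le_nonempty₀ {E : Submodule R I | Ess K E} (by
    intro c hc hch y hy
    refine ⟨sSup c, ?_, fun z hz => le_sSup hz⟩
    intro x hx hx0
    obtain ⟨F, hF, hxF⟩ := (Submodule.mem_sSup_of_directed ⟨y, hy⟩ hch.directedOn).mp hx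
    exact hc hF x hxF hx0) K (fun x hx hx0 => ⟨1, by simpa using hx, by simpa using hx0⟩)
  obtain ⟨C, -, hC⟩ := zorn_le_nonempty₀ {C : Submodule R I | ∀ x ∈ C, x ∈ E → x = 0} (by
    intro c hc hch y hy
    refine ⟨sSup c, ?_, fun z hz => le_sSup hz⟩
    intro x hx hxE
    obtain ⟨F, hF, hxF⟩ := (Submodule.mem_sSup_of_directed ⟨y, hy⟩ hch.directedOn).mp hx
    exact hc hF x hxF hxE) ⊥ (fun x hx _ => by simpa using hx)
  refine ⟨E, hKE, hE.prop, ?_⟩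
  let j : E →ₗ[R] (I ⧸ C) := C.mkQ ∘ₗ E.subtype
  have hj : Function.Injective j := by
    rw [injective_iff_map_eq_zero]
    rintro ⟨x, hx⟩ h
    have : x ∈ C := by simpa [j] using h
    exact Subtype.ext (hC.prop x this hx)
  obtain ⟨ψ, hψ⟩ := hI.out j hj E.subtype
  -- elements of the quotient hit the image of E
  have hess : ∀ y : I ⧸ C, y ≠ 0 → ∃ r : R, ∃ e : E, r • y = j e ∧ r • y ≠ 0 := by
    intro y hy
    obtain ⟨x, rfl⟩ := C.mkQ_surjective y
    have hxC : x ∉ C := fun h => hy (by simpa using h)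
    have : ¬ (C ⊔ Submodule.span R {x}) ≤ C := fun h =>
      hxC (h (Submodule.mem_sup_right (Submodule.mem_span_singleton_self x)))
    have h2 : ¬ ∀ z ∈ C ⊔ Submodule.span R {x}, z ∈ E → z = 0 := fun h =>
      this (hC.le_of_ge h le_sup_left)
    push Not at h2
    obtain ⟨z, hz, hzE, hz0⟩ := h2
    obtain ⟨c, hc, w, hw, rfl⟩ := Submodule.mem_sup.mp hz
    obtain ⟨r, rfl⟩ := Submodule.mem_span_singleton.mp hw
    have h3 : r • C.mkQ x = j ⟨c + r • x, hzE⟩ := by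
      simp only [j, LinearMap.comp_apply, Submodule.subtype_apply, map_add, map_smul]
      rw [(Submodule.Quotient.mk_eq_zero C).mpr hc |> (show C.mkQ c = 0 from ·), zero_add]
    refine ⟨r, ⟨_, hzE⟩, h3, ?_⟩
    rw [h3, Ne, map_eq_zero_iff j hj]
    exact fun h => hz0 (congrArg Subtype.val h)
  have hψi : Function.Injective ψ := by
    rw [injective_iff_map_eq_zero]
    intro y hy
    by_contra h0
    obtain ⟨r, e, h1, h2⟩ := hess y h0
    have : ψ (r • y) = 0 := by rw [map_smul, hy, smul_zero]
    rw [h1, hψ] at this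
    have he : e = 0 := Subtype.ext this
    rw [h1, he, map_zero] at h2
    exact h2 rfl
  have hEr : E ≤ LinearMap.range ψ := fun x hx => ⟨j ⟨x, hx⟩, hψ _⟩
  have hrE : LinearMap.range ψ ≤ E := by
    refine hE.le_of_ge (y := LinearMap.range ψ) ?_ hEr
    rintro _ ⟨y, rfl⟩ hy
    obtain ⟨r, e, h1, h2⟩ := hess y (fun h => hy (by rw [h, map_zero]))
    have h3 : r • ψ y = e := by rw [← map_smul, h1, hψ]; rfl
    have h4 : (e : I) ≠ 0 := by
      rw [← h3, ← map_smul, Ne, map_eq_zero_iff ψ hψi]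
      exact h2
    obtain ⟨s, hs, hs0⟩ := hE.prop e e.2 h4
    exact ⟨s * r, by rw [mul_smul, h3]; exact hs, by rw [mul_smul, h3]; exact hs0⟩
  let ρ : I →ₗ[R] E := LinearMap.codRestrict E (ψ ∘ₗ C.mkQ) (fun x => hrE ⟨_, rfl⟩)
  have hρ : ∀ e : E, ρ e = e := fun e => Subtype.ext (hψ e)
  constructor
  intro X Y _ _ _ _ f hf g
  obtain ⟨h, hh⟩ := hI.out f hf (E.subtype ∘ₗ g)
  refine ⟨ρ ∘ₗ h, fun x => ?_⟩
  rw [LinearMap.comp_apply, hh]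
  exact hρ _

/-- The package of properties of the injective hull of the residue field -/
structure Hull (R : Type u) [CommRing R] [IsLocalRing R] where
  E : Type u
  [acg : AddCommGroup E]
  [mod : Module R E]
  inj : Module.Injective R E
  e : E
  e_ne : e ≠ 0
  e_tors : ∀ r ∈ IsLocalRing.maximalIdeal R, r • e = 0
  soc : ∀ x : E, (∀ r ∈ IsLocalRing.maximalIdeal R, r • x = 0) → ∃ r : R, x = r • e

attribute [instance] Hull.acg Hull.mod

theorem exists_Hull (R : Type u) [CommRing R] [IsLocalRing R] : Nonempty (Hull R) := by
  obtain ⟨I, _, _, f, hI, hf⟩ := exists_injective R (R ⧸ IsLocalRing.maximalIdeal R)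
  obtain ⟨E, hKE, hE, hEi⟩ := exists_hull hI (LinearMap.range f)
  have h1 : (1 : R ⧸ IsLocalRing.maximalIdeal R) ≠ 0 := one_ne_zero
  refine ⟨⟨E, hEi, ⟨f 1, hKE ⟨1, rfl⟩⟩, ?_, ?_, ?_⟩⟩
  · intro h
    exact h1 (hf ((congrArg Subtype.val h).trans (map_zero f).symm))
  · intro r hr
    refine Subtype.ext ?_
    change r • f 1 = 0
    rw [← map_smul, Algebra.smul_def, mul_one]
    change f (Ideal.Quotient.mk _ r) = 0
    rw [Ideal.Quotient.eq_zero_iff_mem.mpr hr, map_zero]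
  · rintro ⟨x, hx⟩ h
    by_cases hx0 : x = 0
    · exact ⟨0, Subtype.ext (by simp [hx0])⟩
    obtain ⟨r, ⟨y, hy⟩, hr0⟩ := hE x hx hx0
    have hru : IsUnit r := by
      by_contra hr
      exact hr0 (congrArg Subtype.val (h r ((IsLocalRing.mem_maximalIdeal r).mpr hr)))
    obtain ⟨v, rfl⟩ := hru
    obtain ⟨s, rfl⟩ := Ideal.Quotient.mk_surjective y
    refine ⟨(↑v⁻¹ : R) * s, Subtype.ext ?_⟩
    change x = (↑v⁻¹ * s : R) • f 1
    rw [mul_smul, ← map_smul, Algebra.smul_def, mul_one]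
    change x = (↑v⁻¹ : R) • f (Ideal.Quotient.mk _ s)
    rw [hy, smul_smul, Units.inv_mul, one_smul]

section dual
variable [IsLocalRing R] (h : Hull R)
variable {X Y Z : Type u} [AddCommGroup X] [Module R X] [AddCommGroup Y] [Module R Y]
  [AddCommGroup Z] [Module R Z]

lemma Hull.factor {f : X →ₗ[R] Y} {g : Y →ₗ[R] Z} (hfg : Function.Exact f g) (φ : Y →ₗ[R] h.E)
    (hφ : ∀ x, φ (f x) = 0) : ∃ ψ : Z →ₗ[R] h.E, ∀ y, ψ (g y) = φ y := by
  have hk : LinearMap.ker g ≤ LinearMap.ker φ := by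
    intro y hy
    obtain ⟨x, rfl⟩ := (hfg y).mp hy
    exact hφ x
  let φ' : (Y ⧸ LinearMap.ker g) →ₗ[R] h.E := (LinearMap.ker g).liftQ φ hk
  let g' : (Y ⧸ LinearMap.ker g) →ₗ[R] Z := (LinearMap.ker g).liftQ g le_rfl
  have hg' : Function.Injective g' := LinearMap.ker_eq_bot.mp (Submodule.ker_liftQ_eq_bot _ _ _ le_rfl)
  obtain ⟨ψ, hψ⟩ := h.inj.out g' hg' φ'
  exact ⟨ψ, fun y => hψ (Submodule.Quotient.mk y)⟩

lemma Hull.finite_mid [IsNoetherianRing R] {f : X →ₗ[R] Y} {g : Y →ₗ[R] Z}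
    (hfg : Function.Exact f g)
    [Module.Finite R (X →ₗ[R] h.E)] [Module.Finite R (Z →ₗ[R] h.E)] :
    Module.Finite R (Y →ₗ[R] h.E) := by
  have : Function.Exact (LinearMap.lcomp R h.E g) (LinearMap.lcomp R h.E f) := by
    intro φ
    constructor
    · intro hφ
      obtain ⟨ψ, hψ⟩ := h.factor hfg φ (fun x => LinearMap.congr_fun hφ x)
      exact ⟨ψ, LinearMap.ext hψ⟩
    · rintro ⟨ψ, rfl⟩
      refine LinearMap.ext fun x => ?_
      change ψ (g (f x)) = 0
      rw [hfg.apply_apply_eq_zero, map_zero]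
  have h2 := isNoetherian_of_range_eq_ker (LinearMap.lcomp R h.E g) (LinearMap.lcomp R h.E f)
    (LinearMap.exact_iff.mp this).symm
  infer_instance

lemma Hull.cogen (x : X) (hx : x ≠ 0) :
    ∃ φ : X →ₗ[R] h.E, φ x ≠ 0 := by
  let f : R →ₗ[R] X := LinearMap.toSpanSingleton R X x
  let g : R →ₗ[R] h.E := LinearMap.toSpanSingleton R h.E h.e
  have hk : ∀ y ∈ LinearMap.ker f, g y = 0 := by
    intro y hy
    refine h.e_tors y ?_
    rw [IsLocalRing.mem_maximalIdeal, mem_nonunits_iff]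
    rintro ⟨v, rfl⟩
    have : (v : R) • x = 0 := hy
    exact hx (by simpa using this)
  obtain ⟨ψ, hψ⟩ := h.factor (LinearMap.exact_subtype_ker_map f) g (fun y => hk y y.2)
  refine ⟨ψ, ?_⟩
  have := hψ 1
  simp only [f, g, LinearMap.toSpanSingleton_apply, one_smul] at this
  rw [this]
  exact h.e_ne

lemma Hull.finite_tors [IsNoetherianRing R] [Module.Finite R X]
    (hX : IsATors (IsLocalRing.maximalIdeal R) X) : Module.Finite R (X →ₗ[R] h.E) := by
  have := devissage (R := R) (fun N _ _ => IsATors (IsLocalRing.maximalIdeal R) N →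
    Module.Finite R (N →ₗ[R] h.E)) ?_ ?_ ?_ X
  · exact this hX
  · intro N _ _ _ _ _
    have : Subsingleton (N →ₗ[R] h.E) := ⟨fun f g => LinearMap.ext fun x => by
      rw [Subsingleton.elim x 0, map_zero, map_zero]⟩
    infer_instance
  · intro N₁ _ _ _ N₂ _ _ _ N₃ _ _ _ f g hf hfg hg h1 h3 hN
    have := h1 (hN.of_injective f hf)
    have := h3 (hN.of_surjective g hg)
    exact h.finite_mid hfg
  · intro q _ _ hq
    obtain ⟨t, ht⟩ := hq (Ideal.Quotient.mk q 1)
    have hmq : IsLocalRing.maximalIdeal R ≤ q := by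
      refine Ideal.IsPrime.le_of_pow_le (n := t) fun r hr => ?_
      have := ht r hr
      rw [Algebra.smul_def, map_one, mul_one] at this
      exact Ideal.Quotient.eq_zero_iff_mem.mp this
    let ev : ((R ⧸ q) →ₗ[R] h.E) →ₗ[R] h.E := LinearMap.applyₗ (Ideal.Quotient.mk q 1)
    have hev : ∀ φ, ev φ ∈ Submodule.span R {h.e} := by
      intro φ
      obtain ⟨r, hr⟩ := h.soc (ev φ) (fun r hr => by
        change r • φ (Ideal.Quotient.mk q 1) = 0
        rw [← map_smul, Algebra.smul_def, map_one, mul_one]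
        change φ (Ideal.Quotient.mk q r) = 0
        rw [Ideal.Quotient.eq_zero_iff_mem.mpr (hmq hr), map_zero])
      rw [hr]
      exact Submodule.smul_mem _ _ (Submodule.mem_span_singleton_self _)
    have hinj : Function.Injective (ev.codRestrict _ hev) := by
      intro φ ψ hφ
      have h1 : φ (Ideal.Quotient.mk q 1) = ψ (Ideal.Quotient.mk q 1) := congrArg Subtype.val hφ
      refine LinearMap.ext fun y => ?_
      obtain ⟨r, rfl⟩ := Ideal.Quotient.mk_surjective y
      have : Ideal.Quotient.mk q r = r • Ideal.Quotient.mk q 1 := by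
        rw [Algebra.smul_def, map_one, mul_one]; rfl
      rw [this, map_smul, map_smul, h1]
    exact Module.Finite.of_injective _ hinj

variable {h} in
lemma hausdorff_dual (hX : IsATors (IsLocalRing.maximalIdeal R) X) :
    IsHausdorff (IsLocalRing.maximalIdeal R) (X →ₗ[R] h.E) := by
  constructor
  intro φ hφ
  refine LinearMap.ext fun x => ?_
  obtain ⟨t, ht⟩ := hX x
  have h1 := SModEq.zero.mp (hφ t)
  refine Submodule.smul_induction_on (p := fun φ : X →ₗ[R] h.E => φ x = (0 : X →ₗ[R] h.E) x)
    h1 ?_ ?_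
  · intro r hr ψ _
    rw [LinearMap.smul_apply, ← map_smul, ht r hr, map_zero, LinearMap.zero_apply]
  · intro φ ψ h1 h2
    rw [LinearMap.add_apply, h1, h2, LinearMap.zero_apply, add_zero]

omit [IsLocalRing R] in
lemma precomplete_pi (I : Ideal R) [IsPrecomplete I R] (k : ℕ) : IsPrecomplete I (Fin k → R) := by
  constructor
  intro f hf
  have h1 : ∀ i : Fin k, ∃ L : R, ∀ n, f n i ≡ L [SMOD (I ^ n • ⊤ : Submodule R R)] := by
    intro i
    refine IsPrecomplete.prec inferInstance (f := fun n => f n i) ?_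
    intro m n hmn
    have := (hf hmn).map (LinearMap.proj i : (Fin k → R) →ₗ[R] R)
    refine SModEq.mono ?_ this
    rw [Submodule.map_smul'']
    exact Submodule.smul_mono le_rfl le_top
  choose L hL using h1
  refine ⟨L, fun n => ?_⟩
  rw [SModEq.sub_mem, pi_eq_sum_univ (f n - L) (R := R)]
  refine Submodule.sum_mem _ fun i _ => ?_
  refine Submodule.smul_mem_smul ?_ trivial
  have := SModEq.sub_mem.mp (hL i n)
  simpa using this

lemma finite_of_quot [IsAdicComplete (IsLocalRing.maximalIdeal R) R]
    [IsHausdorff (IsLocalRing.maximalIdeal R) X] {x : R}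
    (hx : x ∈ IsLocalRing.maximalIdeal R) [Module.Finite R Y] [IsNoetherianRing R]
    (g : X →ₗ[R] Y) (hg : ∀ z, g z = 0 → ∃ w, z = x • w) : Module.Finite R X := by
  obtain ⟨k, s, hs⟩ := Submodule.fg_iff_exists_fin_generating_family.mp
    (IsNoetherian.noetherian (LinearMap.range g))
  have hs' : ∀ i, ∃ v, g v = s i := fun i => by
    have : s i ∈ LinearMap.range g := hs ▸ Submodule.subset_span ⟨i, rfl⟩
    exact this
  choose v hv using hs'
  let f : (Fin k → R) →ₗ[R] X := Fintype.linearCombination R v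
  have hf : Function.Surjective f := by
    have := precomplete_pi (IsLocalRing.maximalIdeal R) k
    refine surjective_of_mkQ_comp_surjective (I := IsLocalRing.maximalIdeal R) ?_
    intro y
    obtain ⟨z, rfl⟩ := Submodule.mkQ_surjective _ y
    have : g z ∈ Submodule.span R (Set.range s) := hs ▸ ⟨z, rfl⟩
    obtain ⟨c, hc⟩ := (Submodule.mem_span_range_iff_exists_fun R).mp this
    refine ⟨c, ?_⟩
    have h1 : g (z - f c) = 0 := by
      rw [map_sub, ← hc]
      simp [f, Fintype.linearCombination_apply, hv]
    obtain ⟨w, hw⟩ := hg _ h1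
    symm
    change Submodule.Quotient.mk z = Submodule.Quotient.mk (f c)
    rw [Submodule.Quotient.eq, hw]
    exact Submodule.smul_mem_smul hx trivial
  exact Module.Finite.of_surjective f hf

theorem dual_finite [IsNoetherianRing R] [IsAdicComplete (IsLocalRing.maximalIdeal R) R]
    (a : Ideal R) (ha : a ≤ IsLocalRing.maximalIdeal R) (i : ℕ) : ∀ (N : Type u) [AddCommGroup N] [Module R N]
    [Module.Finite R N], (a = IsLocalRing.maximalIdeal R ∨ DL R (i + 1) N) →
      Module.Finite R (T a i N →ₗ[R] h.E) := by
  have tors : ∀ i, ∀ (N : Type u) [AddCommGroup N] [Module R N]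
    [Module.Finite R N], (a = IsLocalRing.maximalIdeal R ∨ DL R (i + 1) N) →
      IsATors (IsLocalRing.maximalIdeal R) (T a i N) := by
    rintro i N _ _ _ (rfl | h)
    · exact isATors_T i
    · exact T_mtors a N i h
  induction i with
  | zero =>
    intro N _ _ _ hN
    have : Module.Finite R (T a 0 N) := Module.Finite.of_injective (evT a N) evT_injective
    exact h.finite_tors (tors 0 N hN)
  | succ i ih =>
    intro N _ _ _
    refine devissage (R := R) (fun N _ _ _ => (a = IsLocalRing.maximalIdeal R ∨ DL R (i + 1 + 1) N) →
      Module.Finite R (T a (i + 1) N →ₗ[R] h.E)) ?_ ?_ ?_ N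
    · intro N _ _ _ _ _
      have : Subsingleton (T a (i + 1) N →ₗ[R] h.E) := ⟨fun f g => LinearMap.ext fun x => by
        rw [T_sub a _ x, map_zero, map_zero]⟩
      infer_instance
    · intro N₁ _ _ _ N₂ _ _ _ N₃ _ _ _ f g hf hfg hg h1 h3 hN
      have := h1 (hN.imp_right fun hd => hd.of_injective f hf)
      have := h3 (hN.imp_right fun hd => hd.of_surjective g hg)
      exact h.finite_mid (exact₂ hf hfg hg)
    · intro q hq _ hN
      have ht := tors _ _ hN
      by_cases haq : a ≤ q
      · have : Subsingleton (T a (i + 1) (R ⧸ q) →ₗ[R] h.E) := ⟨fun f g => LinearMap.ext fun x => by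
          rw [T_tors_zero a i _ (isATors_quot haq) x, map_zero, map_zero]⟩
        infer_instance
      obtain ⟨x, hxa, hxq⟩ := SetLike.not_le_iff_exists.mp haq
      have := ih (QuotSMulTop x (R ⧸ q)) (hN.imp_right fun hd => hd.quot hxq)
      have := hausdorff_dual (h := h) ht
      let δ := dT a i (lsmul_inj hxq) (qx_exact x) (qx_surj x)
      refine finite_of_quot (x := x) (ha hxa) (LinearMap.lcomp R h.E δ) ?_
      intro φ hφ
      obtain ⟨ψ, hψ⟩ := h.factor (exact₁ (lsmul_inj hxq) (qx_exact x) (qx_surj x)) φ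
        (fun z => LinearMap.congr_fun hφ z)
      refine ⟨ψ, LinearMap.ext fun y => ?_⟩
      rw [← hψ, mapT_lsmul, map_smul, LinearMap.smul_apply]

/-- killing -/
theorem lhvt_kill [IsNoetherianRing R] [IsAdicComplete (IsLocalRing.maximalIdeal R) R]
    (a P : Ideal R) [hP : P.IsPrime] (haP : a ≤ P) (hPm : P ≠ IsLocalRing.maximalIdeal R) (n : ℕ) :
    ∀ (N : Type u) [AddCommGroup N] [Module R N] [Module.Finite R N], DL R (n + 1) N →
      ∃ s ∉ P, ∀ z : T a n N, s • z = 0 := by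
  obtain ⟨h⟩ := exists_Hull R
  have ham : a ≤ IsLocalRing.maximalIdeal R := haP.trans (IsLocalRing.le_maximalIdeal hP.ne_top)
  induction n with
  | zero => ?_
  | succ n ih => ?_
  all_goals
    intro N _ _ _
    refine devissage (R := R) (fun N _ _ _ => DL R (_ + 1) N → ∃ s ∉ P, ∀ z : T a _ N, s • z = 0)
      ?_ ?_ ?_ N
    · intro N _ _ _ _ _
      exact ⟨1, (Ideal.ne_top_iff_one P).mp hP.ne_top, fun z => by rw [T_sub a _ z, smul_zero]⟩
    · intro N₁ _ _ _ N₂ _ _ _ N₃ _ _ _ f g hf hfg hg h1 h3 hN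
      obtain ⟨s, hs, hs'⟩ := h1 (hN.of_injective f hf)
      obtain ⟨t, ht, ht'⟩ := h3 (hN.of_surjective g hg)
      refine ⟨s * t, fun hst => (hP.mem_or_mem hst).elim hs ht, fun z => ?_⟩
      obtain ⟨w, hw⟩ := (exact₂ hf hfg hg (t • z)).mp (by rw [map_smul, ht'])
      rw [mul_smul, ← hw, ← map_smul, hs', map_zero]
    · intro q hq _ hN
      by_cases hqP : q ≤ P
      swap
      · obtain ⟨s, hs, hsP⟩ := SetLike.not_le_iff_exists.mp hqP
        refine ⟨s, hsP, fun z => ?_⟩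
        rw [← mapT_lsmul, show LinearMap.lsmul R (R ⧸ q) s = 0 from ?_, mapT_zero]
        refine LinearMap.ext fun y => ?_
        obtain ⟨r, rfl⟩ := Ideal.Quotient.mk_surjective y
        exact Ideal.Quotient.eq_zero_iff_mem.mpr (q.mul_mem_right r hs)
      first
      | exact absurd (le_antisymm (IsLocalRing.le_maximalIdeal hP.ne_top)
          ((eq_max_of_DL_one hN) ▸ hqP)) hPm
      | by_cases haq : a ≤ q
        · exact ⟨1, (Ideal.ne_top_iff_one P).mp hP.ne_top, fun z => by
            rw [T_tors_zero a n _ (isATors_quot haq) z, smul_zero]⟩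
        obtain ⟨x, hxa, hxq⟩ := SetLike.not_le_iff_exists.mp haq
        obtain ⟨s, hs, hs'⟩ := ih (QuotSMulTop x (R ⧸ q)) (hN.quot hxq)
        have hfin := dual_finite h a ham (n + 1) (R ⧸ q) (Or.inr hN)
        let F : Module.End R (T a (n + 1) (R ⧸ q) →ₗ[R] h.E) := algebraMap R _ s
        have hF : LinearMap.range F ≤ Ideal.span {x} • ⊤ := by
          rintro _ ⟨φ, rfl⟩
          obtain ⟨ψ, hψ⟩ := h.factor (exact₁ (lsmul_inj hxq) (qx_exact x) (qx_surj x)) (s • φ)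
            (fun z => by rw [LinearMap.smul_apply, ← map_smul, ← map_smul, hs', map_zero, map_zero])
          have : F φ = x • ψ := by
            refine LinearMap.ext fun y => ?_
            change (s • φ) y = _
            rw [← hψ, mapT_lsmul, map_smul, LinearMap.smul_apply]
          rw [this]
          exact Submodule.smul_mem_smul (Ideal.mem_span_singleton_self x) trivial
        obtain ⟨p, hp, -, hpc, hp0⟩ :=
          LinearMap.exists_monic_and_natDegree_eq_and_coeff_mem_pow_and_aeval_eq_zero R F _ hF
        have hev : p.eval s ∉ P := by
          intro hmem
          refine hs (hP.mem_of_pow_mem p.natDegree ?_)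
          rw [hp.as_sum] at hmem
          simp only [Polynomial.eval_add, Polynomial.eval_pow, Polynomial.eval_X,
            Polynomial.eval_finsetSum, Polynomial.eval_mul, Polynomial.eval_C] at hmem
          refine (Ideal.add_mem_iff_left _ (Ideal.sum_mem _ fun k hk => ?_)).mp hmem
          refine Ideal.mul_mem_right _ _ ?_
          have h1 := Ideal.pow_le_self (by have := Finset.mem_range.mp hk; omega) (hpc k)
          exact (Ideal.span_le.mpr (by simpa using haP hxa)) h1
        refine ⟨p.eval s, hev, fun z => ?_⟩
        by_contra hz
        obtain ⟨φ, hφ⟩ := h.cogen _ hz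
        apply hφ
        have h2 : Polynomial.aeval F p = algebraMap R _ (p.eval s) := by
          rw [Polynomial.aeval_algebraMap_apply, Polynomial.coe_aeval_eq_eval]
        rw [h2] at hp0
        rw [map_smul]
        exact LinearMap.congr_fun (LinearMap.congr_fun hp0 φ) z

/-- top cohomology: elements outside `q` act surjectively -/
lemma surj_smul [IsNoetherianRing R] (a : Ideal R) {n : ℕ} {q : Ideal R} [q.IsPrime]
    (hN : DL R (n + 1) (R ⧸ q)) {s : R} (hs : s ∉ q) (z : T a n (R ⧸ q)) :
    ∃ w : T a n (R ⧸ q), s • w = z := by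
  obtain ⟨w, hw⟩ := (exact₂ (a := a) (i := n) (lsmul_inj hs) (qx_exact s) (qx_surj s) z).mp
    (T_vanish a _ n (hN.quot hs) _)
  exact ⟨w, by rw [← mapT_lsmul, hw]⟩

theorem lhvt [IsNoetherianRing R] [IsAdicComplete (IsLocalRing.maximalIdeal R) R]
    (a : Ideal R) (n : ℕ) (N : Type u) [AddCommGroup N] [Module R N] [Module.Finite R N] :
    DL R (n + 1) N → (∀ q ∈ Module.support R N, ¬ DL R n (R ⧸ q.asIdeal) →
      ∃ P : Ideal R, P.IsPrime ∧ P ≠ IsLocalRing.maximalIdeal R ∧ a ≤ P ∧ q.asIdeal ≤ P) →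
    ∀ z : T a n N, z = 0 := by
  refine devissage (R := R) (fun N _ _ _ => DL R (n + 1) N →
    (∀ q ∈ Module.support R N, ¬ DL R n (R ⧸ q.asIdeal) →
      ∃ P : Ideal R, P.IsPrime ∧ P ≠ IsLocalRing.maximalIdeal R ∧ a ≤ P ∧ q.asIdeal ≤ P) →
    ∀ z : T a n N, z = 0) ?_ ?_ ?_ N
  · intro N _ _ _ _ _ _ z
    exact T_sub a _ z
  · intro N₁ _ _ _ N₂ _ _ _ N₃ _ _ _ f g hf hfg hg h1 h3 hN hq z
    have h1' := h1 (hN.of_injective f hf)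
      (fun q hq' => hq q (Module.support_subset_of_injective f hf hq'))
    have h3' := h3 (hN.of_surjective g hg)
      (fun q hq' => hq q (Module.support_subset_of_surjective g hg hq'))
    obtain ⟨w, rfl⟩ := (exact₂ hf hfg hg z).mp (h3' _)
    rw [h1' w, map_zero]
  · intro q hq _ hN hP z
    by_cases hd : DL R n (R ⧸ q)
    · exact T_vanish a _ n hd z
    obtain ⟨P, hPp, hPm, haP, hqP⟩ := hP ⟨q, hq⟩ (mem_support_quot.mpr le_rfl) hd
    obtain ⟨s, hs, hs'⟩ := lhvt_kill a P haP hPm n (R ⧸ q) hN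
    obtain ⟨w, rfl⟩ := surj_smul a hN (fun h => hs (hqP h)) z
    exact hs' w

end dual
end LCX
end

noncomputable section
open CategoryTheory
namespace LCX
variable {R : Type u} [CommRing R]

open Pointwise in
lemma exists_toquot {q p : Ideal R} (hqp : q ≤ p) {x : R} (hx : x ∈ p) :
    ∃ f : QuotSMulTop x (R ⧸ q) →ₗ[R] (R ⧸ p), Function.Surjective f := by
  let g : (R ⧸ q) →ₗ[R] (R ⧸ p) := Submodule.mapQ q p LinearMap.id hqp
  have hg : Function.Surjective g := by
    intro y
    obtain ⟨r, rfl⟩ := Ideal.Quotient.mk_surjective y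
    exact ⟨Ideal.Quotient.mk q r, rfl⟩
  refine ⟨Submodule.liftQ _ g ?_, ?_⟩
  · intro y hy
    obtain ⟨b, -, rfl⟩ := (Submodule.mem_smul_pointwise_iff_exists _ _ _).mp hy
    rw [LinearMap.mem_ker, map_smul]
    obtain ⟨r, hr⟩ := Ideal.Quotient.mk_surjective (g b)
    rw [← hr, Algebra.smul_def]
    exact Ideal.Quotient.eq_zero_iff_mem.mpr (p.mul_mem_right r hx)
  · intro y
    obtain ⟨z, rfl⟩ := hg y
    exact ⟨Submodule.Quotient.mk z, rfl⟩

lemma eq_of_DL {n : ℕ} {q p : Ideal R} [q.IsPrime] (hqp : q ≤ p) (h : DL R (n + 1) (R ⧸ q))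
    (h' : ¬ DL R n (R ⧸ p)) : q = p := by
  by_contra hne
  obtain ⟨x, hxp, hxq⟩ := SetLike.exists_of_lt (lt_of_le_of_ne hqp hne)
  obtain ⟨f, hf⟩ := exists_toquot hqp hxp
  exact h' ((h.quot hxq).of_surjective f hf)

lemma DL_quot_of_mem {n : ℕ} {N : Type u} [AddCommGroup N] [Module R N] [Module.Finite R N]
    (h : DL R n N)
    {p : PrimeSpectrum R} (hp : p ∈ Module.support R N) : DL R n (R ⧸ p.asIdeal) := by
  refine lt_of_le_of_lt ?_ h
  refine Order.krullDim_le_of_strictMono (fun q => ⟨q.1, ?_⟩) (fun _ _ h => h)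
  have := mem_support_quot.mp q.2
  exact Module.mem_support_mono this hp

theorem notkill [IsLocalRing R] [IsNoetherianRing R] (a : Ideal R) (n : ℕ) (p : PrimeSpectrum R)
    (hp : ¬ DL R n (R ⧸ p.asIdeal)) (hT : ∃ z : T a n (R ⧸ p.asIdeal), z ≠ 0)
    (N : Type u) [AddCommGroup N] [Module R N] [Module.Finite R N] :
    DL R (n + 1) N → p ∈ Module.support R N → ∀ s ∉ p.asIdeal, ∃ z : T a n N, s • z ≠ 0 := by
  refine devissage (R := R) (fun N _ _ _ => DL R (n + 1) N → p ∈ Module.support R N →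
    ∀ s ∉ p.asIdeal, ∃ z : T a n N, s • z ≠ 0) ?_ ?_ ?_ N
  · intro N _ _ _ _ _ hpN
    rw [Module.support_eq_empty] at hpN
    exact hpN.elim
  · intro N₁ _ _ _ N₂ _ _ _ N₃ _ _ _ f g hf hfg hg h1 h3 hN hpN s hs
    by_cases hp3 : p ∈ Module.support R N₃
    · obtain ⟨z, hz⟩ := h3 (hN.of_surjective g hg) hp3 s hs
      obtain ⟨w, rfl⟩ : ∃ w, mapT a n g w = z :=
        (exact₃ hf hfg hg z).mp (T_vanish a _ _ (hN.of_injective f hf) _)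
      refine ⟨w, fun h => hz ?_⟩
      rw [← map_smul, h, map_zero]
    · have hp1 : p ∈ Module.support R N₁ := by
        rw [Module.support_of_exact hfg hf hg] at hpN
        exact hpN.resolve_right hp3
      rw [Module.mem_support_iff_of_finite, SetLike.not_le_iff_exists] at hp3
      obtain ⟨t, ht, htp⟩ := hp3
      have ht' : ∀ j, ∀ z : T a j N₃, t • z = 0 := by
        intro j z
        rw [← mapT_lsmul, show LinearMap.lsmul R N₃ t = 0 from
          LinearMap.ext fun y => Module.mem_annihilator.mp ht y, mapT_zero]
      obtain ⟨z, hz⟩ := h1 (hN.of_injective f hf) hp1 (t * s)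
        (fun h => (p.isPrime.mem_or_mem h).elim htp hs)
      refine ⟨mapT a n f z, fun h => hz ?_⟩
      rw [← map_smul] at h
      rw [mul_smul]
      cases n with
      | zero => rw [inj₀ hf (h.trans (map_zero _).symm), smul_zero]
      | succ n =>
        obtain ⟨w, hw⟩ := (exact₁ hf hfg hg _).mp h
        rw [← hw, ← map_smul, ht', map_zero]
  · intro q hq _ hN hpq s hs
    have := eq_of_DL (mem_support_quot.mp hpq) hN hp
    subst this
    obtain ⟨z, hz⟩ := hT
    obtain ⟨w, rfl⟩ := surj_smul a hN hs z
    exact ⟨w, hz⟩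

/-- a prime in the support of full dimension -/
lemma exists_prime_dim {n : ℕ} {N : Type u} [AddCommGroup N] [Module R N] 
    (h : ¬ DL R n N) : ∃ p ∈ Module.support R N, ¬ DL R n (R ⧸ p.asIdeal) := by
  have h1 : (n : WithBot ℕ∞) ≤ Order.krullDim (Module.support R N) := not_lt.mp h
  rw [Order.le_krullDim_iff] at h1
  obtain ⟨l, hl⟩ := h1
  refine ⟨l.head.1, l.head.2, ?_⟩
  rw [DL, not_lt]
  change _ ≤ Order.krullDim _
  rw [Order.le_krullDim_iff]
  refine ⟨⟨l.length, fun i => ⟨(l i).1, mem_support_quot.mpr ?_⟩, fun i => l.step i⟩, hl⟩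
  exact l.head_le i

lemma DL_one_max [IsLocalRing R] : DL R 1 (R ⧸ IsLocalRing.maximalIdeal R) := by
  rw [show (1 : ℕ) = 0 + 1 from rfl, DL_succ]
  have : Subsingleton (Module.support R (R ⧸ IsLocalRing.maximalIdeal R)) := by
    constructor
    rintro ⟨p, hp⟩ ⟨q, hq⟩
    have h1 := mem_support_quot.mp hp
    have h2 := mem_support_quot.mp hq
    refine Subtype.ext (PrimeSpectrum.ext ?_)
    change p.asIdeal = q.asIdeal
    rw [← (IsLocalRing.maximalIdeal.isMaximal R).eq_of_le p.isPrime.ne_top h1,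
      ← (IsLocalRing.maximalIdeal.isMaximal R).eq_of_le q.isPrime.ne_top h2]
  exact Order.krullDim_nonpos_of_subsingleton

lemma dim_arith {d d' : WithBot ℕ∞} {n : ℕ} (h1 : d ≤ d' + 1) (h2 : d' < n) : d < (n + 1 : ℕ) := by
  refine lt_of_le_of_lt h1 ?_
  cases d' with
  | bot => exact WithBot.bot_lt_coe _
  | coe d' =>
    cases d' with
    | top => exact absurd (WithBot.coe_lt_coe.mp h2 : (⊤ : ℕ∞) < (n : ℕ∞)) not_top_lt
    | coe k =>
      have : k < n := by exact_mod_cast h2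
      exact_mod_cast Nat.succ_lt_succ this

lemma mem_ass [IsNoetherianRing R] {N : Type u} [AddCommGroup N] [Module R N] {p : Ideal R} :
    p ∈ associatedPrimes R N ↔ p.IsPrime ∧ ∃ x : N, ∀ r : R, r ∈ p ↔ r • x = 0 := by
  rw [AssociatedPrimes.mem_iff, isAssociatedPrime_iff]
  refine and_congr_right fun _ => exists_congr fun x => ?_
  rw [SetLike.ext_iff]
  refine forall_congr' fun r => ?_
  rw [Submodule.mem_colon_singleton, Submodule.mem_bot]

section
variable [IsLocalRing R] [IsNoetherianRing R] [IsAdicComplete (IsLocalRing.maximalIdeal R) R]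

theorem nonvanish (n : ℕ) : ∀ (q : Ideal R) [q.IsPrime], DL R (n + 1) (R ⧸ q) →
    ¬ DL R n (R ⧸ q) → ∃ z : T (IsLocalRing.maximalIdeal R) n (R ⧸ q), z ≠ 0 := by
  obtain ⟨h⟩ := exists_Hull R
  induction n with
  | zero =>
    intro q _ hN _
    have hq := eq_max_of_DL_one hN
    obtain ⟨z, hz⟩ := (evT_bijective (isATors_quot hq.ge)).2 (1 : R ⧸ q)
    refine ⟨z, fun h => ?_⟩
    rw [h, map_zero] at hz
    have : Nontrivial (R ⧸ q) := Ideal.Quotient.nontrivial_iff.mpr (Ideal.IsPrime.ne_top ‹_›)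
    exact zero_ne_one hz
  | succ n ih =>
    intro q hq hN hN'
    by_contra! hz0
    have hqm : q ≠ IsLocalRing.maximalIdeal R := by
      intro h
      exact hN' ((h ▸ DL_one_max : DL R 1 (R ⧸ q)).mono (by omega))
    have key : ∀ x ∈ IsLocalRing.maximalIdeal R, x ∉ q → ∃ P : Ideal R, x ∈ P ∧
        ¬ DL R n (R ⧸ P) ∧ P ∈ associatedPrimes R
          (T (IsLocalRing.maximalIdeal R) n (R ⧸ q) →ₗ[R] h.E) := by
      intro x hx hxq
      have hd := hN.quot hxq
      have hd' : ¬ DL R n (QuotSMulTop x (R ⧸ q)) := by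
        intro hh
        apply hN'
        have h1 := Module.supportDim_le_supportDim_quotSMulTop_succ (M := R ⧸ q) hx
        exact dim_arith h1 hh
      obtain ⟨P, hP, hPd⟩ := exists_prime_dim hd'
      have hPd' := DL_quot_of_mem hd hP
      have hqP := support_quotx hxq hP
      have hxP : x ∈ P.asIdeal := by
        have hP2 := hP
        rw [Module.support_quotSMulTop] at hP2
        simpa using hP2.2
      obtain ⟨z, hz⟩ := ih P.asIdeal hPd' hPd
      obtain ⟨f, hf⟩ := exists_toquot hqP.le hxP
      have s1 : Function.Surjective (mapT (IsLocalRing.maximalIdeal R) n (qx x (R ⧸ q))) := fun y =>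
        (exact₃ (lsmul_inj hxq) (qx_exact x) (qx_surj x) y).mp (hz0 _)
      have s2 : Function.Surjective (mapT (IsLocalRing.maximalIdeal R) n f) := fun y =>
        (exact₃ (LinearMap.ker f).injective_subtype (LinearMap.exact_subtype_ker_map f) hf y).mp
          (T_vanish _ _ _ (hd.of_injective _ (LinearMap.ker f).injective_subtype) _)
      let π := (mapT (IsLocalRing.maximalIdeal R) n f) ∘ₗ
        (mapT (IsLocalRing.maximalIdeal R) n (qx x (R ⧸ q)))
      have hπ : Function.Surjective π := s2.comp s1
      obtain ⟨φ, hφ⟩ := h.cogen z hz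
      refine ⟨P.asIdeal, hxP, hPd, mem_ass.mpr ⟨P.isPrime, φ ∘ₗ π, fun r => ⟨fun hr => ?_, fun hr => ?_⟩⟩⟩
      · refine LinearMap.ext fun y => ?_
        change r • φ (π y) = 0
        rw [← map_smul, ← mapT_lsmul, show LinearMap.lsmul R (R ⧸ P.asIdeal) r = 0 from ?_,
          mapT_zero, map_zero]
        refine LinearMap.ext fun y => ?_
        obtain ⟨t, rfl⟩ := Ideal.Quotient.mk_surjective y
        exact Ideal.Quotient.eq_zero_iff_mem.mpr (P.asIdeal.mul_mem_right t hr)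
      · by_contra hrP
        apply hφ
        obtain ⟨w, rfl⟩ := surj_smul _ hPd' hrP z
        obtain ⟨y, rfl⟩ := hπ w
        rw [map_smul]
        exact LinearMap.congr_fun hr y
    have hfin := dual_finite h (IsLocalRing.maximalIdeal R) le_rfl n (R ⧸ q) (Or.inl rfl)
    let s : Set (Ideal R) := {q} ∪ {P | P ∈ associatedPrimes R
          (T (IsLocalRing.maximalIdeal R) n (R ⧸ q) →ₗ[R] h.E) ∧ ¬ DL R n (R ⧸ P)}
    have hs : s.Finite := (Set.finite_singleton q).union
      ((associatedPrimes.finite R _).subset fun P hP => hP.1)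
    have hqle : q ≤ IsLocalRing.maximalIdeal R := IsLocalRing.le_maximalIdeal hq.ne_top
    obtain ⟨P, hPs, hmP⟩ := (Ideal.subset_union_prime_finite hs (f := id) q q
      (I := IsLocalRing.maximalIdeal R) (by
        rintro P (rfl | hP) h1 _
        · exact absurd rfl h1
        · exact hP.1.isPrime)).mp (by
        intro x hx
        by_cases hxq : x ∈ q
        · exact Set.mem_biUnion (Or.inl rfl : q ∈ s) hxq
        · obtain ⟨P, hxP, h1, h2⟩ := key x hx hxq
          exact Set.mem_biUnion (Or.inr ⟨h2, h1⟩ : P ∈ s) hxP)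
    obtain (rfl | ⟨hPa, hPd⟩) := hPs
    · exact hqm (le_antisymm hqle hmP)
    have hP := (mem_ass.mp hPa).1
    have hPm : P = IsLocalRing.maximalIdeal R :=
      le_antisymm (IsLocalRing.le_maximalIdeal hP.ne_top) hmP
    subst hPm
    have hn : n = 0 := by
      by_contra hn
      exact hPd (DL_one_max.mono (by omega))
    subst hn
    obtain ⟨-, φ, hφ⟩ := mem_ass.mp hPa
    refine hP.ne_top ((Ideal.eq_top_iff_one _).mpr ((hφ 1).mpr ?_))
    refine LinearMap.ext fun z => ?_
    obtain ⟨x, hx, hxq⟩ := SetLike.exists_of_lt (lt_of_le_of_ne hqle hqm)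
    obtain ⟨t, ht⟩ := torsionT_pow hx z
    have hz : z = 0 := by
      refine evT_injective ?_
      rw [map_zero]
      refine lsmul_inj (fun h => hxq (hq.mem_of_pow_mem t h)) (?_ : _ = LinearMap.lsmul R (R ⧸ q) (x ^ t) 0)
      rw [map_zero, LinearMap.lsmul_apply, ← map_smul, ht, map_zero]
    rw [hz, map_zero, map_zero]
end
end LCX
end

noncomputable section
open CategoryTheory
namespace LCX
variable {R : Type u} [CommRing R]

section
variable [IsNoetherianRing R] [IsLocalRing R]
variable {N N' : Type u} [AddCommGroup N] [Module R N] [Module.Finite R N]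
  [AddCommGroup N'] [Module R N'] 

omit [IsLocalRing R] in
lemma surjT (a : Ideal R) {n : ℕ} (hN : DL R (n + 1) N) (g : N →ₗ[R] N')
    (hg : Function.Surjective g) : Function.Surjective (mapT a n g) := fun y =>
  (exact₃ (LinearMap.ker g).injective_subtype (LinearMap.exact_subtype_ker_map g) hg y).mp
    (T_vanish _ _ _ (hN.of_injective _ (LinearMap.ker g).injective_subtype) _)

omit [IsLocalRing R] in
lemma ann_T (a : Ideal R) (n : ℕ) {r : R} (hr : ∀ x : N, r • x = 0) (z : T a n N) : r • z = 0 := by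
  rw [← mapT_lsmul, show LinearMap.lsmul R N r = 0 from LinearMap.ext hr, mapT_zero]

omit [IsNoetherianRing R] [IsLocalRing R] [Module.Finite R N] in
lemma DL.of_support {n : ℕ} (h : Module.support R N' ⊆ Module.support R N) (hN : DL R n N) :
    DL R n N' := by
  refine lt_of_le_of_lt ?_ hN
  exact Order.krullDim_le_of_strictMono (fun q => ⟨q.1, h q.2⟩) (fun _ _ h => h)

/-- `ker (T(N) → T(N/IN)) ≤ I T(N)`. -/
lemma ker_T_quot (a : Ideal R) {n : ℕ} (hN : DL R (n + 1) N) (I : Ideal R)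
    (z : T a n N) (hz : mapT a n (I • (⊤ : Submodule R N)).mkQ z = 0) :
    z ∈ I • (⊤ : Submodule R (T a n N)) := by
  obtain ⟨k, s, hs⟩ := Submodule.fg_iff_exists_fin_generating_family.mp (IsNoetherian.noetherian I)
  let f : (Fin k → N) →ₗ[R] N := ∑ i, s i • LinearMap.proj i
  have hf : ∀ v, f v ∈ (I • (⊤ : Submodule R N)) := by
    intro v
    simp only [f, LinearMap.sum_apply, LinearMap.smul_apply]
    refine Submodule.sum_mem _ fun i _ => Submodule.smul_mem_smul ?_ trivial
    rw [← hs]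
    exact Submodule.subset_span ⟨i, rfl⟩
  let f' : (Fin k → N) →ₗ[R] (I • (⊤ : Submodule R N) : Submodule R N) := f.codRestrict _ hf
  have hf' : Function.Surjective f' := by
    rintro ⟨y, hy⟩
    suffices h : y ∈ LinearMap.range f by
      obtain ⟨v, hv⟩ := h
      exact ⟨v, Subtype.ext hv⟩
    rw [← hs] at hy
    revert hy
    refine fun hy => Submodule.smul_le.mpr ?_ hy
    intro r hr x _
    obtain ⟨c, rfl⟩ := (Submodule.mem_span_range_iff_exists_fun R).mp hr
    refine ⟨fun i => c i • x, ?_⟩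
    simp only [f, LinearMap.sum_apply, LinearMap.smul_apply, LinearMap.proj_apply,
      Finset.sum_smul, smul_eq_mul, mul_smul]
    exact Finset.sum_congr rfl fun i _ => smul_comm _ _ _
  have hpi : DL R (n + 1) (Fin k → N) := by
    refine DL.of_support (fun p hp => ?_) hN
    rw [Module.mem_support_iff_of_finite] at hp ⊢
    refine le_trans (fun r hr => ?_) hp
    rw [Module.mem_annihilator] at hr ⊢
    exact fun v => funext fun i => hr (v i)
  obtain ⟨y, rfl⟩ := (exact₂ (Submodule.injective_subtype _) (LinearMap.exact_subtype_mkQ _)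
    (Submodule.mkQ_surjective _) z).mp hz
  obtain ⟨w, rfl⟩ := surjT a hpi f' hf' y
  rw [mapT_comp, show (Submodule.subtype _) ∘ₗ f' = f from rfl]
  have : mapT a n f w = ∑ i, s i • mapT a n (LinearMap.proj i : (Fin k → N) →ₗ[R] N) w := by
    have : mapT a n f = ∑ i, s i • mapT a n (LinearMap.proj i : (Fin k → N) →ₗ[R] N) := by
      let F : ((Fin k → N) →ₗ[R] N) →ₗ[R] (T a n (Fin k → N) →ₗ[R] T a n N) :=
        { toFun := fun f => mapT a n f
          map_add' := fun f g => LinearMap.ext (mapT_add f g)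
          map_smul' := fun r f => LinearMap.ext (mapT_smul r f) }
      change F f = ∑ i, s i • F _
      rw [map_sum]
      simp only [map_smul]
    rw [this, LinearMap.sum_apply]
    rfl
  rw [this]
  refine Submodule.sum_mem _ fun i _ => Submodule.smul_mem_smul ?_ trivial
  rw [← hs]
  exact Submodule.subset_span ⟨i, rfl⟩

omit [IsLocalRing R] in
lemma mem_supp_smul_top {I : Ideal R} {p : PrimeSpectrum R}
    (hp : p ∈ Module.support R (N ⧸ (I • ⊤ : Submodule R N))) :
    I ≤ p.asIdeal := by
  rw [Module.mem_support_iff_of_finite] at hp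
  refine le_trans (fun r hr => ?_) hp
  rw [Module.mem_annihilator]
  intro y
  obtain ⟨x, rfl⟩ := Submodule.mkQ_surjective _ y
  rw [← map_smul]
  exact (Submodule.Quotient.mk_eq_zero _).mpr (Submodule.smul_mem_smul hr trivial)

omit [IsLocalRing R] in
lemma mem_supp_quot_smul_top {p : PrimeSpectrum R} (hp : p ∈ Module.support R N) :
    p ∈ Module.support R (N ⧸ (p.asIdeal • ⊤ : Submodule R N)) := by
  rw [Module.support_quotient]
  exact ⟨hp, fun _ h => h⟩

omit [IsLocalRing R] in
lemma exists_ass_le {p : PrimeSpectrum R} (hp : p ∈ Module.support R N) :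
    ∃ q ∈ associatedPrimes R N, q ≤ p.asIdeal := by
  have := p.isPrime
  obtain ⟨q, hq, hqp⟩ := Ideal.exists_minimalPrimes_le (Module.mem_support_iff_of_finite.mp hp)
  exact ⟨q, Module.associatedPrimes.minimalPrimes_annihilator_subset_associatedPrimes R N hq, hqp⟩

omit [IsLocalRing R] in
lemma ass_supp {q : Ideal R} (hq : q ∈ associatedPrimes R N) :
    (⟨q, hq.isPrime⟩ : PrimeSpectrum R) ∈ Module.support R N := by
  rw [Module.mem_support_iff_of_finite]
  obtain ⟨_, x, hx⟩ := mem_ass.mp hq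
  exact fun r hr => (hx r).mpr (Module.mem_annihilator.mp hr x)

omit [IsLocalRing R] in
lemma ass_DL {q : Ideal R} (hq : q ∈ associatedPrimes R N) {n : ℕ} (hN : DL R n N) :
    DL R n (R ⧸ q) := by
  have hq1 := ass_supp hq
  have : Module.support R (R ⧸ q) ⊆ Module.support R N := by
    intro p hp
    have h2 : (⟨q, hq.isPrime⟩ : PrimeSpectrum R) ≤ p := by
      have := mem_support_quot.mp hp
      exact this
    exact Module.mem_support_mono h2 hq1
  exact DL.of_support this hN

variable [IsAdicComplete (IsLocalRing.maximalIdeal R) R]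

/-- attached primes -/
def AttT (R : Type u) [CommRing R] (X : Type u) [AddCommGroup X] [Module R X] : Set (Ideal R) :=
  { p | p.IsPrime ∧ ∃ U : Submodule R X, p = Module.annihilator R (X ⧸ U) }

lemma att_eq {n : ℕ} (hN : DL R (n + 1) N)
    (hass : ∀ q ∈ associatedPrimes R N, ¬ DL R n (R ⧸ q)) :
    associatedPrimes R N = AttT R (T (IsLocalRing.maximalIdeal R) n N) := by
  have hsup : ∀ q (hq : q ∈ associatedPrimes R N), (⟨q, hq.isPrime⟩ : PrimeSpectrum R) ∈ Module.support R N := by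
    exact fun q hq => ass_supp hq
  ext q
  constructor
  · intro hq
    have hd := hass q hq
    have hqp := hq.isPrime
    have hqs := hsup q hq
    have hqs2 : (⟨q, hqp⟩ : PrimeSpectrum R) ∈ Module.support R (N ⧸ (q • ⊤ : Submodule R N)) := by
      exact mem_supp_quot_smul_top (p := ⟨q, hqp⟩) hqs
    have hnv := nonvanish n q (ass_DL hq hN) hd
    have hN' : DL R (n + 1) (N ⧸ (q • ⊤ : Submodule R N)) :=
      hN.of_surjective (Submodule.mkQ (q • ⊤ : Submodule R N)) (Submodule.mkQ_surjective _)
    have hk := notkill (IsLocalRing.maximalIdeal R) n ⟨q, hqp⟩ hd hnv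
      (N ⧸ (q • ⊤ : Submodule R N)) hN' hqs2
    let g := mapT (IsLocalRing.maximalIdeal R) n (q • (⊤ : Submodule R N)).mkQ
    have hg : Function.Surjective g := surjT _ hN (q • (⊤ : Submodule R N)).mkQ (Submodule.mkQ_surjective _)
    refine ⟨hqp, LinearMap.ker g, ?_⟩
    rw [(g.quotKerEquivOfSurjective hg).annihilator_eq]
    refine le_antisymm (fun r hr => ?_) (fun r hr => ?_)
    · rw [Module.mem_annihilator]
      refine ann_T _ _ ?_
      intro y
      obtain ⟨x, rfl⟩ := Submodule.mkQ_surjective _ y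
      rw [← map_smul]
      exact (Submodule.Quotient.mk_eq_zero _).mpr (Submodule.smul_mem_smul hr trivial)
    · by_contra hrq
      obtain ⟨z, hz⟩ := hk r hrq
      exact hz (Module.mem_annihilator.mp hr z)
  · rintro ⟨hq, U, hU⟩
    have hqs : (⟨q, hq⟩ : PrimeSpectrum R) ∈ Module.support R N := by
      rw [Module.mem_support_iff_of_finite]
      intro r hr
      rw [Module.mem_annihilator] at hr
      change r ∈ q
      rw [hU, Module.mem_annihilator]
      intro y
      obtain ⟨x, rfl⟩ := Submodule.mkQ_surjective _ y
      rw [← map_smul, ann_T _ _ hr, map_zero]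
    have hd : ¬ DL R n (R ⧸ q) := by
      intro hd
      have h0 : DL R n (N ⧸ (q • ⊤ : Submodule R N)) :=
        DL.of_support (fun p hp => mem_support_quot.mpr (mem_supp_smul_top hp)) hd
      refine hq.ne_top ((Ideal.eq_top_iff_one _).mpr ?_)
      rw [hU, Module.mem_annihilator]
      intro y
      obtain ⟨x, rfl⟩ := Submodule.mkQ_surjective _ y
      rw [one_smul]
      have hx := ker_T_quot _ hN q x (T_vanish _ _ _ h0 _)
      refine (Submodule.Quotient.mk_eq_zero _).mpr ?_
      refine Submodule.smul_le.mpr ?_ hx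
      intro r hr z _
      rw [hU, Module.mem_annihilator] at hr
      exact (Submodule.Quotient.mk_eq_zero _).mp (hr (Submodule.Quotient.mk z))
    obtain ⟨p, hp, hpq⟩ := exists_ass_le hqs
    have := hp.isPrime
    have hpe : p = q := eq_of_DL hpq (ass_DL hp hN) hd
    rwa [← hpe]

theorem main_complete (a : Ideal R) (ha : a ≤ IsLocalRing.maximalIdeal R) (X : Type u)
    [AddCommGroup X] [Module R X] [Module.Finite R X] {n : ℕ} (hX : DL R (n + 1) X) :
    ∃ N : Submodule R X,
      associatedPrimes R (X ⧸ N) = AttT R (T (IsLocalRing.maximalIdeal R) n (X ⧸ N)) ∧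
      Nonempty (T a n X ≃ₗ[R] T (IsLocalRing.maximalIdeal R) n (X ⧸ N)) := by
  let W : Set (PrimeSpectrum R) := {q | q ∈ Module.support R X ∧ ¬ DL R n (R ⧸ q.asIdeal) ∧
    ∀ P : Ideal R, P.IsPrime → a ≤ P → q.asIdeal ≤ P → P = IsLocalRing.maximalIdeal R}
  let N : Submodule R X :=
    { carrier := {x | ∀ q ∈ W, ∃ s ∉ q.asIdeal, s • x = 0}
      add_mem' := by
        intro x y hx hy q hq
        obtain ⟨s, hs, hs'⟩ := hx q hq
        obtain ⟨t, ht, ht'⟩ := hy q hq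
        refine ⟨s * t, fun h => (q.isPrime.mem_or_mem h).elim hs ht, ?_⟩
        rw [smul_add, mul_smul, mul_smul, ht', smul_comm, hs', smul_zero, smul_zero, add_zero]
      zero_mem' := fun q _ => ⟨1, (Ideal.ne_top_iff_one _).mp q.isPrime.ne_top, smul_zero _⟩
      smul_mem' := by
        intro r x hx q hq
        obtain ⟨s, hs, hs'⟩ := hx q hq
        exact ⟨s, hs, by rw [smul_comm, hs', smul_zero]⟩ }
  have hmemN : ∀ x, x ∈ N ↔ ∀ q ∈ W, ∃ s ∉ q.asIdeal, s • x = 0 := fun x => Iff.rfl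
  have hK : DL R (n + 1) (X ⧸ N) := hX.of_surjective _ N.mkQ_surjective
  have hassW : ∀ P (hP : P ∈ associatedPrimes R (X ⧸ N)), ∃ q ∈ W, P = q.asIdeal := by
    intro P hP
    obtain ⟨hPp, y, hy⟩ := mem_ass.mp hP
    obtain ⟨x, rfl⟩ := N.mkQ_surjective y
    have hx : x ∉ N := by
      intro h
      refine hPp.ne_top ((Ideal.eq_top_iff_one _).mpr ((hy 1).mpr ?_))
      rw [one_smul]
      exact (Submodule.Quotient.mk_eq_zero _).mpr h
    rw [hmemN] at hx
    push Not at hx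
    obtain ⟨q, hq, hqx⟩ := hx
    have hPq : P ≤ q.asIdeal := by
      intro s hs
      by_contra hsq
      have h1 := (hy s).mp hs
      rw [← map_smul] at h1
      have h2 : s • x ∈ N := (Submodule.Quotient.mk_eq_zero _).mp h1
      obtain ⟨t, ht, ht'⟩ := h2 q hq
      exact hqx (t * s) (fun h => (q.isPrime.mem_or_mem h).elim ht hsq) (by rw [mul_smul, ht'])
    refine ⟨q, hq, eq_of_DL hPq (ass_DL hP hK) hq.2.1⟩
  refine ⟨N, att_eq hK ?_, ?_⟩
  · intro q hq
    obtain ⟨q', hq', rfl⟩ := hassW q hq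
    exact hq'.2.1
  have hN0 : ∀ z : T a n N, z = 0 := by
    refine lhvt a n N (hX.of_injective _ N.injective_subtype) ?_
    intro q hq hqd
    by_contra hcon
    push Not at hcon
    have hqW : q ∈ W := ⟨Module.support_subset_of_injective _ N.injective_subtype hq, hqd,
      fun P hP haP hqP => by
        by_contra hPm
        exact hcon P hP hPm haP hqP⟩
    rw [Module.mem_support_iff'] at hq
    obtain ⟨m, hm⟩ := hq
    obtain ⟨s, hs, hs'⟩ := m.2 q hqW
    exact hm s hs (Subtype.ext hs')
  have hb1 : Function.Bijective (mapT a n N.mkQ) := by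
    refine ⟨?_, surjT a hX _ N.mkQ_surjective⟩
    rw [injective_iff_map_eq_zero]
    intro z hz
    obtain ⟨w, rfl⟩ := (exact₂ N.injective_subtype (LinearMap.exact_subtype_mkQ _)
      N.mkQ_surjective z).mp hz
    rw [hN0 w, map_zero]
  have hb2 := chg_bij ha (X ⧸ N) (by
    intro q hq haq
    obtain ⟨P, hP, hPq⟩ := exists_ass_le hq
    obtain ⟨q', hq', rfl⟩ := hassW P hP
    exact (hq'.2.2 q.asIdeal q.isPrime haq hPq).ge) n
  exact ⟨(LinearEquiv.ofBijective _ hb1).trans (LinearEquiv.ofBijective _ hb2).symm⟩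

end
end LCX
end

noncomputable section
open CategoryTheory
namespace LCX
variable {R : Type u} [CommRing R]

open IsLocalRing in
theorem noeth_compl (I : Ideal R) [IsNoetherianRing R] : IsNoetherianRing (AdicCompletion I R) := by
  obtain ⟨k, s, hs⟩ := Submodule.fg_iff_exists_fin_generating_family.mp (IsNoetherian.noetherian I)
  let J := MvPolynomial.idealOfVars (Fin k) R
  let f : MvPolynomial (Fin k) R →+* R := (MvPolynomial.aeval s).toRingHom
  have hfX : ∀ i, f (MvPolynomial.X i) = s i := fun i => MvPolynomial.aeval_X s i
  have hfC : ∀ r, f (MvPolynomial.C r) = r := fun r => MvPolynomial.aeval_C s r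
  have hJ : J.map f = I := by
    rw [← hs]
    change Ideal.map f (Ideal.span _) = _
    rw [Ideal.map_span, ← Set.range_comp]
    congr 2
    ext i
    exact hfX i
  have hJn : ∀ n, J ^ n ≤ (I ^ n).comap f := by
    intro n
    rw [← Ideal.map_le_iff_le_comap, Ideal.map_pow, hJ]
  let A := AdicCompletion J (MvPolynomial (Fin k) R)
  have hA : IsNoetherianRing A :=
    isNoetherianRing_of_ringEquiv _ (MvPowerSeries.toAdicCompletionAlgEquiv (Fin k) R).toRingEquiv
  let g : (n : ℕ) → A →+* R ⧸ I ^ n := fun n =>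
    (Ideal.quotientMap (I ^ n) f (hJn n)).comp (AdicCompletion.evalₐ J n).toRingHom
  have hg : ∀ {m n : ℕ} (hle : m ≤ n), (Ideal.Quotient.factorPow I hle).comp (g n) = g m := by
    intro m n hle
    ext x
    change Ideal.Quotient.factorPow I hle (Ideal.quotientMap (I ^ n) f (hJn n) (AdicCompletion.evalₐ J n x))
      = Ideal.quotientMap (I ^ m) f (hJn m) (AdicCompletion.evalₐ J m x)
    induction x using AdicCompletion.induction_on with
    | h x =>
    rw [AdicCompletion.evalₐ_mk, AdicCompletion.evalₐ_mk]
    change Ideal.Quotient.mk (I ^ m) (f (x.val n)) = Ideal.Quotient.mk (I ^ m) (f (x.val m))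
    refine Ideal.Quotient.eq.mpr ?_
    rw [← map_sub]
    refine hJn m ?_
    have h3 := SModEq.sub_mem.mp (x.property hle).symm
    rw [smul_eq_mul, Ideal.mul_top] at h3
    exact h3
  let F : A →+* AdicCompletion I R := AdicCompletion.liftRingHom I g hg
  have hF : ∀ p, F (algebraMap _ A p) = algebraMap R _ (f p) := by
    intro p
    refine AdicCompletion.ext_evalₐ (I := I) fun n => ?_
    refine (AdicCompletion.evalₐ_liftRingHom I g hg n _).trans ?_
    rfl
  have hFm : (J.map (algebraMap _ A)).map F = I.map (algebraMap R (AdicCompletion I R)) := by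
    rw [Ideal.map_map, show F.comp (algebraMap _ A) = (algebraMap R (AdicCompletion I R)).comp f from
      RingHom.ext hF, ← Ideal.map_map, hJ]
  have fgI : I.FG := IsNoetherian.noetherian I
  have : IsAdicComplete (J.map (algebraMap _ A)) A :=
    AdicCompletion.isAdicComplete_self J (MvPolynomial.idealOfVars_fg (Fin k) R)
  have h2 : IsAdicComplete (I.map (algebraMap R (AdicCompletion I R))) (AdicCompletion I R) :=
    AdicCompletion.isAdicComplete_self I fgI
  have : IsHausdorff ((J.map (algebraMap _ A)).map F) (AdicCompletion I R) := by
    rw [hFm]; infer_instance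
  refine isNoetherianRing_of_surjective A _ F
    (surjective_of_mk_map_comp_surjective (I := J.map (algebraMap _ A)) F ?_)
  intro y
  obtain ⟨y, rfl⟩ := Ideal.Quotient.mk_surjective y
  obtain ⟨r, hr⟩ := Ideal.Quotient.mk_surjective (AdicCompletion.evalOneₐ I y)
  have h5 : F (algebraMap (MvPolynomial (Fin k) R) A (MvPolynomial.C r)) - y ∈ (J.map (algebraMap _ A)).map F := by
    rw [hF, hfC, hFm, ← AdicCompletion.ker_evalOneₐ_eq_map I fgI, RingHom.mem_ker, map_sub,
      sub_eq_zero]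
    exact hr
  exact ⟨algebraMap (MvPolynomial (Fin k) R) A (MvPolynomial.C r), Ideal.Quotient.eq.mpr h5⟩

end LCX
end

noncomputable section
open CategoryTheory
namespace LCX
variable {R : Type u} [CommRing R]

lemma DL_quot_le {I J : Ideal R} (hIJ : I ≤ J) {n : ℕ} (h : DL R n (R ⧸ I)) : DL R n (R ⧸ J) :=
  DL.of_support (fun _ hp => mem_support_quot.mpr (hIJ.trans (mem_support_quot.mp hp))) h

lemma DL_quot_prime {I : Ideal R} {p : PrimeSpectrum R} {n : ℕ} (h : DL R n (R ⧸ I))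
    (hp : I ≤ p.asIdeal) : DL R n (R ⧸ p.asIdeal) := DL_quot_le hp h

open Pointwise in
lemma mem_supp_qx {I : Ideal R} {x : R} {p : PrimeSpectrum R} :
    p ∈ Module.support R (QuotSMulTop x (R ⧸ I)) ↔ I ⊔ Ideal.span {x} ≤ p.asIdeal := by
  rw [Module.support_quotSMulTop]
  constructor
  · intro h
    exact sup_le (mem_support_quot.mp h.1) ((Ideal.span_singleton_le_iff_mem _).mpr (h.2 rfl))
  · intro h
    refine ⟨mem_support_quot.mpr (le_sup_left.trans h), ?_⟩
    rintro y rfl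
    exact (Ideal.span_singleton_le_iff_mem _).mp (le_sup_right.trans h)

theorem DL_up [IsLocalRing R] [IsNoetherianRing R] (S : Type u) [CommRing S] [IsLocalRing S]
    [IsNoetherianRing S] (φ : R →+* S)
    (hm : IsLocalRing.maximalIdeal S = (IsLocalRing.maximalIdeal R).map φ) (n : ℕ) :
    ∀ I : Ideal R, DL R n (R ⧸ I) → DL S n (S ⧸ I.map φ) := by
  induction n with
  | zero =>
    intro I hI
    by_contra hcon
    obtain ⟨Q, hQ, hQd⟩ := exists_prime_dim hcon
    have hIQ := mem_support_quot.mp hQ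
    have h0 := DL_zero.mp hI
    have hI1 : I = ⊤ := Ideal.Quotient.subsingleton_iff.mp h0
    rw [hI1, Ideal.map_top] at hIQ
    exact Q.isPrime.ne_top (top_le_iff.mp hIQ)
  | succ n ih =>
    intro I hI
    by_contra hcon
    obtain ⟨Q, hQ, hQd⟩ := exists_prime_dim hcon
    have hIQ := mem_support_quot.mp hQ
    have hQp := Q.isPrime
    let q : Ideal R := Q.asIdeal.comap φ
    have hqp : q.IsPrime := Ideal.comap_isPrime φ Q.asIdeal
    have hIq : I ≤ q := Ideal.map_le_iff_le_comap.mp hIQ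
    have hq : DL R (n + 1) (R ⧸ q) := DL_quot_le hIq hI
    have hqQ : q.map φ ≤ Q.asIdeal := Ideal.map_comap_le
    refine hQd (DL_quot_le hqQ ?_)
    by_cases hqm : IsLocalRing.maximalIdeal R ≤ q
    · refine DL_quot_le (I := IsLocalRing.maximalIdeal S) ?_ (DL_one_max.mono (by omega))
      rw [hm]
      exact Ideal.map_mono hqm
    · obtain ⟨x, hx, hxq⟩ := SetLike.not_le_iff_exists.mp hqm
      have h1 : DL R n (R ⧸ (q ⊔ Ideal.span {x})) :=
        DL.of_support (fun p hp => mem_supp_qx.mpr (mem_support_quot.mp hp)) (hq.quot hxq)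
      have h2 := ih _ h1
      have h3 : DL S n (QuotSMulTop (φ x) (S ⧸ q.map φ)) := by
        refine DL.of_support (fun p hp => mem_support_quot.mpr ?_) h2
        rw [Ideal.map_sup, Ideal.map_span, Set.image_singleton]
        exact mem_supp_qx.mp hp
      have hxS : φ x ∈ IsLocalRing.maximalIdeal S := by
        rw [hm]; exact Ideal.mem_map_of_mem _ hx
      have h4 := Module.supportDim_le_supportDim_quotSMulTop_succ (M := S ⧸ q.map φ) hxS
      exact dim_arith h4 h3

section
variable [IsLocalRing R] [IsNoetherianRing R]

instance : IsNoetherianRing (Rh R) := noeth_compl _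

theorem fin_compl (M : Type u) [AddCommGroup M] [Module R M] [Module.Finite R M] :
    Module.Finite (Rh R) (AdicCompletion (IsLocalRing.maximalIdeal R) M) :=
  Module.Finite.equiv
    (AdicCompletion.ofTensorProductEquivOfFiniteNoetherian (IsLocalRing.maximalIdeal R) M)

theorem DL_compl (M : Type u) [AddCommGroup M] [Module R M] [Module.Finite R M] (n : ℕ)
    (h : DL R n M) : DL (Rh R) n (AdicCompletion (IsLocalRing.maximalIdeal R) M) := by
  have h1 : DL R n (R ⧸ Module.annihilator R M) := by
    refine DL.of_support (fun p hp => ?_) h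
    rw [Module.mem_support_iff_of_finite]
    exact mem_support_quot.mp hp
  have h2 := DL_up (Rh R) (algebraMap R (Rh R)) AdicCompletion.maximalIdeal_eq_map n _ h1
  refine DL.of_support (fun p hp => mem_support_quot.mpr ?_) h2
  have := fin_compl (R := R) M
  refine le_trans ?_ (Module.mem_support_iff_of_finite.mp hp)
  rw [Ideal.map_le_iff_le_comap]
  intro r hr
  rw [Ideal.mem_comap, Module.mem_annihilator]
  intro y
  rw [algebraMap_smul]
  refine AdicCompletion.ext fun k => ?_
  rw [AdicCompletion.val_smul_apply, AdicCompletion.val_zero_apply]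
  generalize y.val k = z
  obtain ⟨z, rfl⟩ := Submodule.mkQ_surjective _ z
  rw [← map_smul, Module.mem_annihilator.mp hr z, map_zero]

end

lemma AttT_congr {X Y : Type u} [AddCommGroup X] [Module R X] [AddCommGroup Y] [Module R Y]
    (e : X ≃ₗ[R] Y) : AttT R X = AttT R Y := by
  have key : ∀ {X Y : Type u} [AddCommGroup X] [Module R X] [AddCommGroup Y] [Module R Y]
      (e : X ≃ₗ[R] Y), AttT R X ⊆ AttT R Y := by
    rintro X Y _ _ _ _ e p ⟨hp, U, hU⟩
    refine ⟨hp, U.map (e : X →ₗ[R] Y), ?_⟩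
    rw [hU]
    exact (Submodule.Quotient.equiv U (U.map (e : X →ₗ[R] Y)) e rfl).annihilator_eq
  exact (key e).antisymm (key e.symm)

theorem final [IsNoetherianRing R] [IsLocalRing R]
    (a : Ideal R) (ha : a ≠ ⊤) (M : Type u) [AddCommGroup M] [Module R M]
    [Module.Finite R M] (n : ℕ) (hdim : Module.supportDim R M = (n : ℕ∞)) :
    ∃ N : Submodule (Rh R) (AdicCompletion (IsLocalRing.maximalIdeal R) M),
      Module.Finite (Rh R) (AdicCompletion (IsLocalRing.maximalIdeal R) M ⧸ N) ∧
      associatedPrimes (Rh R) (AdicCompletion (IsLocalRing.maximalIdeal R) M ⧸ N) =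
        AttT (Rh R) ((localCohomology (a.map (algebraMap R (Rh R))) n).obj
          (ModuleCat.of (Rh R) (AdicCompletion (IsLocalRing.maximalIdeal R) M))) ∧
      Nonempty (((localCohomology a n).obj (ModuleCat.of R M) : Type u) ≃+
        ((localCohomology (a.map (algebraMap R (Rh R))) n).obj
          (ModuleCat.of (Rh R) (AdicCompletion (IsLocalRing.maximalIdeal R) M)) : Type u)) ∧
      Nonempty (((localCohomology (a.map (algebraMap R (Rh R))) n).obj
          (ModuleCat.of (Rh R) (AdicCompletion (IsLocalRing.maximalIdeal R) M))) ≃ₗ[Rh R]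
        ((localCohomology ((IsLocalRing.maximalIdeal R).map (algebraMap R (Rh R))) n).obj
          (ModuleCat.of (Rh R) (AdicCompletion (IsLocalRing.maximalIdeal R) M ⧸ N)))) := by
  have hM : DL R (n + 1) M := DL_succ.mpr hdim.le
  have hMh := DL_compl M (n + 1) hM
  have hfin := fin_compl (R := R) M
  have haS : a.map (algebraMap R (Rh R)) ≤ IsLocalRing.maximalIdeal (Rh R) := by
    rw [AdicCompletion.maximalIdeal_eq_map]
    exact Ideal.map_mono (IsLocalRing.le_maximalIdeal ha)
  obtain ⟨N, hN1, ⟨e⟩⟩ := main_complete (R := Rh R) (a.map (algebraMap R (Rh R))) haS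
    (AdicCompletion (IsLocalRing.maximalIdeal R) M) hMh
  obtain ⟨b⟩ := base_change a M n hM
  let e1 := lcEquiv (a.map (algebraMap R (Rh R))) n (AdicCompletion (IsLocalRing.maximalIdeal R) M)
  refine ⟨N, inferInstance, ?_, ⟨?_⟩, ?_⟩
  · rw [hN1]
    exact (AttT_congr (e1.trans e)).symm
  · exact (lcEquiv a n M).toAddEquiv.trans (b.trans e1.symm.toAddEquiv)
  · rw [← AdicCompletion.maximalIdeal_eq_map]
    exact ⟨(e1.trans e).trans (lcEquiv (IsLocalRing.maximalIdeal (Rh R)) n _).symm⟩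

end LCX
end

theorem stmt3 (R : Type u) [CommRing R] [IsNoetherianRing R] [IsLocalRing R]
    (a : Ideal R) (ha : a ≠ ⊤) (M : Type u) [AddCommGroup M] [Module R M]
    [Module.Finite R M] (n : ℕ) (hdim : mdim R M = (n : ℕ∞))
    (hne : Nontrivial (LC a n M)) :
    ∃ N : Submodule (AdicCompletion (IsLocalRing.maximalIdeal R) R)
        (AdicCompletion (IsLocalRing.maximalIdeal R) M),
      Module.Finite (AdicCompletion (IsLocalRing.maximalIdeal R) R)
        (AdicCompletion (IsLocalRing.maximalIdeal R) M ⧸ N) ∧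
      associatedPrimes (AdicCompletion (IsLocalRing.maximalIdeal R) R)
          (AdicCompletion (IsLocalRing.maximalIdeal R) M ⧸ N) =
        Att (AdicCompletion (IsLocalRing.maximalIdeal R) R)
          (LC (a.map (algebraMap R (AdicCompletion (IsLocalRing.maximalIdeal R) R))) n
            (AdicCompletion (IsLocalRing.maximalIdeal R) M)) ∧
      Nonempty ((LC a n M : Type u) ≃+
        (LC (a.map (algebraMap R (AdicCompletion (IsLocalRing.maximalIdeal R) R))) n
          (AdicCompletion (IsLocalRing.maximalIdeal R) M) : Type u)) ∧
      Nonempty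
        ((LC (a.map (algebraMap R (AdicCompletion (IsLocalRing.maximalIdeal R) R))) n
            (AdicCompletion (IsLocalRing.maximalIdeal R) M)) ≃ₗ[AdicCompletion (IsLocalRing.maximalIdeal R) R]
          (LC ((IsLocalRing.maximalIdeal R).map
              (algebraMap R (AdicCompletion (IsLocalRing.maximalIdeal R) R))) n
            (AdicCompletion (IsLocalRing.maximalIdeal R) M ⧸ N))) := by
  exact LCX.final a ha M n hdim

end
end

section
/- Let (R, m) be a commutative Noetherian local ring, a an ideal, and M a finitely generated R-module of dimension n > 0. If H_a^n(M) ≠ 0, then H_a^n(M) is not a finitely generated R-module. -/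
noncomputable section

universe u

open CategoryTheory

namespace LCProof
open Limits Opposite

section ExtRep
variable {R : Type u} [CommRing R] {X Y : ModuleCat.{u} R}

abbrev FN (N : ModuleCat.{u} R) : ModuleCat.{u} R ⥤ (ModuleCat.{u} R)ᵒᵖ :=
  ((linearYoneda R (ModuleCat.{u} R)).obj N).rightOp

abbrev KN (P : ProjectiveResolution X) (N : ModuleCat.{u} R) :
    ChainComplex (ModuleCat.{u} R)ᵒᵖ ℕ :=
  ((FN N).mapHomologicalComplex _).obj P.complex

abbrev EX (n : ℕ) (X N : ModuleCat.{u} R) : ModuleCat.{u} R :=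
  ((Ext R (ModuleCat.{u} R) n).obj (op X)).obj N

/-- computing the derived functor -/
def isoD (P : ProjectiveResolution X) (N : ModuleCat.{u} R) (n : ℕ) :
    ((FN N).leftDerived n).obj X ≅ (KN P N).homology n :=
  P.isoLeftDerivedObj (FN N) n

/-- inclusion of cocycles -/
def zi (P : ProjectiveResolution X) (N : ModuleCat.{u} R) (n : ℕ) :
    unop ((KN P N).opcycles n) ⟶ unop ((KN P N).X n) :=
  ((KN P N).pOpcycles n).unop

/-- class of a cocycle -/
def zp (P : ProjectiveResolution X) (N : ModuleCat.{u} R) (n : ℕ) :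
    unop ((KN P N).opcycles n) ⟶ unop (((FN N).leftDerived n).obj X) :=
  ((KN P N).homologyι n).unop ≫ (isoD P N n).hom.unop

lemma zi_inj (P : ProjectiveResolution X) (N : ModuleCat.{u} R) (n : ℕ) :
    Function.Injective (zi P N n) := by
  rw [← ModuleCat.mono_iff_injective]
  exact unop_mono_of_epi ((KN P N).pOpcycles n)

lemma zp_surj (P : ProjectiveResolution X) (N : ModuleCat.{u} R) (n : ℕ) :
    Function.Surjective (zp P N n) := by
  rw [← ModuleCat.epi_iff_surjective]
  exact unop_epi_of_mono ((isoD P N n).hom ≫ (KN P N).homologyι n)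

lemma zi_exact (P : ProjectiveResolution X) (N : ModuleCat.{u} R) (n : ℕ)
    (f : P.complex.X n ⟶ N) : (∃ z, zi P N n z = f) ↔ P.complex.d (n+1) n ≫ f = 0 := by
  have h1 := (ShortComplex.exact_of_g_is_cokernel (.mk ((KN P N).d (n+1) n)
    ((KN P N).pOpcycles n) ((KN P N).d_pOpcycles _ _)) ((KN P N).opcyclesIsCokernel (n+1) n (by simp))).unop
  rw [ShortComplex.moduleCat_exact_iff] at h1
  constructor
  · rintro ⟨z, rfl⟩
    have h2 : zi P N n ≫ ((KN P N).d (n+1) n).unop = 0 := by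
      rw [zi, ← unop_comp, HomologicalComplex.d_pOpcycles]; rfl
    exact congr($h2 z)
  · intro h
    exact h1 f h

lemma zp_exact (P : ProjectiveResolution X) (N : ModuleCat.{u} R) (n : ℕ)
    (z : ↑(unop ((KN P N).opcycles n))) :
    zp P N n z = 0 ↔ ∃ j, ∃ g : P.complex.X j ⟶ N, zi P N n z = P.complex.d n j ≫ g := by
  have h1 := (ShortComplex.exact_of_f_is_kernel (.mk ((KN P N).homologyι n)
    ((KN P N).fromOpcycles n _) ((KN P N).homologyι_comp_fromOpcycles _ _))
      ((KN P N).homologyIsKernel n _ rfl)).unop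
  rw [ShortComplex.moduleCat_exact_iff] at h1
  constructor
  · intro h
    have h2 : ((KN P N).homologyι n).unop z = 0 := by
      have : Function.Injective (isoD P N n).hom.unop := by
        rw [← ModuleCat.mono_iff_injective]; infer_instance
      apply this
      rw [map_zero]; exact h
    obtain ⟨g, hg⟩ := h1 z h2
    refine ⟨_, g, ?_⟩
    rw [← hg]
    have h3 : ((KN P N).fromOpcycles n ((ComplexShape.down ℕ).next n)).unop ≫ zi P N n =
        ((KN P N).d n ((ComplexShape.down ℕ).next n)).unop := by
      rw [zi, ← unop_comp, HomologicalComplex.p_fromOpcycles]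
    exact congr($h3 g)
  · rintro ⟨j, g, hg⟩
    have h3 : ((KN P N).fromOpcycles n j).unop ≫ zi P N n = ((KN P N).d n _).unop := by
      rw [zi, ← unop_comp, HomologicalComplex.p_fromOpcycles]
    have h4 : z = ((KN P N).fromOpcycles n j).unop g := by
      apply zi_inj
      rw [hg]
      exact (congr($h3 g)).symm
    have h5 : ((KN P N).fromOpcycles n j).unop ≫ zp P N n = 0 := by
      rw [zp, ← Category.assoc, ← unop_comp, HomologicalComplex.homologyι_comp_fromOpcycles]
      simp
    rw [h4]
    exact congr($h5 g)

lemma zi_natX (P : ProjectiveResolution X) (Q : ProjectiveResolution Y)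
    (φ : P.complex ⟶ Q.complex) (N : ModuleCat.{u} R) (n : ℕ) 
    (z : ↑(unop ((KN Q N).opcycles n))) :
    zi P N n ((HomologicalComplex.opcyclesMap (((FN N).mapHomologicalComplex _).map φ) n).unop z)
      = φ.f n ≫ zi Q N n z := by
  have h := HomologicalComplex.p_opcyclesMap (((FN N).mapHomologicalComplex _).map φ) n
  have h' := congrArg Quiver.Hom.unop h
  exact congr($h' z)

lemma zp_natX (P : ProjectiveResolution X) (Q : ProjectiveResolution Y)
    (f : X ⟶ Y)
    (φ : P.complex ⟶ Q.complex) (comm : φ.f 0 ≫ Q.π.f 0 = P.π.f 0 ≫ f)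
    (N : ModuleCat.{u} R) (n : ℕ) 
    (z : ↑(unop ((KN Q N).opcycles n))) :
    zp P N n ((HomologicalComplex.opcyclesMap (((FN N).mapHomologicalComplex _).map φ) n).unop z)
      = ((Ext R (ModuleCat.{u} R) n).map f.op).app N (zp Q N n z) := by
  have h : ((FN N).leftDerived n).map f ≫ (isoD Q N n).hom =
    (isoD P N n).hom ≫ HomologicalComplex.homologyMap (((FN N).mapHomologicalComplex _).map φ) n :=
     ProjectiveResolution.isoLeftDerivedObj_hom_naturality f P Q φ comm (FN N) n
  have h2 := HomologicalComplex.homologyι_naturality (((FN N).mapHomologicalComplex _).map φ) n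
  have h3 : (isoD P N n).hom ≫ (KN P N).homologyι n ≫ 
      HomologicalComplex.opcyclesMap (((FN N).mapHomologicalComplex _).map φ) n = 
      ((FN N).leftDerived n).map f ≫ (isoD Q N n).hom ≫
        (KN Q N).homologyι n := by
    rw [← h2, reassoc_of% h]
  have h' := congrArg Quiver.Hom.unop h3
  exact congr($h' z)

lemma zi_natN (P : ProjectiveResolution X)
    {N N' : ModuleCat.{u} R} (v : N ⟶ N') (n : ℕ) 
    (z : ↑(unop ((KN P N).opcycles n))) :
    zi P N' n ((HomologicalComplex.opcyclesMap ((NatTrans.mapHomologicalComplex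
      ((linearYoneda R (ModuleCat.{u} R)).map v).rightOp _).app P.complex) n).unop z)
      = zi P N n z ≫ v := by
  have h := HomologicalComplex.p_opcyclesMap ((NatTrans.mapHomologicalComplex
      ((linearYoneda R (ModuleCat.{u} R)).map v).rightOp _).app P.complex) n
  have h' := congrArg Quiver.Hom.unop h
  exact congr($h' z)

lemma zp_natN (P : ProjectiveResolution X)
    {N N' : ModuleCat.{u} R} (v : N ⟶ N') (n : ℕ) 
    (z : ↑(unop ((KN P N).opcycles n))) :
    zp P N' n ((HomologicalComplex.opcyclesMap ((NatTrans.mapHomologicalComplex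
      ((linearYoneda R (ModuleCat.{u} R)).map v).rightOp _).app P.complex) n).unop z)
      = ((Ext R (ModuleCat.{u} R) n).obj (op X)).map v (zp P N n z) := by
  have h : (NatTrans.leftDerived (F := FN N') (G := FN N)
        ((linearYoneda R (ModuleCat.{u} R)).map v).rightOp n).app X =
      (isoD P N' n).hom ≫ HomologicalComplex.homologyMap ((NatTrans.mapHomologicalComplex
      ((linearYoneda R (ModuleCat.{u} R)).map v).rightOp _).app P.complex) n ≫ (isoD P N n).inv :=
    ProjectiveResolution.leftDerived_app_eq
    ((linearYoneda R (ModuleCat.{u} R)).map v).rightOp P n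
  have h2 := HomologicalComplex.homologyι_naturality ((NatTrans.mapHomologicalComplex
      ((linearYoneda R (ModuleCat.{u} R)).map v).rightOp _).app P.complex) n
  have h3 : (isoD P N' n).hom ≫ (KN P N').homologyι n ≫ 
      HomologicalComplex.opcyclesMap ((NatTrans.mapHomologicalComplex
      ((linearYoneda R (ModuleCat.{u} R)).map v).rightOp _).app P.complex) n = 
      (NatTrans.leftDerived ((linearYoneda R (ModuleCat.{u} R)).map v).rightOp n).app X 
       ≫ (isoD P N n).hom ≫
        (KN P N).homologyι n := by
    rw [← h2, h]
    simp
  have h' := congrArg Quiver.Hom.unop h3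
  exact congr($h' z)

end ExtRep

section LCRep
variable {R : Type u} [CommRing R] (J : Ideal R)

/-- the module `R ⧸ J^t` -/
abbrev XJ (t : ℕ) : ModuleCat.{u} R :=
  (localCohomology.ringModIdeals (localCohomology.idealPowersDiagram J)).obj (op t)

/-- transition maps -/
abbrev XJm {t s : ℕ} (h : t ≤ s) : XJ J s ⟶ XJ J t :=
  (localCohomology.ringModIdeals (localCohomology.idealPowersDiagram J)).map (homOfLE h).op

abbrev PR (t : ℕ) : ProjectiveResolution (XJ J t) := projectiveResolution (XJ J t)

def ph {t s : ℕ} (h : t ≤ s) : (PR J s).complex ⟶ (PR J t).complex :=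
  ProjectiveResolution.lift (XJm J h) (PR J s) (PR J t)

lemma ph_comm {t s : ℕ} (h : t ≤ s) :
    (ph J h).f 0 ≫ (PR J t).π.f 0 = (PR J s).π.f 0 ≫ XJm J h :=
  ProjectiveResolution.lift_commutes_zero _ _ _

abbrev dg (n : ℕ) := localCohomology.diagram (localCohomology.idealPowersDiagram J) n

/-- the colimit cocone -/
def lcCocone (n : ℕ) (N : ModuleCat.{u} R) :
    Cocone (dg J n ⋙ (evaluation _ _).obj N) :=
  ((evaluation _ _).obj N).mapCocone (colimit.cocone (dg J n))

def lcIsColimit (n : ℕ) (N : ModuleCat.{u} R) : IsColimit (lcCocone J n N) :=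
  isColimitOfPreserves ((evaluation _ _).obj N) (colimit.isColimit (dg J n))

abbrev HJ (n : ℕ) (N : ModuleCat.{u} R) : ModuleCat.{u} R := (localCohomology J n).obj N

instance : PreservesFilteredColimitsOfSize.{0, 0} (forget (ModuleCat.{u} R)) :=
  preservesFilteredColimitsOfSize_shrink.{0, u, 0, u} _

/-- class map into local cohomology -/
def io (n : ℕ) (N : ModuleCat.{u} R) (t : ℕ) :
    unop (((FN N).leftDerived n).obj (XJ J t)) ⟶ HJ J n N :=
  (colimit.ι (dg J n) (op (op t))).app N

lemma io_surj (n : ℕ) (N : ModuleCat.{u} R) (h : HJ J n N) : ∃ t e, io J n N t e = h := by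
  obtain ⟨t, e, he⟩ := Concrete.isColimit_exists_rep _ (lcIsColimit J n N) h
  exact ⟨t.unop.unop, e, he⟩

lemma io_nat (n : ℕ) {N N' : ModuleCat.{u} R} (v : N ⟶ N') (t : ℕ)
    (e : ↑(unop (((FN N).leftDerived n).obj (XJ J t)))) :
    (localCohomology J n).map v (io J n N t e) =
      io J n N' t (((Ext R (ModuleCat.{u} R) n).obj (op (XJ J t))).map v e) := by
  have h := (colimit.ι (dg J n) (op (op t))).naturality v
  exact (congr($h e)).symm

lemma io_trans (n : ℕ) (N : ModuleCat.{u} R) {t s : ℕ} (h : t ≤ s)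
    (e : ↑(unop (((FN N).leftDerived n).obj (XJ J t)))) :
    io J n N s (((Ext R (ModuleCat.{u} R) n).map (XJm J h).op).app N e) = io J n N t e := by
  have h := congr_app (colimit.w (dg J n) (homOfLE h).op.op) N
  exact congr($h e)

lemma io_zero (n : ℕ) (N : ModuleCat.{u} R) {t : ℕ}
    (e : ↑(unop (((FN N).leftDerived n).obj (XJ J t)))) (he : io J n N t e = 0) :
    ∃ s, ∃ h : t ≤ s, ((Ext R (ModuleCat.{u} R) n).map (XJm J h).op).app N e = 0 := by
  have h0 : (lcCocone J n N).ι.app (op (op t)) e = (lcCocone J n N).ι.app (op (op t)) 0 := by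
    rw [map_zero]; exact he
  obtain ⟨k, f, g, hk⟩ := Concrete.isColimit_exists_of_rep_eq _ (lcIsColimit J n N) _ _ h0
  refine ⟨k.unop.unop, leOfHom f.unop.unop, ?_⟩
  rw [map_zero] at hk
  exact hk

/-- `f` is a cocycle representing `h` -/
def Rep {n : ℕ} {N : ModuleCat.{u} R} (t : ℕ) (f : (PR J t).complex.X n ⟶ N) (h : HJ J n N) : Prop :=
  ∃ z, zi (PR J t) N n z = f ∧ io J n N t (zp (PR J t) N n z) = h

variable {J} {n : ℕ} {N N' : ModuleCat.{u} R}

lemma Rep.exists_of {t : ℕ} {f : (PR J t).complex.X n ⟶ N}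
    (hf : (PR J t).complex.d (n+1) n ≫ f = 0) : ∃ h, Rep J t f h := by
  obtain ⟨z, hz⟩ := (zi_exact _ _ _ f).2 hf
  exact ⟨_, z, hz, rfl⟩

lemma Rep.surj (h : HJ J n N) : ∃ t f, Rep J t f h := by
  obtain ⟨t, e, rfl⟩ := io_surj J n N h
  obtain ⟨z, rfl⟩ := zp_surj (PR J t) N n e
  exact ⟨t, _, z, rfl, rfl⟩

lemma Rep.cocycle {t : ℕ} {f : (PR J t).complex.X n ⟶ N} {h} (hf : Rep J t f h) :
    (PR J t).complex.d (n+1) n ≫ f = 0 := by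
  obtain ⟨z, hz, _⟩ := hf
  exact (zi_exact _ _ _ f).1 ⟨z, hz⟩

lemma Rep.sub {t : ℕ} {f f' : (PR J t).complex.X n ⟶ N} {h h'} (hf : Rep J t f h)
    (hf' : Rep J t f' h') : Rep J t (f - f') (h - h') := by
  obtain ⟨z, rfl, rfl⟩ := hf
  obtain ⟨z', rfl, rfl⟩ := hf'
  refine ⟨z - z', ?_, ?_⟩
  · exact map_sub (zi (PR J t) N n).hom z z'
  · simp

lemma Rep.trans {t s : ℕ} (hts : t ≤ s) {f : (PR J t).complex.X n ⟶ N} {h} (hf : Rep J t f h) :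
    Rep J s ((ph J hts).f n ≫ f) h := by
  obtain ⟨z, rfl, rfl⟩ := hf
  refine ⟨_, zi_natX (PR J s) (PR J t) (ph J hts) N n z, ?_⟩
  rw [zp_natX _ _ _ _ (ph_comm J hts), io_trans]

lemma Rep.map {t : ℕ} {f : (PR J t).complex.X n ⟶ N} {h} (hf : Rep J t f h) (v : N ⟶ N') :
    Rep J t (f ≫ v) ((localCohomology J n).map v h) := by
  obtain ⟨z, rfl, rfl⟩ := hf
  refine ⟨_, zi_natN (PR J t) v n z, ?_⟩
  rw [zp_natN, io_nat]

lemma Rep.bdry {t j : ℕ} {f : (PR J t).complex.X n ⟶ N} {h} (hf : Rep J t f h)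
    (g : (PR J t).complex.X j ⟶ N) (hg : f = (PR J t).complex.d n j ≫ g) : h = 0 := by
  obtain ⟨z, rfl, rfl⟩ := hf
  rw [(zp_exact (PR J t) N n z).2 ⟨j, g, hg⟩, map_zero]

lemma Rep.of_bdry {t j : ℕ} 
    (g : (PR J t).complex.X j ⟶ N) : Rep J t ((PR J t).complex.d n j ≫ g) 0 := by
  obtain ⟨h, hh⟩ := Rep.exists_of (J := J) (f := (PR J t).complex.d n j ≫ g) (by simp)
  rwa [hh.bdry g rfl] at hh

lemma Rep.zero {t : ℕ} {f : (PR J t).complex.X n ⟶ N} (hf : Rep J t f 0) :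
    ∃ s, ∃ hts : t ≤ s, ∃ j, ∃ g : (PR J s).complex.X j ⟶ N,
      (ph J hts).f n ≫ f = (PR J s).complex.d n j ≫ g := by
  obtain ⟨z, rfl, h0⟩ := hf
  obtain ⟨s, hts, hs⟩ := io_zero J n N _ h0
  rw [← zp_natX _ _ _ _ (ph_comm J hts)] at hs
  obtain ⟨j, g, hg⟩ := (zp_exact (PR J s) N n _).1 hs
  refine ⟨s, hts, j, g, ?_⟩
  rw [← hg, zi_natX]

lemma Rep.unique {t : ℕ} {f : (PR J t).complex.X n ⟶ N} {h h'} (hf : Rep J t f h)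
    (hf' : Rep J t f h') : h = h' := by
  obtain ⟨z, rfl, rfl⟩ := hf
  obtain ⟨z', h1, rfl⟩ := hf'
  rw [zi_inj _ _ _ h1]
end LCRep

section LES
variable {R : Type u} [CommRing R] {J : Ideal R} {n : ℕ} {N N' : ModuleCat.{u} R}

lemma Rep.smul {t : ℕ} {f : (PR J t).complex.X n ⟶ N} {h} (hf : Rep J t f h) (r : R) :
    Rep J t (r • f) (r • h) := by
  obtain ⟨z, rfl, rfl⟩ := hf
  refine ⟨r • z, ?_, ?_⟩
  · exact map_smul (zi (PR J t) N n).hom r z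
  · simp

lemma map_smul_id (r : R) (h : HJ J n N) : (localCohomology J n).map (r • 𝟙 N) h = r • h := by
  obtain ⟨t, f, hf⟩ := Rep.surj h
  have h1 := hf.map (r • 𝟙 N)
  rw [Linear.comp_smul, Category.comp_id] at h1
  exact h1.unique (hf.smul r)

lemma Rep.torsion {t : ℕ} {f : (PR J t).complex.X n ⟶ N} {h} (hf : Rep J t f h) (r : R)
    (hr : r ∈ J ^ t) : r • h = 0 := by
  have h0 : r • 𝟙 (XJ J t) = 0 := by
    ext x
    obtain ⟨x, rfl⟩ := Ideal.Quotient.mk_surjective x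
    change (Ideal.Quotient.mk (J ^ t) (r * x)) = 0
    rw [Ideal.Quotient.eq_zero_iff_mem]
    exact Ideal.mul_mem_right _ _ hr
  have comm : (r • 𝟙 (PR J t).complex) ≫ (PR J t).π = 0 := by
    ext1
    have : ∀ p : (PR J t).complex.X 0 ⟶ XJ J t, r • p = 0 := fun p => by
      rw [← Category.comp_id p, ← Linear.comp_smul, h0, comp_zero]
    rw [Linear.smul_comp, Category.id_comp]
    exact this ((PR J t).π.f 0)
  have H := ProjectiveResolution.liftHomotopyZero _ comm
  have H1 := H.comm n
  rw [prevD_eq H.hom (show (ComplexShape.down ℕ).Rel (n+1) n by simp)] at H1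
  simp only [HomologicalComplex.smul_f_apply, HomologicalComplex.id_f,
    HomologicalComplex.zero_f, add_zero, dNext] at H1
  refine (hf.smul r).bdry (H.hom ((ComplexShape.down ℕ).next n) n ≫ f) ?_
  have H2 := congr($H1 ≫ f)
  simpa [hf.cocycle] using H2

variable {S : ShortComplex (ModuleCat.{u} R)} (hS : S.ShortExact)
include hS

lemma exact_mid (h : HJ J n S.X₂) (h0 : (localCohomology J n).map S.g h = 0) :
    ∃ k, (localCohomology J n).map S.f k = h := by
  have := hS.mono_f
  have := hS.epi_g
  obtain ⟨t, f, hf⟩ := Rep.surj h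
  have h1 := hf.map S.g
  rw [h0] at h1
  obtain ⟨s, hts, j, g, hg⟩ := h1.zero
  let g' := Projective.factorThru g S.g
  have hg' : g' ≫ S.g = g := Projective.factorThru_comp _ _
  let k := hS.exact.lift ((ph J hts).f n ≫ f - (PR J s).complex.d n j ≫ g') (by simp [hg', hg])
  have hk : k ≫ S.f = (ph J hts).f n ≫ f - (PR J s).complex.d n j ≫ g' := hS.exact.lift_f _ _
  obtain ⟨e, he⟩ := Rep.exists_of (J := J) (f := k) (by
    rw [← cancel_mono S.f, Category.assoc, hk, Preadditive.comp_sub, (hf.trans hts).cocycle]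
    simp)
  refine ⟨e, ?_⟩
  have h2 := he.map S.f
  rw [hk] at h2
  have h3 := (hf.trans hts).sub (Rep.of_bdry (n := n) g')
  rw [sub_zero] at h3
  exact h2.unique h3

lemma surj_of (hz : ∀ k : HJ J (n+1) S.X₁, k = 0) (h : HJ J n S.X₃) :
    ∃ k, (localCohomology J n).map S.g k = h := by
  have := hS.mono_f
  have := hS.epi_g
  obtain ⟨t, f, hf⟩ := Rep.surj h
  let g := Projective.factorThru f S.g
  have hg : g ≫ S.g = f := Projective.factorThru_comp _ _
  let k := hS.exact.lift ((PR J t).complex.d (n+1) n ≫ g) (by simp [hg, hf.cocycle])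
  have hk : k ≫ S.f = (PR J t).complex.d (n+1) n ≫ g := hS.exact.lift_f _ _
  obtain ⟨e, he⟩ := Rep.exists_of (J := J) (f := k) (by
    rw [← cancel_mono S.f, Category.assoc, hk]
    simp)
  rw [hz e] at he
  obtain ⟨s, hts, j, l, hl⟩ := he.zero
  by_cases hj : (ComplexShape.down ℕ).Rel (n+1) j
  · obtain rfl : j = n := by simpa using hj
    obtain ⟨e', he'⟩ := Rep.exists_of (J := J) (f := (ph J hts).f _ ≫ g - l ≫ S.f) (by
      rw [Preadditive.comp_sub, ← Category.assoc _ l, ← hl, Category.assoc, hk]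
      simp)
    refine ⟨e', ?_⟩
    have h2 := he'.map S.g
    simp only [Preadditive.sub_comp, Category.assoc, hg, S.zero, comp_zero, sub_zero] at h2
    exact h2.unique (hf.trans hts)
  · rw [HomologicalComplex.shape _ _ _ hj, zero_comp] at hl
    obtain ⟨e', he'⟩ := Rep.exists_of (J := J) (f := (ph J hts).f _ ≫ g) (by
      rw [← HomologicalComplex.Hom.comm_assoc, ← hk, reassoc_of% hl, zero_comp])
    refine ⟨e', ?_⟩
    have h2 := he'.map S.g
    simp only [Category.assoc, hg] at h2
    exact h2.unique (hf.trans hts)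

lemma inj_of (hz : ∀ h : HJ J n S.X₃, ∃ k, (localCohomology J n).map S.g k = h)
    (h : HJ J (n+1) S.X₁) (h0 : (localCohomology J (n+1)).map S.f h = 0) : h = 0 := by
  have := hS.mono_f
  have := hS.epi_g
  obtain ⟨t, f, hf⟩ := Rep.surj h
  have h1 := hf.map S.f
  rw [h0] at h1
  obtain ⟨s, hts, j, g, hg⟩ := h1.zero
  have hf' := hf.trans hts
  rw [← Category.assoc] at hg
  generalize (ph J hts).f (n+1) ≫ f = f' at hg hf'
  by_cases hj : (ComplexShape.down ℕ).Rel (n+1) j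
  swap
  · rw [HomologicalComplex.shape _ _ _ hj, zero_comp] at hg
    have : f' = 0 := by rw [← cancel_mono S.f, hg, zero_comp]
    exact hf'.bdry (0 : (PR J s).complex.X n ⟶ _) (by simp [this])
  obtain rfl : j = n := by simpa using hj
  obtain ⟨e, he⟩ := Rep.exists_of (J := J) (f := g ≫ S.g) (by
    rw [← Category.assoc, ← hg]; simp)
  obtain ⟨k, hk⟩ := hz e
  obtain ⟨t', f2, hf2⟩ := Rep.surj k
  have h3 := (he.trans (le_max_left s t')).sub ((hf2.map S.g).trans (le_max_right s t'))
  rw [hk, sub_self] at h3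
  have hg2 := congr((ph J (le_max_left s t')).f _ ≫ $hg)
  have hf3 := hf'.trans (le_max_left s t')
  rw [← Category.assoc] at hg2
  obtain ⟨w, hw, i, b, hb⟩ := h3.zero
  have hg3 := congr((ph J hw).f _ ≫ $hg2)
  have hf4 := hf3.trans hw
  rw [← Category.assoc] at hg3
  have hf2' := ((hf2.trans (le_max_right s t')).trans hw).cocycle
  let b' := Projective.factorThru b S.g
  have hb' : b' ≫ S.g = b := Projective.factorThru_comp _ _
  let q := (ph J hw).f _ ≫ (ph J (le_max_left s t')).f _ ≫ g -
    (ph J hw).f _ ≫ (ph J (le_max_right s t')).f _ ≫ f2 - (PR J w).complex.d _ i ≫ b'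
  have hq : q ≫ S.g = 0 := by
    simp only [q, Preadditive.sub_comp, Category.assoc, hb', ← hb, Preadditive.comp_sub]
    simp
  refine hf4.bdry (hS.exact.lift q hq) ?_
  rw [← cancel_mono S.f, hg3, Category.assoc, hS.exact.lift_f]
  simp only [q, Preadditive.comp_sub, hf2']
  simp
end LES

section Tor
variable {R : Type u} [CommRing R] (J : Ideal R)

def IsTor (M : Type u) [AddCommGroup M] [Module R M] : Prop :=
  ∀ y : M, ∃ k : ℕ, ∀ r ∈ J ^ k, r • y = 0

/-- the `J`-torsion submodule -/
def Gam (M : Type u) [AddCommGroup M] [Module R M] : Submodule R M where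
  carrier := {y | ∃ k : ℕ, ∀ r ∈ J ^ k, r • y = 0}
  zero_mem' := ⟨0, by simp⟩
  add_mem' := by
    rintro x y ⟨k, hk⟩ ⟨l, hl⟩
    refine ⟨k + l, fun r hr => ?_⟩
    rw [smul_add, hk r (Ideal.pow_le_pow_right (by simp) hr),
      hl r (Ideal.pow_le_pow_right (by simp) hr), add_zero]
  smul_mem' := by
    rintro c y ⟨k, hk⟩
    exact ⟨k, fun r hr => by rw [smul_comm, hk r hr, smul_zero]⟩

variable {J} {M : Type u} [AddCommGroup M] [Module R M]

lemma mem_Gam {y : M} : y ∈ Gam J M ↔ ∃ k : ℕ, ∀ r ∈ J ^ k, r • y = 0 := Iff.rfl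

lemma isTor_Gam : IsTor J (Gam J M) := fun ⟨_, k, hk⟩ =>
  ⟨k, fun r hr => Subtype.ext (hk r hr)⟩

lemma unif {T : Type u} [AddCommGroup T] [Module R T] [Module.Finite R T] (g : T →ₗ[R] M)
    (hg : ∀ x, ∃ k : ℕ, ∀ r ∈ J ^ k, r • g x = 0) :
    ∃ k : ℕ, ∀ r ∈ J ^ k, ∀ x, r • g x = 0 := by
  obtain ⟨s, hs⟩ := Module.Finite.fg_top (R := R) (M := T)
  choose k hk using hg
  refine ⟨s.sup k, fun r hr x => ?_⟩
  have hx : x ∈ Submodule.span R (s : Set T) := hs ▸ Submodule.mem_top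
  induction hx using Submodule.span_induction with
  | mem x hx => exact hk x r (Ideal.pow_le_pow_right (Finset.le_sup hx) hr)
  | zero => simp
  | add x y _ _ hx hy => simp [hx, hy]
  | smul a x _ hx => rw [map_smul, smul_comm, hx, smul_zero]

lemma inj_Gam [IsNoetherianRing R] (E : Type u) [AddCommGroup E] [Module R E]
    [Module.Injective R E] : Module.Injective R (Gam J E) := by
  apply Module.Baer.injective
  intro I g
  obtain ⟨K, hK⟩ := unif (J := J) g (fun x => isTor_Gam _)
  obtain ⟨k, hk⟩ := Ideal.exists_pow_inf_eq_pow_smul J (I : Submodule R R)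
  have h1 : ∀ x : I, (x : R) ∈ J ^ (K + k) → g x = 0 := by
    rintro ⟨x, hxI⟩ hx
    have hx' : x ∈ J ^ K • (J ^ k • ⊤ ⊓ I : Submodule R R) := by
      have := hk (K + k) (by simp)
      rw [Nat.add_sub_cancel] at this
      rw [← this]
      exact ⟨by simpa using hx, hxI⟩
    have h2 : J ^ K • (J ^ k • ⊤ ⊓ I : Submodule R R) ≤ (LinearMap.ker g).map I.subtype := by
      rw [Submodule.smul_le]
      intro r hr n hn
      exact ⟨r • ⟨n, hn.2⟩, by
        rw [SetLike.mem_coe, LinearMap.mem_ker, map_smul]; exact hK r hr _, rfl⟩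
    obtain ⟨y, hy, hyx⟩ := h2 hx'
    have : y = ⟨x, hxI⟩ := Subtype.ext hyx
    rw [← this]; exact hy
  let q : I →ₗ[R] (R ⧸ J ^ (K + k)) := (Submodule.mkQ (J ^ (K + k))) ∘ₗ I.subtype
  have hq : LinearMap.ker q ≤ LinearMap.ker g := by
    intro x hx
    apply h1
    exact (Submodule.Quotient.mk_eq_zero _).1 hx
  obtain ⟨h, hh⟩ := Module.Injective.out (Q := E) ((LinearMap.ker q).liftQ q le_rfl)
    (by rw [← LinearMap.ker_eq_bot]; exact Submodule.ker_liftQ_eq_bot _ _ _ le_rfl)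
    ((LinearMap.ker q).liftQ ((Gam J E).subtype ∘ₗ g) (by
      rw [LinearMap.ker_comp_of_ker_eq_bot _ (Submodule.ker_subtype _)]; exact hq))
  refine ⟨(h ∘ₗ Submodule.mkQ (J ^ (K + k))).codRestrict _ (fun x => ⟨K + k, fun r hr => ?_⟩), ?_⟩
  · rw [← map_smul]
    have : (Submodule.mkQ (J ^ (K + k))) (r • x) = 0 := by
      rw [Submodule.mkQ_apply, Submodule.Quotient.mk_eq_zero]
      exact Ideal.mul_mem_right _ _ hr
    rw [LinearMap.comp_apply, this, map_zero]
  · intro x hx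
    apply Subtype.ext
    have := hh (Submodule.Quotient.mk ⟨x, hx⟩)
    exact this

lemma HJ_injective (n : ℕ) (E : ModuleCat.{u} R) [Injective E] (h : HJ J (n+1) E) : h = 0 := by
  obtain ⟨t, f, hf⟩ := Rep.surj h
  refine hf.bdry (((PR J t).exact_succ n).descToInjective f hf.cocycle) ?_
  exact (((PR J t).exact_succ n).comp_descToInjective f hf.cocycle).symm

lemma surj_zero {B C : ModuleCat.{u} R} (hB : IsTor J B) (g : B ⟶ C)
    (hg : Function.Surjective g) (h : HJ J 0 C) : ∃ k, (localCohomology J 0).map g k = h := by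
  obtain ⟨t, f, hf⟩ := Rep.surj h
  let p : ∀ t, (PR J t).complex.X 0 ⟶ XJ J t := fun t => (PR J t).π.f 0
  obtain ⟨c, hc⟩ : ∃ c : XJ J t ⟶ C, p t ≫ c = f :=
    ⟨(PR J t).exact₀.desc f hf.cocycle, (PR J t).exact₀.g_desc f hf.cocycle⟩
  obtain ⟨y, hy⟩ := hg (c (Submodule.Quotient.mk (p := J ^ t) (1 : R)))
  obtain ⟨k, hk⟩ := hB y
  have hts : t ≤ max t k := le_max_left _ _
  let b : XJ J (max t k) ⟶ B := ModuleCat.ofHom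
    (Submodule.liftQ (J ^ (max t k)) (LinearMap.toSpanSingleton R B y) (fun r hr => by
      rw [LinearMap.mem_ker, LinearMap.toSpanSingleton_apply]
      exact hk r (Ideal.pow_le_pow_right (le_max_right _ _) hr)))
  have hb : b ≫ g = XJm J hts ≫ c := by
    ext x
    obtain ⟨x, rfl⟩ := Submodule.Quotient.mk_surjective _ x
    change g (x • y) = c (Submodule.Quotient.mk x)
    rw [map_smul, hy]
    refine (map_smul c.hom x (Submodule.Quotient.mk (p := J ^ t) (1 : R))).symm.trans ?_
    have h1 : (x • Submodule.Quotient.mk (1 : R) : R ⧸ J ^ t) = Submodule.Quotient.mk x := by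
      rw [← Submodule.Quotient.mk_smul, smul_eq_mul, mul_one]
    exact congrArg c.hom h1
  obtain ⟨e, he⟩ := Rep.exists_of (J := J) (f := p (max t k) ≫ b) (by
    have : (PR J (max t k)).complex.d 1 0 ≫ p (max t k) = 0 :=
      (PR J (max t k)).complex_d_comp_π_f_zero
    rw [reassoc_of% this, zero_comp])
  refine ⟨e, (he.map g).unique ?_⟩
  have h2 := hf.trans hts
  have h3 : (ph J hts).f 0 ≫ p t = p _ ≫ XJm J hts := ph_comm J hts
  rw [← hc, reassoc_of% h3, ← hb] at h2
  simpa using h2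

/-- short exact sequence of a quotient -/
lemma ses_ker {A B : ModuleCat.{u} R} (i : A ⟶ B) (hi : Function.Injective i) :
    (ShortComplex.mk i (ModuleCat.ofHom (LinearMap.range i.hom).mkQ) (by
      ext x; simp)).ShortExact where
  exact := by
    rw [ShortComplex.moduleCat_exact_iff]
    intro x hx
    have : x ∈ LinearMap.range i.hom := by simpa using hx
    exact this
  mono_f := (ModuleCat.mono_iff_injective _).2 hi
  epi_g := (ModuleCat.epi_iff_surjective _).2 (Submodule.mkQ_surjective _)

lemma exists_env [IsNoetherianRing R] (N : ModuleCat.{u} R) (hN : IsTor J N) :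
    ∃ E : ModuleCat.{u} R, Injective E ∧ IsTor J E ∧ ∃ i : N ⟶ E, Function.Injective i := by
  obtain ⟨E0, hE0, ι, hι⟩ : ∃ (E0 : ModuleCat.{u} R) (_ : Injective E0) (ι : N ⟶ E0), Mono ι :=
    ⟨Injective.under (C := ModuleCat.{u} R) N, inferInstance,
      Injective.ι (C := ModuleCat.{u} R) N, inferInstance⟩
  have : Injective (ModuleCat.of R E0) := hE0
  have := Module.injective_module_of_injective_object R E0
  have := inj_Gam (J := J) E0
  have hi : Function.Injective ι := (ModuleCat.mono_iff_injective _).1 inferInstance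
  refine ⟨ModuleCat.of R (Gam J E0),
    Module.injective_object_of_injective_module R _, isTor_Gam,
    ModuleCat.ofHom (ι.hom.codRestrict _ (fun x => ?_)), ?_⟩
  · obtain ⟨k, hk⟩ := hN x
    refine ⟨k, fun r hr => ?_⟩
    rw [← map_smul, hk r hr, map_zero]
  · intro x y hxy
    exact hi (congrArg Subtype.val hxy)

lemma tor_vanish [IsNoetherianRing R] (n : ℕ) (N : ModuleCat.{u} R) (hN : IsTor J N)
    (h : HJ J (n+1) N) : h = 0 := by
  induction n generalizing N with
  | zero =>
    obtain ⟨E, hE, hEt, i, hi⟩ := exists_env N hN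
    refine inj_of (ses_ker i hi) ?_ h (HJ_injective 0 E _)
    exact surj_zero hEt _ (Submodule.mkQ_surjective _)
  | succ n ih =>
    obtain ⟨E, hE, hEt, i, hi⟩ := exists_env N hN
    refine inj_of (ses_ker i hi) ?_ h (HJ_injective _ E _)
    intro h
    refine ⟨0, ?_⟩
    rw [map_zero]
    refine (ih _ ?_ h).symm
    intro y
    obtain ⟨y, rfl⟩ := Submodule.mkQ_surjective _ y
    obtain ⟨k, hk⟩ := hEt y
    refine ⟨k, fun r hr => ?_⟩
    rw [← map_smul, hk r hr, map_zero]
end Tor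

section Main
variable {R : Type u} [CommRing R] {J : Ideal R}

lemma dim_aux {D : WithBot ℕ∞} {n : ℕ} (h : D + 1 ≤ (n : ℕ∞)) : D < ((n : ℕ∞) : WithBot ℕ∞) := by
  induction D using WithBot.recBotCoe with
  | bot => exact WithBot.bot_lt_coe _
  | coe d =>
    have h' : d + 1 ≤ (n : ℕ∞) := by exact_mod_cast h
    rw [WithBot.coe_lt_coe]
    induction d using ENat.recTopCoe with
    | top => simp at h'
    | coe d => exact_mod_cast h'

lemma dim_aux2 {D : WithBot ℕ∞} {n : ℕ} (h : D < (((n + 1 : ℕ) : ℕ∞) : WithBot ℕ∞)) :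
    D ≤ ((n : ℕ∞) : WithBot ℕ∞) := by
  induction D using WithBot.recBotCoe with
  | bot => exact bot_le
  | coe d =>
    rw [WithBot.coe_lt_coe] at h
    rw [WithBot.coe_le_coe]
    induction d using ENat.recTopCoe with
    | top => simp at h
    | coe d =>
      have : d < n + 1 := by exact_mod_cast h
      exact_mod_cast Nat.lt_succ_iff.1 this

lemma exists_reg [IsNoetherianRing R] (N : Type u) [AddCommGroup N] [Module R N]
    [Module.Finite R N] : ∃ x ∈ J, IsSMulRegular (N ⧸ Gam J N) x := by
  by_contra! hcon
  have hsub : (J : Set R) ⊆ ⋃ p ∈ associatedPrimes R (N ⧸ Gam J N), p := by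
    intro x hx
    rw [biUnion_associatedPrimes_eq_zero_divisors]
    have := hcon x hx
    rw [isSMulRegular_iff_right_eq_zero_of_smul] at this
    push Not at this
    obtain ⟨y, hy, hy0⟩ := this
    exact ⟨y, hy0, hy⟩
  obtain ⟨p, hp, hJp⟩ := (J.subset_union_prime_finite
    (associatedPrimes.finite R (N ⧸ Gam J N)) (f := id) 0 0 fun _ h _ _ ↦ h.isPrime).1 hsub
  rw [AssociatedPrimes.mem_iff, isAssociatedPrime_iff] at hp
  obtain ⟨hpp, y, hy⟩ := hp
  obtain ⟨z, rfl⟩ := Submodule.mkQ_surjective _ y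
  have hJz : ∀ r ∈ J, r • z ∈ Gam J N := by
    intro r hr
    have h1 : r ∈ p := hJp hr
    rw [hy, Submodule.mem_colon_singleton, Submodule.mem_bot, ← map_smul] at h1
    exact (Submodule.Quotient.mk_eq_zero _).1 h1
  obtain ⟨K, hK⟩ := unif (J := J) (Gam J N).subtype (fun x => x.2)
  have hz : z ∈ Gam J N := by
    refine ⟨K + 1, fun r hr => ?_⟩
    rw [pow_succ] at hr
    induction hr using Submodule.mul_induction_on' with
    | mem_mul_mem m hm n hn => rw [mul_smul]; exact hK m hm ⟨_, hJz n hn⟩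
    | add x _ y _ hx hy => rw [add_smul, hx, hy, add_zero]
  apply hpp.ne_top
  rw [hy, Ideal.eq_top_iff_one, Submodule.mem_colon_singleton, one_smul, Submodule.mem_bot]
  exact (Submodule.Quotient.mk_eq_zero _).2 hz

lemma HJ_of_subsingleton (n : ℕ) (N : ModuleCat.{u} R) [Subsingleton N] (h : HJ J n N) :
    h = 0 := by
  obtain ⟨t, f, hf⟩ := Rep.surj h
  obtain rfl : f = 0 := by ext x; exact Subsingleton.elim _ _
  have h2 := hf.sub hf
  rw [sub_zero, sub_self] at h2
  exact hf.unique h2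

lemma ses_Gam (N : Type u) [AddCommGroup N] [Module R N] :
    (ShortComplex.mk (ModuleCat.ofHom (Gam J N).subtype) (ModuleCat.ofHom (Gam J N).mkQ) (by
      ext x; simp)).ShortExact where
  exact := by
    rw [ShortComplex.moduleCat_exact_iff]
    intro x hx
    have : x ∈ Gam J N := (Submodule.Quotient.mk_eq_zero _).1 hx
    exact ⟨⟨x, this⟩, rfl⟩
  mono_f := (ModuleCat.mono_iff_injective _).2 Subtype.val_injective
  epi_g := (ModuleCat.epi_iff_surjective _).2 (Submodule.mkQ_surjective _)

lemma Gam_inj [IsNoetherianRing R] (n : ℕ) (N : Type u) [AddCommGroup N] [Module R N]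
    (h : HJ J (n+1) (ModuleCat.of R N))
    (h0 : (localCohomology J (n+1)).map (ModuleCat.ofHom (Gam J N).mkQ) h = 0) : h = 0 := by
  obtain ⟨k, rfl⟩ := exact_mid (ses_Gam N) h h0
  have : k = 0 := tor_vanish n _ isTor_Gam k
  rw [this, map_zero]

lemma Gam_surj [IsNoetherianRing R] (n : ℕ) (N : Type u) [AddCommGroup N] [Module R N]
    (h : HJ J n (ModuleCat.of R (N ⧸ Gam J N))) :
    ∃ k, (localCohomology J n).map (ModuleCat.ofHom (Gam J N).mkQ) k = h :=
  surj_of (ses_Gam N) (tor_vanish n _ isTor_Gam) h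

lemma smul_inj {N : ModuleCat.{u} R} {x : R} (hx : IsSMulRegular N x) :
    Function.Injective (x • 𝟙 N : N ⟶ N) := fun _ _ h => hx h

/-- the quotient of `N` by the image of multiplication by `x` -/
abbrev Qx (N : ModuleCat.{u} R) (x : R) : ModuleCat.{u} R :=
  ModuleCat.of R (N ⧸ LinearMap.range (x • 𝟙 N : N ⟶ N).hom)

open scoped Pointwise in
lemma dim_Qx [IsNoetherianRing R] [IsLocalRing R] (N : ModuleCat.{u} R) [Module.Finite R N]
    {x : R} (hx : IsSMulRegular N x) (hxm : x ∈ IsLocalRing.maximalIdeal R) {n : ℕ}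
    (hd : Module.supportDim R N ≤ (n : ℕ∞)) : Module.supportDim R (Qx N x) < (n : ℕ∞) := by
  refine lt_of_le_of_lt ?_
    (dim_aux ((Module.supportDim_quotSMulTop_succ_eq_supportDim hx hxm).trans_le hd))
  have hle : (x • ⊤ : Submodule R N) ≤ LinearMap.range (x • 𝟙 N : N ⟶ N).hom := by
    rintro _ ⟨y, -, rfl⟩
    exact ⟨y, rfl⟩
  exact Module.supportDim_le_of_surjective (Submodule.factor hle) (Submodule.factor_surjective hle)

theorem vanish [IsNoetherianRing R] [IsLocalRing R] (hJ : J ≤ IsLocalRing.maximalIdeal R) (n : ℕ)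
    (N : ModuleCat.{u} R) [Module.Finite R N] (hd : Module.supportDim R N < (n : ℕ∞))
    (h : HJ J n N) : h = 0 := by
  induction n generalizing N with
  | zero =>
    have : Subsingleton N := by
      rw [← Module.supportDim_eq_bot_iff_subsingleton (R := R)]
      by_contra hb
      obtain ⟨d, hd'⟩ := WithBot.ne_bot_iff_exists.1 hb
      rw [← hd', WithBot.coe_lt_coe] at hd
      simp at hd
    exact HJ_of_subsingleton 0 N h
  | succ n ih =>
    apply Gam_inj n N h
    generalize (localCohomology J (n+1)).map (ModuleCat.ofHom (Gam J N).mkQ) h = h'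
    obtain ⟨x, hxJ, hx⟩ := exists_reg (J := J) N
    have hd2 := (Module.supportDim_le_of_surjective _ (Submodule.mkQ_surjective (Gam J N))).trans
      (dim_aux2 hd)
    have hq := dim_Qx (ModuleCat.of R (N ⧸ Gam J N)) hx (hJ hxJ) hd2
    have key : ∀ k : HJ J (n+1) (ModuleCat.of R (N ⧸ Gam J N)), x • k = 0 → k = 0 := by
      intro k hk
      refine inj_of (ses_ker _ (smul_inj (N := ModuleCat.of R (N ⧸ Gam J N)) hx)) ?_ k
        ((map_smul_id x k).trans hk)
      intro l
      exact ⟨0, by rw [map_zero]; exact (ih (Qx _ x) hq l).symm⟩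
    obtain ⟨t, f, hf⟩ := Rep.surj h'
    have ht := hf.torsion (x ^ t) (Ideal.pow_mem_pow hxJ t)
    clear hf f
    induction t with
    | zero => simpa using ht
    | succ t iht => exact iht (key _ (by rw [← mul_smul, ← pow_succ']; exact ht))

theorem main [IsNoetherianRing R] [IsLocalRing R] (hJ : J ≤ IsLocalRing.maximalIdeal R) (n : ℕ)
    (N : Type u) [AddCommGroup N] [Module R N] [Module.Finite R N]
    (hd : Module.supportDim R N ≤ ((n + 1 : ℕ) : ℕ∞))
    (hfin : Module.Finite R (HJ J (n+1) (ModuleCat.of R N)))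
    (h : HJ J (n+1) (ModuleCat.of R N)) : h = 0 := by
  apply Gam_inj n N h
  generalize (localCohomology J (n+1)).map (ModuleCat.ofHom (Gam J N).mkQ) h = h'
  obtain ⟨x, hxJ, hx⟩ := exists_reg (J := J) N
  have hd2 := (Module.supportDim_le_of_surjective _ (Submodule.mkQ_surjective (Gam J N))).trans hd
  have hq := dim_Qx (ModuleCat.of R (N ⧸ Gam J N)) hx (hJ hxJ) hd2
  have hfin' : Module.Finite R (HJ J (n+1) (ModuleCat.of R (N ⧸ Gam J N))) :=
    Module.Finite.of_surjective
      ((localCohomology J (n+1)).map (ModuleCat.ofHom (Gam J N).mkQ)).hom (Gam_surj (n+1) N)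
  have key : ∀ k : HJ J (n+1) (ModuleCat.of R (N ⧸ Gam J N)), ∃ l, x • l = k := by
    intro k
    obtain ⟨l, hl⟩ := exact_mid (ses_ker _ (smul_inj (N := ModuleCat.of R (N ⧸ Gam J N)) hx)) k
      (vanish hJ (n+1) (Qx _ x) hq _)
    exact ⟨l, (map_smul_id x l).symm.trans hl⟩
  have htop : (⊤ : Submodule R (HJ J (n+1) (ModuleCat.of R (N ⧸ Gam J N)))) = ⊥ := by
    refine Submodule.eq_bot_of_le_smul_of_le_jacobson_bot (IsLocalRing.maximalIdeal R) _
      Module.Finite.fg_top ?_ (IsLocalRing.maximalIdeal_le_jacobson _)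
    intro k _
    obtain ⟨l, rfl⟩ := key k
    exact Submodule.smul_mem_smul (hJ hxJ) trivial
  exact (Submodule.mem_bot R).1 (htop ▸ Submodule.mem_top)

end Main
end LCProof

theorem stmt4 (R : Type u) [CommRing R] [IsNoetherianRing R] [IsLocalRing R]
    (a : Ideal R) (ha : a ≠ ⊤) (M : Type u) [AddCommGroup M] [Module R M]
    [Module.Finite R M] (n : ℕ) (hn : 0 < n) (hdim : mdim R M = (n : ℕ∞))
    (hne : Nontrivial (LC a n M)) :
    ¬ Module.Finite R (LC a n M) := by
  intro hfin
  obtain ⟨m, rfl⟩ : ∃ m, n = m + 1 := ⟨n - 1, by omega⟩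
  obtain ⟨h, hh⟩ := exists_ne (0 : LC a (m + 1) M)
  exact hh (LCProof.main (IsLocalRing.le_maximalIdeal ha) m M (le_of_eq hdim) hfin h)

end
end
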